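/- Assume the Riemann Hypothesis. Suppose λ₀ > 0 and r ∈ A(λ₀) satisfy c(λ₀;r) > 0. Then D(λ₀,T) ≫ 1 for all sufficiently large T (so liminf_{T→∞} D(λ₀,T) > 0), and consequently μ_D ≤ λ₀. -/

import Mathlib

open Filter MeasureTheory
open scoped Real

noncomputable section

/-- The multiplicity (order of vanishing) of the Riemann zeta function at a point `z`:
the least `n` such that the `n`-th derivative of `ζ` at `z` is nonzero. -/
def zetaMult (z : ℂ) : ℕ := sInf {n : ℕ | iteratedDeriv n riemannZeta z ≠ 0}

/-- Under RH, the set of ordinates `γ` with `0 < γ ≤ T` of nontrivial zeros `1/2 + iγ` of `ζ`. -/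
def zetaOrds (T : ℝ) : Set ℝ :=
  {γ : ℝ | 0 < γ ∧ γ ≤ T ∧ riemannZeta (1 / 2 + γ * Complex.I) = 0}

/-- The multiplicity of the zero of `ζ` at `1/2 + iγ`. -/
def ordMult (γ : ℝ) : ℕ := zetaMult (1 / 2 + γ * Complex.I)

/-- `N(T)`: the number of ordinates of nontrivial zeros in `(0, T]`, counted with multiplicity. -/
def zetaN (T : ℝ) : ℕ := ∑ᶠ γ ∈ zetaOrds T, ordMult γ

/-- The next ordinate of a nontrivial zero strictly above `γ`. -/
def nextOrd (γ : ℝ) : ℝ :=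
  sInf {γ' : ℝ | γ < γ' ∧ riemannZeta (1 / 2 + γ' * Complex.I) = 0}

/-- The number of ordinates `0 < γ ≤ T`, counted with multiplicity, whose successor `γ⁺` in the
nondecreasing sequence of ordinates (with multiplicity) satisfies `γ⁺ - γ ≤ 2πλ / log T`.
A distinct ordinate of multiplicity `m` contributes `m - 1` spacings equal to `0`, together
with the gap `nextOrd γ - γ` to the next distinct ordinate. -/
def Dcount (lam T : ℝ) : ℕ :=
  ∑ᶠ γ ∈ zetaOrds T,
    ((ordMult γ - 1) + if nextOrd γ - γ ≤ 2 * π * lam / Real.log T then 1 else 0)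

/-- `D(λ, T)`: the proportion of ordinates `0 < γ ≤ T` (with multiplicity) with
`γ⁺ - γ ≤ 2πλ / log T`. -/
def Dprop (lam T : ℝ) : ℝ := (Dcount lam T : ℝ) / (zetaN T : ℝ)

/-- The Fourier transform of an (even, real-valued) function `r`, written as a cosine
transform: `r̂(α) = ∫ r(u) cos(2παu) du`, which agrees with
`∫ r(u) e^{-2πiαu} du` for even real-valued `r`. -/
def fourierCos (r : ℝ → ℝ) (α : ℝ) : ℝ := ∫ u : ℝ, r u * Real.cos (2 * π * α * u)

/-- The class `𝒜(λ)` of even, continuous, real-valued `r ∈ L¹(ℝ)` with `r(0) = 1`,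
`r(u) ≤ 0` for `|u| > λ`, and nonnegative Fourier transform. -/
def memA (lam : ℝ) (r : ℝ → ℝ) : Prop :=
  Continuous r ∧ (∀ u : ℝ, r (-u) = r u) ∧ Integrable r ∧ r 0 = 1 ∧
    (∀ u : ℝ, lam < |u| → r u ≤ 0) ∧ ∀ α : ℝ, 0 ≤ fourierCos r α

/-- `c(λ; r) = r̂(0) - 1 + 2∫₀¹ α r̂(α) dα`. -/
def cOf (r : ℝ → ℝ) : ℝ :=
  fourierCos r 0 - 1 + 2 * ∫ α in (0:ℝ)..1, α * fourierCos r α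

open ArithmeticFunction (LSeriesSummable_vonMangoldt vonMangoldt vonMangoldt_le_log vonMangoldt_nonneg)
open Complex (GammaSeq GammaSeq_tendsto_Gamma Gamma_ne_zero_of_re_pos Gammaℝ Gammaℝ_def Gammaℝ_ne_zero_of_re_pos I abs_re_le_norm cderiv cderiv_eq_deriv continuous_re div_re exp_ofReal_mul_I_re exp_re im inv_re natCast_log normSq_apply norm_cpow_eq_rpow_re_of_pos norm_deriv_le_of_forall_mem_sphere_norm_le norm_exp norm_real ofReal_cpow ofReal_exp ofReal_re re reCLM_apply re_ofReal_mul re_sum sub_re)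
open Finset (Ioc card_filter mem_Ioc mem_filter mem_image mem_union mul_sum range sum_Ioc_consecutive sum_Ioc_succ_top sum_add_distrib sum_congr sum_const sum_filter sum_image sum_le_sum sum_mul sum_range_succ sum_singleton sum_sub_distrib sum_subtype_of_mem sum_union_inter)
open Real (abs_cos_le_one abs_sin_le_one add_one_le_exp cos cos_abs cos_add cos_le_one cos_neg cos_sub cos_zero exp exp_add exp_le_one_iff exp_log exp_nat_mul exp_neg exp_one_gt_d9 exp_one_lt_d9 exp_pos le_log_iff_exp_le log log_div log_exp log_le_iff_le_exp log_le_log log_le_sub_one_of_pos log_mul log_natCast_nonneg log_nonneg log_pow log_two_gt_d9 log_two_lt_d9 mul_rpow norm_eq_abs one_le_exp one_sub_inv_le_log_of_pos pi_gt_three pi_lt_four pi_pos quadratic_le_exp_of_nonneg rpow_add_one rpow_def_of_pos rpow_le_rpow rpow_le_rpow_of_exponent_le rpow_natCast rpow_neg rpow_nonneg sin sin_neg sq_sqrt sqrt_eq_rpow sqrt_le_left sqrt_mul sqrt_nonneg sqrt_sq two_pi_pos)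
open intervalIntegral (integral_add_adjacent_intervals integral_congr integral_eq_sub_of_hasDerivAt integral_mono_on integral_of_le)

lemma mll {a b c : ℝ} (h : b ≤ c) (a0 : 0 ≤ a) : a * b ≤ a * c := mul_le_mul_of_nonneg_left h a0
lemma mlr {a b c : ℝ} (h : b ≤ c) (a0 : 0 ≤ a) : b * a ≤ c * a := mul_le_mul_of_nonneg_right h a0
lemma evA {α : Type*} {p : α → Prop} {f : Filter α} (h : ∀ x, p x) : ∀ᶠ x in f, p x := Eventually.of_forall h

lemma div_entire {g : ℂ → ℂ} (hg : Differentiable ℂ g) {ρ : ℂ} {n : ℕ}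
    (hn : analyticOrderAt g ρ = n) :
    ∃ q : ℂ → ℂ, Differentiable ℂ q ∧ q ρ ≠ 0 ∧ ∀ z, g z = (z - ρ) ^ n * q z := by
  classical
  obtain ⟨p, hp, hp0, he⟩ := (hg.analyticAt ρ).analyticOrderAt_eq_natCast.1 hn
  refine ⟨fun z => if z = ρ then p ρ else g z / (z - ρ) ^ n, ?_, by simpa using hp0, ?_⟩
  · intro z
    by_cases hz : z = ρ
    · subst hz
      refine hp.differentiableAt.congr_of_eventuallyEq ?_
      filter_upwards [he] with w hw
      by_cases h : w = z
      · simp [h]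
      · have : (w - z) ^ n ≠ 0 := pow_ne_zero _ (sub_ne_zero.2 h)
        simp only [h, if_false, hw, smul_eq_mul]; field_simp
    · have : DifferentiableAt ℂ (fun z => g z / (z - ρ) ^ n) z :=
        (hg z).div (by fun_prop) (pow_ne_zero _ (sub_ne_zero.2 hz))
      refine this.congr_of_eventuallyEq ?_
      filter_upwards [isOpen_ne.mem_nhds hz] with w hw
      simp [show w ≠ ρ from hw]
  · intro z
    by_cases hz : z = ρ
    · subst hz; have := he.self_of_nhds; simpa using this
    · have : (z - ρ) ^ n ≠ 0 := pow_ne_zero _ (sub_ne_zero.2 hz)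
      simp only [hz, if_false]; field_simp

lemma div_finset {F : ℂ → ℂ} (hF : Differentiable ℂ F) (hfin : ∀ z, analyticOrderAt F z ≠ ⊤)
    (S : Finset ℂ) :
    ∃ g : ℂ → ℂ, Differentiable ℂ g ∧ (∀ ρ ∈ S, g ρ ≠ 0) ∧
      ∀ z, F z = (∏ ρ ∈ S, (z - ρ) ^ analyticOrderNatAt F ρ) * g z := by
  classical
  induction S using Finset.induction_on with
  | empty => exact ⟨F, hF, by simp, by simp⟩
  | insert a S ha ih =>
    obtain ⟨g, hg, hg0, hFg⟩ := ih
    have hP : Differentiable ℂ (fun z => ∏ ρ ∈ S, (z - ρ) ^ analyticOrderNatAt F ρ) := by fun_prop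
    have hPa : (∏ ρ ∈ S, (a - ρ) ^ analyticOrderNatAt F ρ) ≠ 0 :=
      Finset.prod_ne_zero_iff.2 fun ρ hρ => pow_ne_zero _ (sub_ne_zero.2 (by
        rintro rfl; exact ha hρ))
    have hord : analyticOrderAt g a = (analyticOrderNatAt F a : ℕ) := by
      have h1 : F = (fun z => ∏ ρ ∈ S, (z - ρ) ^ analyticOrderNatAt F ρ) * g := funext hFg
      have h2 : analyticOrderAt F a = analyticOrderAt g a := by
        conv_lhs => rw [h1]
        rw [analyticOrderAt_mul (hP.analyticAt a) (hg.analyticAt a),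
          (hP.analyticAt a).analyticOrderAt_eq_zero.2 hPa, zero_add]
      rw [← h2, Nat.cast_analyticOrderNatAt (hfin a)]
    obtain ⟨q, hq, hq0, hgq⟩ := div_entire hg hord
    refine ⟨q, hq, ?_, ?_⟩
    · intro ρ hρ
      rcases Finset.mem_insert.1 hρ with rfl | h
      · exact hq0
      · intro h0; exact hg0 ρ h (by rw [hgq, h0, mul_zero])
    · intro z; rw [Finset.prod_insert ha, hFg, hgq]; ring

/-- logarithm bound -/
lemma logDeriv_diff_bound {g : ℂ → ℂ} (hg : Differentiable ℂ g) {R M : ℝ} (hR : 0 < R) (hM : 0 < M)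
    (hg0 : ∀ z ∈ Metric.ball (0:ℂ) R, g z ≠ 0)
    (hb : ∀ z ∈ Metric.ball (0:ℂ) R, ‖g z‖ ≤ ‖g 0‖ * exp M) {z w : ℂ}
    (hz : ‖z‖ < R / 8) (hw : ‖w‖ < R / 8) :
    ‖logDeriv g z - logDeriv g w‖ ≤ 64 * M / R ^ 2 * ‖z - w‖ := by
  have h0 : (0:ℂ) ∈ Metric.ball (0:ℂ) R := by simpa using hR
  have hgd : Differentiable ℂ (deriv g) := by
    have := hg.contDiff (n := 2)
    exact (this.differentiable_deriv_two)
  have hld : DifferentiableOn ℂ (logDeriv g) (Metric.ball 0 R) := by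
    intro x hx
    exact ((hgd x).div (hg x) (hg0 x hx)).differentiableWithinAt
  obtain ⟨h, hh0, hh⟩ := hld.isExactOn_ball.with_val_at 0 0
  have hgh : ∀ x ∈ Metric.ball (0:ℂ) R, g x = g 0 * Complex.exp (h x) := by
    have hc : ∀ x ∈ Metric.ball (0:ℂ) R,
        HasDerivAt (fun x => g x * Complex.exp (-h x)) 0 x := by
      intro x hx
      have := (hg x).hasDerivAt.mul ((hh x hx).neg.cexp)
      refine this.congr_deriv ?_
      rw [logDeriv_apply]; have := hg0 x hx; field_simp; simp
    intro x hx
    have := (convex_ball (0:ℂ) R).is_const_of_fderivWithin_eq_zero (𝕜 := ℂ)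
      (f := fun x => g x * Complex.exp (-h x))
      (fun y hy => (hc y hy).differentiableAt.differentiableWithinAt)
      (fun y hy => by
        rw [fderivWithin_of_isOpen Metric.isOpen_ball hy]
        ext; simpa using (hc y hy).deriv) hx h0
    simp only [hh0, neg_zero, Complex.exp_zero, mul_one] at this
    rw [← this, mul_assoc, ← Complex.exp_add]; simp
  have hhd : DifferentiableOn ℂ h (Metric.ball 0 R) :=
    fun x hx => (hh x hx).differentiableAt.differentiableWithinAt
  have hre : Set.MapsTo h (Metric.ball 0 R) {z | z.re ≤ M} := by
    intro x hx
    have h1 := hb x hx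
    rw [hgh x hx, norm_mul, norm_exp] at h1
    have h2 : 0 < ‖g 0‖ := norm_pos_iff.2 (hg0 0 h0)
    exact Real.exp_le_exp.1 (le_of_mul_le_mul_left h1 h2)
  have hB : ∀ x, ‖x‖ ≤ R / 2 → ‖h x‖ ≤ 2 * M := by
    intro x hx
    have h1 := Complex.borelCaratheodory_zero hM hhd hre hR
      (z := x) (by simp; linarith) hh0
    refine h1.trans ?_
    rw [div_le_iff₀ (by linarith)]
    nlinarith
  have hD : ∀ x, ‖x‖ ≤ R / 4 → ‖logDeriv g x‖ ≤ 8 * M / R := by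
    intro x hx
    have hsub : Metric.closedBall x (R/4) ⊆ Metric.ball 0 R := by
      intro y hy
      have : ‖y‖ ≤ ‖y - x‖ + ‖x‖ := by simpa using norm_add_le (y - x) x
      simp [dist_eq_norm] at hy ⊢; linarith
    have := norm_deriv_le_of_forall_mem_sphere_norm_le (c := x) (R := R/4) (f := h)
      (C := 2 * M) (by linarith) ((hhd.mono hsub).diffContOnCl_ball subset_rfl) (by
        intro y hy
        apply hB
        have h3 : ‖y‖ ≤ ‖y - x‖ + ‖x‖ := by simpa using norm_add_le (y - x) x
        simp [dist_eq_norm] at hy; linarith)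
    rw [(hh x (by simp; linarith)).deriv] at this
    refine this.trans (le_of_eq ?_)
    field_simp; ring
  have hDD : ∀ x ∈ Metric.ball (0:ℂ) (R/8), ‖deriv (logDeriv g) x‖ ≤ 64 * M / R ^ 2 := by
    intro x hx
    have hx' : ‖x‖ < R / 8 := by simpa using hx
    have hsub : Metric.closedBall x (R/8) ⊆ Metric.ball 0 R := by
      intro y hy
      have : ‖y‖ ≤ ‖y - x‖ + ‖x‖ := by simpa using norm_add_le (y - x) x
      simp [dist_eq_norm] at hy ⊢; linarith
    have := norm_deriv_le_of_forall_mem_sphere_norm_le (c := x) (R := R/8) (f := logDeriv g)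
      (C := 8 * M / R) (by linarith) ((hld.mono hsub).diffContOnCl_ball subset_rfl) (by
        intro y hy
        apply hD
        have h3 : ‖y‖ ≤ ‖y - x‖ + ‖x‖ := by simpa using norm_add_le (y - x) x
        simp [dist_eq_norm] at hy; linarith)
    refine this.trans (le_of_eq ?_)
    field_simp; ring
  refine (convex_ball (0:ℂ) (R/8)).norm_image_sub_le_of_norm_deriv_le (𝕜 := ℂ) ?_ hDD
    (by simpa using hw) (by simpa using hz)
  intro x hx
  have hx' : ‖x‖ < R / 8 := by simpa using hx
  exact (hld x (by simp; linarith)).differentiableAt (Metric.isOpen_ball.mem_nhds (by simp; linarith))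

lemma pf_bound {F : ℂ → ℂ} (hF : Differentiable ℂ F) (hF0 : F 0 ≠ 0) {R M : ℝ} (hR : 0 < R)
    (hM : 0 < M) (hb : ∀ z, ‖z‖ = 4 * R → ‖F z‖ ≤ ‖F 0‖ * exp M)
    (S : Finset ℂ) (hS : ∀ ρ, ρ ∈ S ↔ F ρ = 0 ∧ ‖ρ‖ ≤ R) {z w : ℂ}
    (hz : ‖z‖ < R / 8) (hw : ‖w‖ < R / 8) (hFz : F z ≠ 0) (hFw : F w ≠ 0) :
    ‖logDeriv F z - logDeriv F w -
      ∑ ρ ∈ S, (analyticOrderNatAt F ρ : ℂ) * (1 / (z - ρ) - 1 / (w - ρ))‖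
      ≤ 64 * M / R ^ 2 * ‖z - w‖ := by
  have hfin : ∀ z, analyticOrderAt F z ≠ ⊤ := by
    intro x hx
    have h1 := (AnalyticOnNhd.eqOn_zero_of_preconnected_of_eventuallyEq_zero
      (f := F) (U := Set.univ) (fun y _ => hF.analyticAt y) isPreconnected_univ (Set.mem_univ x)
      (analyticOrderAt_eq_top.1 hx))
    exact hF0 (h1 (Set.mem_univ 0))
  obtain ⟨g, hg, hgS, hFg⟩ := div_finset hF hfin S
  set P : ℂ → ℂ := fun z => ∏ ρ ∈ S, (z - ρ) ^ analyticOrderNatAt F ρ with hP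
  have hPd : Differentiable ℂ P := by rw [hP]; fun_prop
  have hFP : F = fun z => P z * g z := funext hFg
  have hgne : ∀ z ∈ Metric.ball (0:ℂ) R, g z ≠ 0 := by
    intro x hx h0
    have hx' : ‖x‖ ≤ R := by simp at hx; exact hx.le
    exact hgS x ((hS x).2 ⟨by rw [hFg, h0, mul_zero], hx'⟩) h0
  have hP0 : P 0 ≠ 0 := fun h => hF0 (by rw [hFP]; simp [h])
  have hg00 : g 0 ≠ 0 := fun h => hF0 (by rw [hFP]; simp [h])
  have hgb : ∀ x ∈ Metric.closedBall (0:ℂ) (4 * R), ‖g x‖ ≤ ‖g 0‖ * exp M := by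
    intro x hx
    refine Complex.norm_le_of_forall_mem_frontier_norm_le (U := Metric.ball (0:ℂ) (4*R))
      Metric.isBounded_ball hg.diffContOnCl ?_ (by rw [closure_ball _ (by positivity)]; exact hx)
    intro y hy
    rw [frontier_ball _ (by positivity)] at hy
    have hy' : ‖y‖ = 4 * R := by simpa using hy
    have h1 : ‖P 0‖ ≤ ‖P y‖ := by
      simp only [hP, norm_prod, norm_pow]
      refine Finset.prod_le_prod (fun _ _ => by positivity) fun ρ hρ => ?_
      refine pow_le_pow_left₀ (norm_nonneg _) ?_ _
      have h2 := ((hS ρ).1 hρ).2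
      have h3 : ‖y‖ - ‖ρ‖ ≤ ‖y - ρ‖ := norm_sub_norm_le y ρ
      rw [zero_sub, norm_neg]; linarith
    have h2 := hb y hy'
    rw [hFP] at h2
    simp only [norm_mul] at h2
    have h4 : 0 < ‖P 0‖ := norm_pos_iff.2 hP0
    have h5 : ‖P 0‖ * ‖g y‖ ≤ ‖P y‖ * ‖g y‖ := by gcongr
    have h6 : ‖P 0‖ * ‖g y‖ ≤ ‖P 0‖ * (‖g 0‖ * exp M) := by linarith
    exact le_of_mul_le_mul_left h6 h4
  have key := logDeriv_diff_bound hg hR hM hgne (fun x hx => hgb x (by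
    simp at hx ⊢; linarith)) hz hw
  have hld : ∀ x, F x ≠ 0 → logDeriv F x =
      ∑ ρ ∈ S, (analyticOrderNatAt F ρ : ℂ) * (1 / (x - ρ)) + logDeriv g x := by
    intro x hx
    have h1 : P x ≠ 0 := fun h => hx (by rw [hFP]; simp [h])
    have h2 : g x ≠ 0 := fun h => hx (by rw [hFP]; simp [h])
    conv_lhs => rw [hFP]
    rw [logDeriv_mul x h1 h2 (hPd x) (hg x)]
    congr 1
    have h3 := Finset.prod_ne_zero_iff.1 h1
    rw [hP, logDeriv_prod h3 (fun i _ => by fun_prop)]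
    refine sum_congr rfl fun ρ hρ => ?_
    rw [logDeriv_fun_pow (by fun_prop)]
    simp [logDeriv_apply]
  have : logDeriv F z - logDeriv F w -
      ∑ ρ ∈ S, (analyticOrderNatAt F ρ : ℂ) * (1 / (z - ρ) - 1 / (w - ρ))
      = logDeriv g z - logDeriv g w := by
    rw [hld z hFz, hld w hFw]; simp only [mul_sub, sum_sub_distrib]; ring
  rw [this]; exact key

/-- Poisson kernel -/
def Pk (c t : ℝ) : ℝ := c / (c ^ 2 + t ^ 2)

lemma tendsto_deriv_of_dom {f : ℕ → ℂ → ℂ} {g : ℂ → ℂ} {c : ℂ} {r B : ℝ} (hr : 0 < r) {U : Set ℂ}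
    (hU : IsOpen U) (hcU : Metric.closedBall c r ⊆ U)
    (hf : ∀ᶠ n in atTop, DifferentiableOn ℂ (f n) U) (hg : DifferentiableOn ℂ g U)
    (hB : ∀ᶠ n in atTop, ∀ w ∈ Metric.sphere c r, ‖f n w‖ ≤ B)
    (hl : ∀ w ∈ Metric.sphere c r, Tendsto (fun n => f n w) atTop (nhds (g w))) :
    Tendsto (fun n => deriv (f n) c) atTop (nhds (deriv g c)) := by
  have h1 : Tendsto (fun n => cderiv r (f n) c) atTop (nhds (cderiv r g c)) := by
    unfold cderiv
    refine Tendsto.const_smul ?_ _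
    unfold circleIntegral
    refine intervalIntegral.tendsto_integral_filter_of_dominated_convergence
      (fun _ => r * ((r ^ 2)⁻¹ * B)) ?_ ?_ (by simp) ?_
    · filter_upwards [hf] with n hn
      refine Continuous.aestronglyMeasurable ?_
      have h2 : Continuous fun θ => f n (circleMap c r θ) :=
        hn.continuousOn.comp_continuous (continuous_circleMap c r)
          fun θ => hcU (circleMap_mem_closedBall c hr.le θ)
      simp only [deriv_circleMap, smul_eq_mul, circleMap_sub_center]
      have h3 : ∀ θ, circleMap 0 r θ ^ 2 ≠ 0 := fun θ => pow_ne_zero _ (by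
        simp [circleMap, hr.ne'])
      have h4 : Continuous fun θ => (circleMap 0 r θ ^ 2)⁻¹ :=
        ((continuous_circleMap 0 r).pow 2).inv₀ h3
      exact ((continuous_circleMap 0 r).mul continuous_const).mul (h4.mul h2)
    · filter_upwards [hB] with n hn
      refine evA fun θ _ => ?_
      simp only [deriv_circleMap, smul_eq_mul, norm_mul, Complex.norm_I, mul_one,
        circleMap_sub_center, norm_inv, norm_pow, norm_circleMap_zero, abs_of_pos hr]
      gcongr
      exact hn _ (circleMap_mem_sphere c hr.le θ)
    · refine evA fun θ _ => ?_
      exact ((hl _ (circleMap_mem_sphere c hr.le θ)).const_smul _).const_smul _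
  rw [cderiv_eq_deriv hU hg hr hcU] at h1
  refine h1.congr' ?_
  filter_upwards [hf] with n hn
  exact cderiv_eq_deriv hU hn hr hcU

lemma norm_GammaSeq_le {s : ℂ} (hs : 0 < s.re) {n : ℕ} (hn : n ≠ 0) :
    ‖GammaSeq s n‖ ≤ Real.Gamma s.re := by
  rw [Complex.GammaSeq_eq_approx_Gamma_integral hs hn, Real.Gamma_eq_integral hs,
    integral_of_le (by positivity)]
  have hi := Real.GammaIntegral_convergent hs
  have hss : Set.Ioc 0 (n:ℝ) ⊆ Set.Ioi 0 := fun x hx => hx.1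
  refine (norm_integral_le_of_norm_le (hi.mono_set hss) ?_).trans
    (setIntegral_mono_set hi ?_ (evA hss))
  · refine (ae_restrict_mem measurableSet_Ioc).mono fun x hx => ?_
    rw [norm_mul, norm_cpow_eq_rpow_re_of_pos hx.1, norm_real, norm_eq_abs]
    have h1 : 0 ≤ 1 - x / n := by
      rw [sub_nonneg, div_le_one (by positivity)]; exact hx.2
    rw [abs_of_nonneg (by positivity)]
    simp only [sub_re, Complex.one_re]
    gcongr
    · exact rpow_nonneg hx.1.le _
    · exact Real.one_sub_div_pow_le_exp_neg hx.2
  · refine (ae_restrict_mem measurableSet_Ioi).mono fun x hx => ?_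
    have : (0:ℝ) < x := hx
    simp only [Pi.zero_apply]; positivity

lemma tendsto_digamma {s : ℂ} (hs : 0 < s.re) :
    Tendsto (fun n : ℕ => (log n : ℂ) - ∑ j ∈ range (n + 1), 1 / (s + j)) atTop
      (nhds (logDeriv Complex.Gamma s)) := by
  have hU : IsOpen {z : ℂ | 0 < z.re} := isOpen_lt continuous_const continuous_re
  have hne : ∀ z : ℂ, 0 < z.re → ∀ j : ℕ, z + j ≠ 0 := by
    intro z hz j h
    have := congrArg re h
    simp at this
    have h2 : (0:ℝ) ≤ j := j.cast_nonneg
    linarith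
  have hdn : ∀ n : ℕ, n ≠ 0 → ∀ z : ℂ, 0 < z.re →
      HasDerivAt (fun z => GammaSeq z n) (GammaSeq z n *
        ((log n : ℂ) - ∑ j ∈ range (n + 1), 1 / (z + j))) z := by
    intro n hn z hz
    have hn' : (n:ℂ) ≠ 0 := by exact_mod_cast hn
    have hP : (∏ j ∈ range (n + 1), (z + j)) ≠ 0 :=
      Finset.prod_ne_zero_iff.2 fun j _ => hne z hz j
    have hPd : DifferentiableAt ℂ (fun z : ℂ => ∏ j ∈ range (n + 1), (z + j)) z := by fun_prop
    have h1 : HasDerivAt (fun z : ℂ => (n:ℂ) ^ z * (n.factorial : ℂ))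
        ((n:ℂ) ^ z * Complex.log n * n.factorial) z := by
      have := (hasDerivAt_id z).const_cpow (c := (n:ℂ)) (Or.inl hn')
      simpa using this.mul_const (n.factorial : ℂ)
    have h2 := h1.div hPd.hasDerivAt hP
    refine h2.congr_deriv ?_
    have h3 : logDeriv (fun z : ℂ => ∏ j ∈ range (n + 1), (z + j)) z =
        ∑ j ∈ range (n + 1), 1 / (z + j) := by
      rw [logDeriv_prod (fun j _ => hne z hz j) (fun i _ => by fun_prop)]
      refine sum_congr rfl fun j _ => by simp [logDeriv_apply]
    rw [logDeriv_apply, div_eq_iff hP] at h3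
    rw [h3, GammaSeq, natCast_log]
    field_simp
  have hGd : DifferentiableOn ℂ Complex.Gamma {z : ℂ | 0 < z.re} := by
    intro z hz
    refine (Complex.differentiableAt_Gamma z fun m h => ?_).differentiableWithinAt
    exact hne z hz m (by rw [h]; ring)
  obtain ⟨B, hB⟩ := (isCompact_Icc (a := s.re / 2) (b := 2 * s.re)).exists_bound_of_continuousOn
    (f := Real.Gamma) (by
      intro x hx
      refine (Real.differentiableAt_Gamma fun m => ?_).continuousAt.continuousWithinAt
      have h2 : (0:ℝ) ≤ m := m.cast_nonneg
      have := hx.1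
      intro h; linarith)
  have hball : ∀ w ∈ Metric.closedBall s (s.re / 2), s.re / 2 ≤ w.re ∧ w.re ≤ 2 * s.re := by
    intro w hw
    have h1 : |(w - s).re| ≤ s.re / 2 := (abs_re_le_norm _).trans (by
      simpa [dist_eq_norm] using hw)
    rw [sub_re, abs_le] at h1
    constructor <;> linarith
  have key := tendsto_deriv_of_dom (f := fun n z => GammaSeq z n) (g := Complex.Gamma)
    (c := s) (r := s.re / 2) (B := B) (by linarith) hU
    (fun w hw => by have := (hball w hw).1; show 0 < w.re; linarith)
    (by
      filter_upwards [eventually_ne_atTop 0] with n hn z hz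
      exact (hdn n hn z hz).differentiableAt.differentiableWithinAt) hGd
    (by
      filter_upwards [eventually_ne_atTop 0] with n hn w hw
      have h1 := hball w (Metric.sphere_subset_closedBall hw)
      refine (norm_GammaSeq_le (by linarith) hn).trans ((le_abs_self _).trans (hB _ h1)))
    (fun w _ => GammaSeq_tendsto_Gamma w)
  have hG0 : Complex.Gamma s ≠ 0 := Gamma_ne_zero_of_re_pos hs
  have h5 := key.div (GammaSeq_tendsto_Gamma s) hG0
  rw [logDeriv_apply]
  refine h5.congr' ?_
  have h6 := (GammaSeq_tendsto_Gamma s).eventually_ne hG0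
  filter_upwards [eventually_ne_atTop 0, h6] with n hn hn2
  simp only [Pi.div_apply]
  rw [(hdn n hn s hs).deriv, mul_div_cancel_left₀ _ hn2]

/-- the archimedean partial sums -/
def bN (n : ℕ) (t : ℝ) : ℝ :=
  1 / 2 * log n - ∑ j ∈ range (n + 1), Pk (3 / 2 + 2 * j) t

lemma bN_step (t : ℝ) {n : ℕ} (hn : 1 ≤ n) :
    |bN (n + 1) t - bN n t| ≤ 6 * (1 + √|t|) * (1 / √n - 1 / √((n + 1 : ℕ) : ℝ)) := by
  have hn' : (1:ℝ) ≤ n := by exact_mod_cast hn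
  obtain ⟨x, hx⟩ : ∃ x : ℝ, x = n := ⟨_, rfl⟩
  rw [← hx] at hn' ⊢
  have e1 : bN (n + 1) t - bN n t = 1 / 2 * (log (x + 1) - log x) - Pk (2 * x + 7 / 2) t := by
    unfold bN
    rw [sum_range_succ _ (n + 1)]
    push_cast
    rw [← hx, show (3 / 2 + 2 * (x + 1) : ℝ) = 2 * x + 7 / 2 by ring]; ring
  have hlog : log (x + 1) - log x = log (1 + 1 / x) := by
    rw [← log_div (by positivity) (by positivity)]; congr 1; field_simp
  have hl1 : log (1 + 1 / x) ≤ 1 / x := by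
    have := log_le_sub_one_of_pos (show 0 < 1 + 1 / x by positivity); linarith
  have hl2 : 1 / (x + 1) ≤ log (1 + 1 / x) := by
    have := one_sub_inv_le_log_of_pos (show 0 < 1 + 1 / x by positivity)
    refine le_trans (le_of_eq ?_) this
    field_simp; ring
  set c : ℝ := 2 * x + 7 / 2 with hc
  have hc0 : 0 < c := by positivity
  have hs : 0 ≤ √|t| := sqrt_nonneg _
  -- second difference
  have hq : 1 / c - Pk c t ≤ √|t| * (1 / (c * √c)) ∧ 0 ≤ 1 / c - Pk c t := by
    have e : 1 / c - Pk c t = (1 / c) * (t ^ 2 / (c ^ 2 + t ^ 2)) := by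
      unfold Pk; field_simp; ring
    rw [e]
    refine ⟨?_, by positivity⟩
    have h1 : t ^ 2 / (c ^ 2 + t ^ 2) ≤ √|t| / √c := by
      set a := √|t|
      set b := √c with hb
      have hb0 : 0 < b := Real.sqrt_pos.2 hc0
      have ha2 : a ^ 2 = |t| := sq_sqrt (abs_nonneg t)
      have hb2 : b ^ 2 = c := sq_sqrt hc0.le
      rw [← sq_abs t, ← ha2, ← hb2]
      rw [div_le_div_iff₀ (by positivity) hb0]
      rcases le_total a b with h | h
      · have h3 : a ^ 3 ≤ b ^ 3 := pow_le_pow_left₀ hs h 3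
        have : a * (a ^ 3 * b) ≤ a * (b ^ 3 * b) := by gcongr
        nlinarith [pow_nonneg hs 5]
      · have : a ^ 4 * b ≤ a ^ 4 * a := by gcongr
        nlinarith [mul_nonneg hs (pow_nonneg hb0.le 4)]
    calc 1 / c * (t ^ 2 / (c ^ 2 + t ^ 2)) ≤ 1 / c * (√|t| / √c) := by gcongr
      _ = _ := by field_simp
  -- telescoping
  have hsx : 0 < √x := Real.sqrt_pos.2 (by linarith)
  have hsx1 : 1 ≤ √x := Real.one_le_sqrt.2 hn'
  have hsx2 : √x ^ 2 = x := sq_sqrt (by linarith)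
  have hsy : 0 < √(x + 1) := Real.sqrt_pos.2 (by linarith)
  have hsy2 : √(x + 1) ^ 2 = x + 1 := sq_sqrt (by linarith)
  have hyx : √(x + 1) ≤ 3 / 2 * √x := by
    rw [show (3 / 2 : ℝ) = √(9 / 4) by
      rw [show (9 / 4 : ℝ) = (3 / 2) ^ 2 by norm_num, sqrt_sq (by norm_num)],
      ← sqrt_mul (by norm_num)]
    exact Real.sqrt_le_sqrt (by linarith)
  have htel : 1 / (x * √x) ≤ 6 * (1 / √x - 1 / √(x + 1)) := by
    have e : 1 / √x - 1 / √(x + 1) = 1 / (√x * √(x + 1) * (√x + √(x + 1))) := by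
      have h7 : (√(x+1) - √x) * (√(x+1) + √x) = 1 := by nlinarith
      rw [div_sub_div _ _ hsx.ne' hsy.ne', div_eq_div_iff (by positivity) (by positivity)]
      linear_combination (√x * √(x + 1)) * h7
    rw [e, mul_one_div, div_le_div_iff₀ (by positivity) (by positivity)]
    have h10 : x * √x = √x ^ 3 := by nth_rw 1 [← hsx2]; ring
    rw [h10]
    have h9 : √(x + 1) * (√x + √(x + 1)) ≤ 3 / 2 * √x * (√x + 3 / 2 * √x) := by gcongr
    have h8 : √x * (√(x + 1) * (√x + √(x + 1))) ≤ √x * (3 / 2 * √x * (√x + 3 / 2 * √x)) := by gcongr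
    nlinarith [pow_pos hsx 3]
  have hcx : 1 / (c * √c) ≤ 1 / (x * √x) := by
    have : x ≤ c := by linarith
    gcongr
  have hx2 : 1 / x ^ 2 ≤ 1 / (x * √x) := by
    have : √x ≤ x := by nlinarith
    rw [sq]; gcongr
  have hd1 : 1 / (2 * x) - 1 / c ≤ 1 / x ^ 2 := by
    rw [div_sub_div _ _ (by positivity) (by positivity), div_le_div_iff₀ (by positivity) (by positivity),
      hc]
    nlinarith [sq_nonneg x]
  have hd2 : 1 / c ≤ 1 / 2 * (1 / (x + 1)) := by
    have : 2 * (x + 1) ≤ c := by linarith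
    calc 1 / c ≤ 1 / (2 * (x + 1)) := by gcongr
      _ = _ := by field_simp
  have hd3 : 1 / 2 * (1 / x) = 1 / (2 * x) := by field_simp
  have hn1 : (((n + 1 : ℕ)) : ℝ) = x + 1 := by push_cast; rw [hx]
  rw [e1, hlog, hn1, abs_le]
  have hf : √|t| * (1 / (c * √c)) ≤ √|t| * (6 * (1 / √x - 1 / √(x + 1))) := by
    gcongr; exact hcx.trans htel
  have hpos : 0 ≤ 6 * (1 + √|t|) * (1 / √x - 1 / √(x + 1)) := by
    have : 0 ≤ 6 * (1 / √x - 1 / √(x + 1)) := le_trans (by positivity) htel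
    nlinarith
  have hexp : 6 * (1 + √|t|) * (1 / √x - 1 / √(x + 1)) = 6 * (1 / √x - 1 / √(x + 1)) +
    √|t| * (6 * (1 / √x - 1 / √(x + 1))) := by ring
  constructor
  · linarith [hq.2]
  · rw [hexp]; linarith [hq.1]

lemma bN_limit {t l : ℝ} (h : Tendsto (fun n => bN n t) atTop (nhds l)) {n : ℕ} (hn : 1 ≤ n) :
    |l - bN n t| ≤ 6 * (1 + √|t|) / √n := by
  have key : ∀ m, n ≤ m → |bN m t - bN n t| ≤ 6 * (1 + √|t|) * (1 / √n - 1 / √m) := by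
    intro m hm
    induction m, hm using Nat.le_induction with
    | base => simp
    | succ m hm ih =>
      have h1 := bN_step t (hn.trans hm)
      have h2 := abs_add_le (bN (m + 1) t - bN m t) (bN m t - bN n t)
      rw [sub_add_sub_cancel] at h2
      push_cast at *
      nlinarith
  have h2 : Tendsto (fun m => |bN m t - bN n t|) atTop (nhds |l - bN n t|) :=
    (h.sub_const _).abs
  refine le_of_tendsto h2 ?_
  filter_upwards [eventually_ge_atTop n] with m hm
  refine (key m hm).trans ?_
  rw [div_eq_mul_one_div]
  have : 0 ≤ 1 / √(m:ℝ) := by positivity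
  exact mll (by rw [one_div] at this ⊢; rw [one_div]; linarith) (by positivity)

lemma re_digamma_tendsto (t : ℝ) :
    Tendsto (fun n => bN n t) atTop
      (nhds (1 / 2 * (logDeriv Complex.Gamma ((3 / 2 + t * I) / 2)).re)) := by
  have h := tendsto_digamma (s := (3 / 2 + t * I) / 2) (by simp)
  have h2 := ((Complex.continuous_re.tendsto _).comp h).const_mul (1 / 2 : ℝ)
  refine h2.congr fun n => ?_
  unfold bN
  simp only [Function.comp, sub_re, ofReal_re, re_sum, mul_sub, mul_sum]
  congr 1
  refine sum_congr rfl fun j _ => ?_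
  rw [one_div (_ + _), inv_re]
  unfold Pk
  have e1 : ((3 / 2 + t * I) / 2 + j : ℂ).re = (3 / 2 + 2 * j) / 2 := by
    simp; ring
  have e2 : ((3 / 2 + t * I) / 2 + j : ℂ).im = t / 2 := by
    simp
  rw [normSq_apply, e1, e2]
  have : 0 < (3 / 2 + 2 * (j:ℝ)) := by positivity
  field_simp

def xi (s : ℂ) : ℂ := s * (s - 1) * completedRiemannZeta₀ s + 1

lemma xi_diff : Differentiable ℂ xi := by
  unfold xi
  have := differentiable_completedZeta₀
  fun_prop

lemma xi_one_sub (s : ℂ) : xi (1 - s) = xi s := by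
  unfold xi; rw [completedRiemannZeta₀_one_sub]; ring

lemma xi_eq {s : ℂ} (h0 : s ≠ 0) (h1 : s ≠ 1) : xi s = s * (s - 1) * completedRiemannZeta s := by
  unfold xi
  rw [completedRiemannZeta_eq]
  have : 1 - s ≠ 0 := sub_ne_zero.2 (Ne.symm h1)
  field_simp
  ring

lemma xi_eq_zeta {s : ℂ} (h0 : 0 < s.re) (h1 : s ≠ 1) :
    xi s = s * (s - 1) * (Gammaℝ s * riemannZeta s) := by
  have hs : s ≠ 0 := by rintro rfl; simp at h0
  rw [xi_eq hs h1, riemannZeta_def_of_ne_zero hs, mul_div_cancel₀ _ (Gammaℝ_ne_zero_of_re_pos h0)]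

lemma Lam0_strip : ∃ C : ℝ, 0 ≤ C ∧ ∀ s : ℂ, 0 ≤ s.re → s.re ≤ 2 → ‖completedRiemannZeta₀ s‖ ≤ C := by
  obtain ⟨f, hf⟩ : ∃ f : ℝ → ℂ, f = (HurwitzZeta.hurwitzEvenFEPair 0).f_modif := ⟨_, rfl⟩
  have hconv : ∀ s : ℂ, MellinConvergent f s := fun s => by
    have := ((HurwitzZeta.hurwitzEvenFEPair 0).isStrongFEPair_toStrongFEPair.hasMellin s).1
    rw [hf]; exact this
  have hrep : ∀ s : ℂ, completedRiemannZeta₀ s = mellin f (s / 2) / 2 := fun s => by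
    rw [hf]; rfl
  have key : ∀ (σ : ℂ) (x : ℝ), 0 < x → ‖(x : ℂ) ^ (σ - 1) • f x‖ = x ^ (σ.re - 1) * ‖f x‖ := by
    intro σ x hx
    rw [norm_smul, norm_cpow_eq_rpow_re_of_pos hx]; simp
  refine ⟨(∫ x in Set.Ioi (0:ℝ), (‖(x : ℂ) ^ ((0:ℂ) - 1) • f x‖ + ‖(x : ℂ) ^ ((1:ℂ) - 1) • f x‖)), ?_, ?_⟩
  · exact integral_nonneg fun x => by positivity
  intro s h0 h2
  rw [hrep, mellin, norm_div]
  have : ‖∫ t in Set.Ioi (0:ℝ), (t:ℂ) ^ (s / 2 - 1) • f t‖ ≤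
      (∫ x in Set.Ioi (0:ℝ), (‖(x : ℂ) ^ ((0:ℂ) - 1) • f x‖ + ‖(x : ℂ) ^ ((1:ℂ) - 1) • f x‖)) := by
    refine (norm_integral_le_integral_norm _).trans ?_
    refine setIntegral_mono_on (hconv _).norm ((hconv 0).norm.add (hconv 1).norm) measurableSet_Ioi ?_
    intro x hx
    have hx : 0 < x := hx
    rw [key _ _ hx, key _ _ hx, key _ _ hx, ← add_mul]
    gcongr
    have hre : (s / 2).re = s.re / 2 := by simp
    rw [hre]
    rcases le_total x 1 with h | h
    · have := Real.rpow_le_rpow_of_exponent_ge hx h (show (0:ℂ).re - 1 ≤ s.re / 2 - 1 by simp; linarith)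
      have := rpow_nonneg hx.le ((1:ℂ).re - 1)
      linarith
    · have := rpow_le_rpow_of_exponent_le h (show s.re / 2 - 1 ≤ (1:ℂ).re - 1 by simp; linarith)
      have := rpow_nonneg hx.le ((0:ℂ).re - 1)
      linarith
  have h2 : ‖(2:ℂ)‖ = 2 := by simp
  rw [h2]
  have := norm_nonneg (∫ t in Set.Ioi (0:ℝ), (t:ℂ) ^ (s / 2 - 1) • f t)
  linarith

lemma norm_Gamma_le {s : ℂ} (hs : 0 < s.re) : ‖Complex.Gamma s‖ ≤ Real.Gamma s.re := by
  refine le_of_tendsto (GammaSeq_tendsto_Gamma s).norm ?_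
  filter_upwards [eventually_ne_atTop 0] with n hn using norm_GammaSeq_le hs hn

lemma Gamma_le_exp {x : ℝ} (hx : 1 ≤ x) : Real.Gamma x ≤ exp (2 * (x + 1) ^ (3 / 2 : ℝ)) := by
  have h1 : Real.Gamma x ≤ Real.Gamma (x + 1) := by
    rw [Real.Gamma_add_one (by linarith)]
    have := Real.Gamma_pos_of_pos (show 0 < x by linarith)
    nlinarith
  have hc : x ≤ ⌈x⌉₊ := Nat.le_ceil x
  have hc2 : (⌈x⌉₊ : ℝ) < x + 1 := Nat.ceil_lt_add_one (by linarith)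
  have h2 : Real.Gamma (x + 1) ≤ Real.Gamma ((⌈x⌉₊ : ℝ) + 1) :=
    Real.Gamma_strictMonoOn_Ici.monotoneOn (by simp; linarith) (by simp; linarith) (by linarith)
  rw [Real.Gamma_nat_eq_factorial] at h2
  have h3 : ((⌈x⌉₊).factorial : ℝ) ≤ (⌈x⌉₊ : ℝ) ^ (⌈x⌉₊) := by exact_mod_cast Nat.factorial_le_pow _
  have h4 : (⌈x⌉₊ : ℝ) ^ (⌈x⌉₊) ≤ (x + 1) ^ (x + 1) := by
    rw [← rpow_natCast]
    calc (⌈x⌉₊ : ℝ) ^ (⌈x⌉₊ : ℝ) ≤ (x + 1) ^ (⌈x⌉₊ : ℝ) := by gcongr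
      _ ≤ (x + 1) ^ (x + 1) := by
        apply rpow_le_rpow_of_exponent_le <;> linarith
  have h5 : (x + 1) ^ (x + 1) ≤ exp (2 * (x + 1) ^ (3 / 2 : ℝ)) := by
    rw [rpow_def_of_pos (by linarith)]
    apply Real.exp_le_exp.2
    have hl := Real.log_le_rpow_div (show 0 ≤ x + 1 by linarith) (show (0:ℝ) < 1 / 2 by norm_num)
    have : (x + 1) ^ (3 / 2 : ℝ) = (x + 1) ^ (1 / 2 : ℝ) * (x + 1) := by
      rw [show (3 / 2 : ℝ) = 1 / 2 + 1 by norm_num, rpow_add_one (by linarith)]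
    rw [this]
    have h6 : log (x + 1) ≤ 2 * (x + 1) ^ (1 / 2 : ℝ) := by linarith
    nlinarith
  linarith

lemma norm_zeta_le : ∃ C : ℝ, 0 ≤ C ∧ ∀ s : ℂ, 2 ≤ s.re → ‖riemannZeta s‖ ≤ C := by
  have hsum : Summable (fun n : ℕ => 1 / (n : ℝ) ^ (2:ℝ)) := Real.summable_one_div_nat_rpow.2 (by norm_num)
  refine ⟨∑' n : ℕ, 1 / (n : ℝ) ^ (2:ℝ), tsum_nonneg fun n => by positivity, fun s hs => ?_⟩
  rw [zeta_eq_tsum_one_div_nat_cpow (by linarith)]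
  refine tsum_of_norm_bounded hsum.hasSum fun n => ?_
  rcases Nat.eq_zero_or_pos n with rfl | hn
  · have : s ≠ 0 := by rintro rfl; simp at hs; linarith
    simp [this]
  · rw [norm_div, norm_one, Complex.norm_natCast_cpow_of_pos hn]
    gcongr
    exact_mod_cast hn

lemma xi_growth : ∃ C : ℝ, 0 < C ∧ ∀ s : ℂ, ‖xi s‖ ≤ exp (C * (1 + ‖s‖) ^ (3 / 2 : ℝ)) := by
  obtain ⟨C1, h1, H1⟩ := Lam0_strip
  obtain ⟨C2, h2, H2⟩ := norm_zeta_le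
  -- half-plane bound
  have hp : ∀ s : ℂ, 0 ≤ s.re → ‖xi s‖ ≤ exp ((C1 + C2 + 5) * (1 + ‖s‖) ^ (3 / 2 : ℝ)) := by
    intro s hs
    have hn := norm_nonneg s
    obtain ⟨y, hy⟩ : ∃ y : ℝ, y = (1 + ‖s‖) ^ (3 / 2 : ℝ) := ⟨_, rfl⟩
    have hy1 : 1 + ‖s‖ ≤ y := by
      rw [hy]
      calc 1 + ‖s‖ = (1 + ‖s‖) ^ (1:ℝ) := by simp
        _ ≤ _ := rpow_le_rpow_of_exponent_le (by linarith) (by norm_num)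
    rw [← hy]
    have hq : ‖s * (s - 1)‖ ≤ exp (2 * y) := by
      have : ‖s - 1‖ ≤ ‖s‖ + 1 := by simpa using norm_sub_le s 1
      have he := add_one_le_exp y
      rw [norm_mul, two_mul, exp_add]
      gcongr <;> linarith
    have hc : ∀ c : ℝ, 0 ≤ c → c + 1 ≤ exp (c * y) := by
      intro c hc
      have := add_one_le_exp (c * y)
      nlinarith
    rcases le_total s.re 2 with h | h
    · have := H1 s hs h
      calc ‖xi s‖ ≤ ‖s * (s - 1)‖ * ‖completedRiemannZeta₀ s‖ + 1 := by
            unfold xi; refine (norm_add_le _ _).trans ?_; rw [norm_mul]; simp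
        _ ≤ exp (2 * y) * C1 + exp (2 * y) := by
            gcongr; exact one_le_exp (by linarith)
        _ ≤ exp (2 * y) * exp (C1 * y) := by
            have := hc C1 h1; have := exp_pos (2 * y); nlinarith
        _ ≤ _ := by rw [← exp_add]; apply Real.exp_le_exp.2; nlinarith
    · have hG : ‖Gammaℝ s‖ ≤ exp (2 * y) := by
        rw [Gammaℝ_def, norm_mul, norm_cpow_eq_rpow_re_of_pos pi_pos]
        have a1 : π ^ (-s / 2).re ≤ 1 := by
          apply Real.rpow_le_one_of_one_le_of_nonpos
          · linarith [pi_gt_three]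
          · simp; linarith
        have a2 := norm_Gamma_le (s := s / 2) (by simp; linarith)
        have a3 := Gamma_le_exp (x := (s / 2).re) (by simp; linarith)
        have a4 : exp (2 * ((s / 2).re + 1) ^ (3 / 2 : ℝ)) ≤ exp (2 * y) := by
          rw [hy]
          have : (s / 2).re ≤ ‖s‖ := by simp; linarith [Complex.re_le_norm s]
          have h0 : 0 ≤ (s / 2).re := by simp; linarith
          have := rpow_le_rpow (by linarith) (show (s / 2).re + 1 ≤ 1 + ‖s‖ by linarith)
            (show (0:ℝ) ≤ 3 / 2 by norm_num)
          exact Real.exp_le_exp.2 (by linarith)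
        have := rpow_nonneg Real.pi_pos.le (-s / 2).re
        have := norm_nonneg (Complex.Gamma (s / 2))
        nlinarith
      have hz := H2 s h
      rw [xi_eq_zeta (by linarith) (by rintro rfl; simp at h), norm_mul, norm_mul (Gammaℝ s)]
      calc _ ≤ exp (2 * y) * (exp (2 * y) * exp (C2 * y)) := by
            have := hc C2 h2
            gcongr; linarith
        _ ≤ _ := by rw [← exp_add, ← exp_add]; apply Real.exp_le_exp.2; nlinarith
  refine ⟨(C1 + C2 + 5) * 4, by positivity, fun s => ?_⟩
  have hn := norm_nonneg s
  rcases le_total 0 s.re with h | h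
  · refine (hp s h).trans ?_
    apply Real.exp_le_exp.2
    have : 0 ≤ (1 + ‖s‖) ^ (3 / 2 : ℝ) := by positivity
    nlinarith
  · have h3 := hp (1 - s) (by simp; linarith)
    rw [xi_one_sub] at h3
    refine h3.trans ?_
    apply Real.exp_le_exp.2
    have : ‖1 - s‖ ≤ 1 + ‖s‖ := by simpa using norm_sub_le 1 s
    have h4 : (1 + ‖1 - s‖) ^ (3 / 2 : ℝ) ≤ (2 * (1 + ‖s‖)) ^ (3 / 2 : ℝ) := by
      gcongr; linarith
    rw [mul_rpow (by norm_num) (by linarith)] at h4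
    have h5 : (2:ℝ) ^ (3 / 2 : ℝ) ≤ 4 := by
      calc (2:ℝ) ^ (3 / 2 : ℝ) ≤ 2 ^ (2:ℝ) := rpow_le_rpow_of_exponent_le (by norm_num) (by norm_num)
        _ = 4 := by norm_num
    have : 0 ≤ (1 + ‖s‖) ^ (3 / 2 : ℝ) := by positivity
    rw [mul_assoc]
    gcongr
    nlinarith

lemma xi_zero : xi 0 = 1 := by simp [xi]
lemma xi_one : xi 1 = 1 := by simp [xi]

lemma xi_ne_of_re {s : ℂ} (h : 1 ≤ s.re) : xi s ≠ 0 := by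
  by_cases h1 : s = 1
  · rw [h1, xi_one]; norm_num
  rw [xi_eq_zeta (by linarith) h1]
  have h0 : s ≠ 0 := by rintro rfl; simp at h; linarith
  have := riemannZeta_ne_zero_of_one_le_re h
  have := Gammaℝ_ne_zero_of_re_pos (s := s) (by linarith)
  have := sub_ne_zero.2 h1
  positivity

lemma xi_zero_iff (hRH : RiemannHypothesis) (s : ℂ) :
    xi s = 0 ↔ ∃ γ : ℝ, riemannZeta (1 / 2 + γ * I) = 0 ∧ s = 1 / 2 + γ * I := by
  constructor
  · intro h
    have h1 : s.re < 1 := by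
      by_contra hh; exact xi_ne_of_re (not_lt.1 hh) h
    have h2 : 0 < s.re := by
      by_contra hh
      exact xi_ne_of_re (s := 1 - s) (by simp; linarith) (by rw [xi_one_sub, h])
    have hs1 : s ≠ 1 := by rintro rfl; simp at h1
    have hs0 : s ≠ 0 := by rintro rfl; simp at h2
    rw [xi_eq_zeta h2 hs1] at h
    have hz : riemannZeta s = 0 := by
      have := Gammaℝ_ne_zero_of_re_pos (s := s) h2
      have := sub_ne_zero.2 hs1
      simp_all
    have hre := hRH s hz (by
      rintro ⟨n, hn⟩
      rw [hn] at h2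
      simp at h2
      have : (0:ℝ) ≤ n := by positivity
      linarith) hs1
    have hs : s = 1 / 2 + s.im * I := by
      apply Complex.ext <;> simp [hre]
    exact ⟨s.im, by rw [← hs]; exact hz, hs⟩
  · rintro ⟨γ, hz, rfl⟩
    rw [xi_eq_zeta (by simp) (by intro h; have := congrArg re h; norm_num at this), hz]; simp

lemma half_ne_one (γ : ℝ) : (1 / 2 + γ * I : ℂ) ≠ 1 := by
  intro h; have := congrArg re h; norm_num at this

lemma xi_order (γ : ℝ) : analyticOrderNatAt xi (1 / 2 + γ * I) = ordMult γ ∧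
    (riemannZeta (1 / 2 + γ * I) = 0 → 1 ≤ ordMult γ) := by
  obtain ⟨z, hz⟩ : ∃ z : ℂ, z = 1 / 2 + γ * I := ⟨_, rfl⟩
  unfold ordMult
  rw [← hz]
  have hz1 : z ≠ 1 := hz ▸ half_ne_one γ
  have hz0 : 0 < z.re := by rw [hz]; simp
  have hzA : AnalyticAt ℂ riemannZeta z := analyticOn_riemannZeta z hz1
  have hxa : AnalyticOnNhd ℂ xi Set.univ := fun s _ => xi_diff.analyticAt s
  have hxt : analyticOrderAt xi z ≠ ⊤ := by
    intro h
    rw [analyticOrderAt_eq_top] at h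
    have := AnalyticOnNhd.eqOn_zero_of_preconnected_of_eventuallyEq_zero hxa isPreconnected_univ
      (Set.mem_univ z) h (Set.mem_univ 0)
    simp [xi_zero] at this
  have heq : xi =ᶠ[nhds z] (fun s => (s * (s - 1) * Gammaℝ s) * riemannZeta s) := by
    have h1 : ∀ᶠ s in nhds z, 0 < s.re :=
      (isOpen_lt continuous_const continuous_re).mem_nhds hz0
    filter_upwards [h1, isOpen_ne.mem_nhds hz1] with s h1 h2
    rw [xi_eq_zeta h1 h2]; ring
  have hdiffG : ∀ s : ℂ, 0 < s.re → DifferentiableAt ℂ Gammaℝ s := by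
    intro s hs
    have e : Gammaℝ = fun s => (π:ℂ) ^ (-s / 2) * Complex.Gamma (s / 2) := by
      ext; rw [Gammaℝ_def]
    rw [e]
    have : DifferentiableAt ℂ (fun s => Complex.Gamma (s / 2)) s := by
      apply DifferentiableAt.comp (g := Complex.Gamma)
      · apply Complex.differentiableAt_Gamma
        intro m h
        have := congrArg re h
        simp at this
        have : (0:ℝ) ≤ m := by positivity
        linarith
      · fun_prop
    refine DifferentiableAt.mul ?_ this
    refine DifferentiableAt.const_cpow (by fun_prop) (Or.inl ?_)
    exact_mod_cast Real.pi_pos.ne'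
  have hu : AnalyticAt ℂ (fun s => s * (s - 1) * Gammaℝ s) z := by
    have hU : IsOpen {s : ℂ | 0 < s.re} := isOpen_lt continuous_const continuous_re
    have : DifferentiableOn ℂ (fun s => s * (s - 1) * Gammaℝ s) {s : ℂ | 0 < s.re} := by
      intro s hs
      have := hdiffG s hs
      exact DifferentiableAt.differentiableWithinAt (by fun_prop)
    exact this.analyticAt (hU.mem_nhds hz0)
  have hu0 : analyticOrderAt (fun s => s * (s - 1) * Gammaℝ s) z = 0 := by
    rw [hu.analyticOrderAt_eq_zero]
    have := Gammaℝ_ne_zero_of_re_pos (s := z) hz0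
    have := sub_ne_zero.2 hz1
    have : z ≠ 0 := by rintro rfl; simp at hz0
    positivity
  have hord : analyticOrderAt xi z = analyticOrderAt riemannZeta z := by
    rw [analyticOrderAt_congr heq]
    have := analyticOrderAt_mul hu hzA
    rw [hu0, zero_add] at this
    exact this
  have hzt : analyticOrderAt riemannZeta z ≠ ⊤ := hord ▸ hxt
  have hk : analyticOrderNatAt riemannZeta z = zetaMult z := by
    have hcast := Nat.cast_analyticOrderNatAt hzt
    obtain ⟨k, hk⟩ : ∃ k, k = analyticOrderNatAt riemannZeta z := ⟨_, rfl⟩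
    rw [← hk] at hcast ⊢
    have a1 := (natCast_le_analyticOrderAt_iff_iteratedDeriv_eq_zero (n := k) hzA).1 hcast.le
    have a2 : ¬ ∀ i < k + 1, iteratedDeriv i riemannZeta z = 0 := by
      rw [← natCast_le_analyticOrderAt_iff_iteratedDeriv_eq_zero hzA, ← hcast]
      simp only [Nat.cast_le]; omega
    push Not at a2
    obtain ⟨i, hi, hi2⟩ := a2
    have hik : i = k := by
      by_contra hne; exact hi2 (a1 i (by omega))
    subst hik
    refine (IsLeast.csInf_eq ⟨hi2, fun j hj => ?_⟩).symm
    by_contra hlt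
    exact hj (a1 j (by omega))
  refine ⟨?_, ?_⟩
  · rw [← hk, analyticOrderNatAt, analyticOrderNatAt, hord]
  · intro h0
    rw [← hk]
    have h1 : analyticOrderAt riemannZeta z ≠ 0 := by
      rw [Ne, hzA.analyticOrderAt_eq_zero]; simpa using h0
    rw [← Nat.cast_analyticOrderNatAt hzt] at h1
    have : analyticOrderNatAt riemannZeta z ≠ 0 := by exact_mod_cast h1
    omega

abbrev ZO : Type := {γ : ℝ // riemannZeta (1 / 2 + γ * I) = 0}

lemma ZO_finite (K : ℝ) : {γ : ZO | |(γ : ℝ)| ≤ K}.Finite := by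
  have hc : IsCompact (Metric.closedBall (0:ℂ) (1 / 2 + K)) := isCompact_closedBall _ _
  have hf := hc.inter_riemannZetaZeros_finite
  refine Set.Finite.of_finite_image (f := fun γ : ZO => (1 / 2 + (γ:ℝ) * I : ℂ)) (hf.subset ?_) ?_
  · rintro _ ⟨γ, hγ, rfl⟩
    refine ⟨?_, ?_⟩
    · have hγ : |(γ : ℝ)| ≤ K := hγ
      simp only [Metric.mem_closedBall, dist_zero_right]
      refine (norm_add_le _ _).trans ?_
      rw [norm_mul]
      simp
      linarith
    · rw [mem_riemannZetaZeros]; exact γ.2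
  · intro a _ b _ h
    apply Subtype.ext
    have := congrArg im h
    simpa using this

lemma logDeriv_xi_one_sub (s : ℂ) : logDeriv xi (1 - s) = - logDeriv xi s := by
  have h : xi = xi ∘ (fun s => 1 - s) := by ext s; simp [xi_one_sub]
  have h2 := logDeriv_comp (f := xi) (g := fun s => 1 - s) (x := s) (xi_diff _) (by fun_prop)
  rw [← h] at h2
  rw [h2]
  simp

lemma re_term (t γ : ℝ) : (1 / ((3 / 2 + t * I) - (1 / 2 + γ * I)) -
    1 / ((1 - (3 / 2 + t * I)) - (1 / 2 + γ * I)) : ℂ).re = Pk 1 (t - γ) + Pk 1 (t + γ) := by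
  simp only [Pk, sub_re, div_re, normSq_apply]
  simp
  norm_num
  rw [← sq, ← sq]
  have : (0:ℝ) < 1 + (t - γ)^2 := by positivity
  have : (0:ℝ) < 1 + (-t - γ)^2 := by positivity
  have : (0:ℝ) < 1 + (t + γ)^2 := by positivity
  rw [show (-t - γ)^2 = (t + γ)^2 by ring]
  field_simp
  ring

lemma Pk_nonneg {c : ℝ} (hc : 0 ≤ c) (t : ℝ) : 0 ≤ Pk c t := by unfold Pk; positivity

theorem hasSum_P (hRH : RiemannHypothesis) (t : ℝ) :
    HasSum (fun γ : ZO => (ordMult γ : ℝ) * (Pk 1 (t - γ) + Pk 1 (t + γ)))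
      (2 * (logDeriv xi (3 / 2 + t * I)).re) := by
  obtain ⟨C, hC, hg⟩ := xi_growth
  obtain ⟨s, hs⟩ : ∃ s : ℂ, s = 3 / 2 + t * I := ⟨_, rfl⟩
  rw [← hs]
  have hsre : s.re = 3 / 2 := by rw [hs]; simp
  have hfin : ∀ K : ℕ, {γ : ZO | ‖(1 / 2 + (γ:ℝ) * I : ℂ)‖ ≤ K}.Finite := by
    intro K
    refine (ZO_finite K).subset fun γ hγ => ?_
    have h1 := Complex.abs_im_le_norm (1 / 2 + (γ:ℝ) * I : ℂ)
    have hγ : ‖(1 / 2 + (γ:ℝ) * I : ℂ)‖ ≤ K := hγ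
    simp at h1
    show |(γ:ℝ)| ≤ K
    refine le_trans ?_ hγ
    simpa using h1
  obtain ⟨S, hS⟩ : ∃ S : ℕ → Finset ZO, ∀ K γ, γ ∈ S K ↔ ‖(1 / 2 + (γ:ℝ) * I : ℂ)‖ ≤ K :=
    ⟨fun K => (hfin K).toFinset, fun K γ => by simp⟩
  obtain ⟨f, hf⟩ : ∃ f : ZO → ℝ, f = fun γ : ZO => (ordMult γ : ℝ) * (Pk 1 (t - γ) + Pk 1 (t + γ)) := ⟨_, rfl⟩
  rw [← hf]
  have hf0 : ∀ γ, 0 ≤ f γ := fun γ => by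
    rw [hf]
    have := Pk_nonneg (c := 1) (by norm_num) (t - γ)
    have := Pk_nonneg (c := 1) (by norm_num) (t + γ)
    positivity
  have hSt : Tendsto S atTop atTop := by
    refine tendsto_atTop_finset_of_monotone ?_ ?_
    · intro a b hab γ hγ
      rw [hS] at *
      exact hγ.trans (by exact_mod_cast hab)
    · intro γ
      obtain ⟨n, hn⟩ := exists_nat_ge ‖(1 / 2 + (γ:ℝ) * I : ℂ)‖
      exact ⟨n, (hS _ _).2 hn⟩
  have hbound : ∀ᶠ K : ℕ in atTop, |2 * (logDeriv xi s).re - ∑ γ ∈ S K, f γ| ≤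
      64 * (C * (1 + 4 * K) ^ (3 / 2 : ℝ)) / (K:ℝ) ^ 2 * ‖s - (1 - s)‖ := by
    obtain ⟨N, hN⟩ := exists_nat_gt (8 * (‖s‖ + ‖1 - s‖ + 1))
    filter_upwards [eventually_ge_atTop N] with K hK
    have hKN : (N:ℝ) ≤ K := by exact_mod_cast hK
    have hn1 := norm_nonneg s
    have hn2 := norm_nonneg (1 - s)
    have hK0 : (0:ℝ) < K := by linarith
    have hinj : Set.InjOn (fun γ : ZO => (1 / 2 + (γ:ℝ) * I : ℂ)) (S K) := by
      intro a _ b _ h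
      apply Subtype.ext
      have := congrArg im h
      simpa using this
    have h := pf_bound xi_diff (by rw [xi_zero]; norm_num) (R := K) (M := C * (1 + 4 * K) ^ (3 / 2 : ℝ))
      hK0 (by positivity) (fun z hz => by
        have := hg z
        rw [hz] at this
        rw [xi_zero]; simpa using this)
      ((S K).image (fun γ : ZO => (1 / 2 + (γ:ℝ) * I : ℂ)))
      (fun ρ => by
        rw [mem_image, xi_zero_iff hRH]
        constructor
        · rintro ⟨γ, hγ, rfl⟩
          exact ⟨⟨γ, γ.2, rfl⟩, (hS _ _).1 hγ⟩
        · rintro ⟨⟨γ, hγ, rfl⟩, hn⟩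
          exact ⟨⟨γ, hγ⟩, (hS _ _).2 hn, rfl⟩)
      (z := s) (w := 1 - s) (by linarith) (by linarith) (xi_ne_of_re (by linarith))
      (by rw [xi_one_sub]; exact xi_ne_of_re (by linarith))
    rw [sum_image hinj] at h
    refine le_trans ?_ h
    refine le_trans (le_of_eq ?_) (abs_re_le_norm _)
    congr 1
    rw [sub_re, logDeriv_xi_one_sub, re_sum]
    congr 1
    · simp; ring
    · apply sum_congr rfl
      intro γ _
      rw [(xi_order γ).1, hf, hs, ← Complex.ofReal_natCast, re_ofReal_mul, re_term]
  have hlim : Tendsto (fun K : ℕ => ∑ γ ∈ S K, f γ) atTop (nhds (2 * (logDeriv xi s).re)) := by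
    have e0 : Tendsto (fun K : ℕ => 64 * (C * (1 + 4 * K) ^ (3 / 2 : ℝ)) / (K:ℝ) ^ 2 * ‖s - (1 - s)‖) atTop (nhds 0) := by
      have e1 : Tendsto (fun K : ℕ => 64 * C * 5 ^ (3 / 2 : ℝ) * ‖s - (1 - s)‖ * (K:ℝ) ^ (-(1 / 2) : ℝ)) atTop (nhds 0) := by
        have := (tendsto_rpow_neg_atTop (show (0:ℝ) < 1 / 2 by norm_num)).comp tendsto_natCast_atTop_atTop
        simpa using this.const_mul (64 * C * 5 ^ (3 / 2 : ℝ) * ‖s - (1 - s)‖)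
      refine squeeze_zero' (evA fun K => by positivity) ?_ e1
      filter_upwards [eventually_ge_atTop 1] with K hK
      have hK1 : (1:ℝ) ≤ K := by exact_mod_cast hK
      have b1 : (1 + 4 * (K:ℝ)) ^ (3 / 2 : ℝ) ≤ 5 ^ (3 / 2 : ℝ) * (K:ℝ) ^ (3 / 2 : ℝ) := by
        rw [← mul_rpow (by norm_num) (by linarith)]
        apply rpow_le_rpow <;> linarith
      have b2 : (K:ℝ) ^ (3 / 2 : ℝ) / (K:ℝ) ^ 2 = (K:ℝ) ^ (-(1 / 2) : ℝ) := by
        rw [← rpow_natCast, ← Real.rpow_sub (by linarith)]; norm_num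
      rw [← b2]
      calc 64 * (C * (1 + 4 * (K:ℝ)) ^ (3 / 2 : ℝ)) / (K:ℝ) ^ 2 * ‖s - (1 - s)‖
          ≤ 64 * (C * (5 ^ (3 / 2 : ℝ) * (K:ℝ) ^ (3 / 2 : ℝ))) / (K:ℝ) ^ 2 * ‖s - (1 - s)‖ := by gcongr
        _ = _ := by ring
    rw [tendsto_iff_norm_sub_tendsto_zero]
    refine squeeze_zero' (evA fun K => norm_nonneg _) ?_ e0
    filter_upwards [hbound] with K hK
    rw [norm_eq_abs, abs_sub_comm]; exact hK
  have hsum : Summable f := by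
    refine summable_of_sum_le hf0 (c := 2 * (logDeriv xi s).re) fun u => ?_
    refine ge_of_tendsto hlim ?_
    filter_upwards [hSt.eventually_ge_atTop u] with K hK
    exact Finset.sum_le_sum_of_subset_of_nonneg hK fun i _ _ => hf0 i
  have := hsum.hasSum.comp hSt
  rw [tendsto_nhds_unique hlim this]
  exact hsum.hasSum

def Aarch (t : ℝ) : ℝ := Pk (3 / 2) t + Pk (1 / 2) t - 1 / 2 * log π +
  1 / 2 * (logDeriv Complex.Gamma ((3 / 2 + t * I) / 2)).re

lemma Aarch_bound (t : ℝ) {n : ℕ} (hn : 1 ≤ n) :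
    |Aarch t - (Pk (1 / 2) t + 1 / 2 * log n - 1 / 2 * log π -
      ∑ j ∈ range n, Pk (3 / 2 + 2 * (j + 1)) t)| ≤ 6 * (1 + √|t|) / √n := by
  have h := bN_limit (re_digamma_tendsto t) hn
  refine le_trans (le_of_eq ?_) h
  congr 1
  unfold Aarch bN
  rw [Finset.sum_range_succ']
  push_cast
  simp only [mul_zero, add_zero]
  ring

def LamW (n : ℕ) : ℝ := vonMangoldt n * (n:ℝ) ^ (-(3 / 2) : ℝ)

lemma LamW_nonneg (n : ℕ) : 0 ≤ LamW n :=
  mul_nonneg vonMangoldt_nonneg (by positivity)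

lemma LamW_summable : Summable LamW := by
  have h := (LSeriesSummable_vonMangoldt (s := 3 / 2) (by norm_num)).norm
  refine h.congr fun n => ?_
  rw [LSeries.norm_term_eq]
  rcases Nat.eq_zero_or_pos n with rfl | hn
  · simp [LamW]
  · rw [if_neg hn.ne', LamW, rpow_neg (by positivity)]
    simp only [norm_real, norm_eq_abs, abs_of_nonneg vonMangoldt_nonneg]
    norm_num
    rw [div_eq_mul_inv]

lemma re_zeta_log (t : ℝ) : HasSum (fun n : ℕ => LamW n * cos (t * log n))
    (-(deriv riemannZeta (3 / 2 + t * I) / riemannZeta (3 / 2 + t * I)).re) := by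
  have hre : 1 < (3 / 2 + t * I : ℂ).re := by simp; norm_num
  have h := (LSeriesSummable_vonMangoldt hre).hasSum
  have h1 := ArithmeticFunction.LSeries_vonMangoldt_eq_deriv_riemannZeta_div hre
  rw [LSeries] at h1
  rw [h1] at h
  have h2 := Complex.hasSum_re h
  rw [neg_div, Complex.neg_re] at h2
  refine h2.congr_fun ?_ |> fun h => h
  intro n
  rcases Nat.eq_zero_or_pos n with rfl | hn
  · simp [LamW]
  rw [LSeries.term_of_ne_zero hn.ne', LamW]
  have hn' : (n:ℂ) ≠ 0 := by exact_mod_cast hn.ne'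
  have hnr : (0:ℝ) < n := by exact_mod_cast hn
  rw [div_eq_mul_inv (_ : ℂ), ← Complex.cpow_neg, re_ofReal_mul, mul_assoc]
  congr 1
  have : (n:ℂ) ^ (-(3 / 2 + t * I) : ℂ) =
      (((n:ℝ) ^ (-(3 / 2) : ℝ) : ℝ) : ℂ) * Complex.exp (((-(t * log n) : ℝ) : ℂ) * I) := by
    rw [neg_add, Complex.cpow_add _ _ hn', ofReal_cpow hnr.le]
    push_cast
    congr 1
    rw [Complex.cpow_def_of_ne_zero hn', ← natCast_log]
    congr 1
    ring
  rw [this, re_ofReal_mul, exp_ofReal_mul_I_re, cos_neg]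

lemma hasDerivAt_Gammaℝ {s : ℂ} (hs : 0 < s.re) : logDeriv Gammaℝ s =
    -(1 / 2) * (log π : ℂ) + 1 / 2 * logDeriv Complex.Gamma (s / 2) ∧
    DifferentiableAt ℂ Gammaℝ s := by
  have hd : DifferentiableAt ℂ Complex.Gamma (s / 2) := by
    apply Complex.differentiableAt_Gamma
    intro m h
    have := congrArg re h
    simp at this
    have : (0:ℝ) ≤ m := by positivity
    linarith
  have e : Gammaℝ = fun s => (π:ℂ) ^ (-s / 2) * (Complex.Gamma ∘ (fun s => s / 2)) s := by
    ext; rw [Gammaℝ_def]; rfl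
  have hd2 : DifferentiableAt ℂ (Complex.Gamma ∘ (fun s => s / 2)) s :=
    DifferentiableAt.comp s hd (by fun_prop)
  have hpi : (π:ℂ) ≠ 0 := by exact_mod_cast Real.pi_pos.ne'
  have hd1 : HasDerivAt (fun s : ℂ => (π:ℂ) ^ (-s / 2)) ((π:ℂ) ^ (-s / 2) * Complex.log π * (-1 / 2)) s := by
    have h0 : HasDerivAt (fun s : ℂ => -s / 2) (-1 / 2) s := (hasDerivAt_id s).neg.div_const 2
    exact h0.const_cpow (Or.inl hpi)
  have hG0 : Complex.Gamma (s / 2) ≠ 0 := Gamma_ne_zero_of_re_pos (by simp; linarith)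
  have hp0 : (π:ℂ) ^ (-s / 2) ≠ 0 := by simp [Complex.cpow_eq_zero_iff, hpi]
  rw [e]
  refine ⟨?_, hd1.differentiableAt.mul hd2⟩
  rw [logDeriv_mul s hp0 hG0 hd1.differentiableAt hd2, logDeriv_comp (g := fun s : ℂ => s / 2) (x := s) hd (by fun_prop)]
  rw [logDeriv_apply _ s, hd1.deriv, ← Complex.ofReal_log Real.pi_pos.le]
  congr 1
  · field_simp
  · simp; ring

lemma re_logDeriv_xi (t : ℝ) : (logDeriv xi (3 / 2 + t * I)).re =
    Aarch t + (deriv riemannZeta (3 / 2 + t * I) / riemannZeta (3 / 2 + t * I)).re := by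
  obtain ⟨s, hs⟩ : ∃ s : ℂ, s = 3 / 2 + t * I := ⟨_, rfl⟩
  have hre : s.re = 3 / 2 := by rw [hs]; simp
  have him : s.im = t := by rw [hs]; simp
  have hs1 : s ≠ 1 := by rintro rfl; norm_num at hre
  have hs0 : s ≠ 0 := by rintro rfl; norm_num at hre
  have heq : xi =ᶠ[nhds s] (fun s => (s * (s - 1)) * (Gammaℝ s * riemannZeta s)) := by
    have h1 : ∀ᶠ s in nhds s, 0 < s.re :=
      (isOpen_lt continuous_const continuous_re).mem_nhds (by show 0 < s.re; linarith)
    filter_upwards [h1, isOpen_ne.mem_nhds hs1] with s h1 h2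
    rw [xi_eq_zeta h1 h2]
  obtain ⟨hG, hGd⟩ := hasDerivAt_Gammaℝ (s := s) (by linarith)
  have hGn := Gammaℝ_ne_zero_of_re_pos (s := s) (by linarith)
  have hzn := riemannZeta_ne_zero_of_one_le_re (s := s) (by linarith)
  have hzd := differentiableAt_riemannZeta hs1
  have hL : logDeriv xi s = (1 / s + 1 / (s - 1)) + (logDeriv Gammaℝ s + deriv riemannZeta s / riemannZeta s) := by
    rw [logDeriv_apply, heq.deriv_eq, heq.eq_of_nhds, ← logDeriv_apply (fun s => (s * (s - 1)) * (Gammaℝ s * riemannZeta s)),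
      logDeriv_mul (f := fun s => s * (s - 1)) (g := fun s => Gammaℝ s * riemannZeta s) s (mul_ne_zero hs0 (sub_ne_zero.2 hs1)) (mul_ne_zero hGn hzn) (by fun_prop) (hGd.mul hzd),
      logDeriv_mul s hGn hzn hGd hzd,
      logDeriv_mul (f := fun s => s) (g := fun s => s - 1) s hs0 (sub_ne_zero.2 hs1) (by fun_prop) (by fun_prop)]
    simp [logDeriv_apply]
  rw [← hs, hL, hG]
  simp only [Complex.add_re, Aarch, ← hs]
  have r1 : (1 / s).re = Pk (3 / 2) t := by
    rw [one_div, inv_re, normSq_apply, hre, him, Pk]; ring_nf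
  have r2 : (1 / (s - 1)).re = Pk (1 / 2) t := by
    rw [one_div, inv_re, normSq_apply, sub_re, Complex.sub_im, hre, him, Pk]
    norm_num; ring_nf
  rw [r1, r2]
  have r3 : (-(1 / 2) * (log π : ℂ)).re = - (1 / 2) * log π := by
    rw [show (-(1 / 2) * (log π : ℂ)) = ((-(1 / 2) * log π : ℝ) : ℂ) by push_cast; ring, ofReal_re]
  have r4 : (1 / 2 * logDeriv Complex.Gamma (s / 2)).re = 1 / 2 * (logDeriv Complex.Gamma (s / 2)).re := by
    rw [show (1 / 2 : ℂ) = ((1 / 2 : ℝ) : ℂ) by push_cast; ring, re_ofReal_mul]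
  rw [r3, r4]; ring

theorem P_formula (hRH : RiemannHypothesis) (t : ℝ) :
    HasSum (fun γ : ZO => (ordMult γ : ℝ) * (Pk 1 (t - γ) + Pk 1 (t + γ)))
      (2 * (Aarch t - ∑' n : ℕ, LamW n * cos (t * log n))) := by
  have h := hasSum_P hRH t
  rw [re_logDeriv_xi] at h
  rw [(re_zeta_log t).tsum_eq, sub_neg_eq_add]
  exact h

lemma integrable_abs_of_Ioi {f : ℝ → ℝ} (hf : IntegrableOn f (Set.Ioi 0)) :
    Integrable (fun x => f |x|) := by
  have h1 : IntegrableOn (fun x => f |x|) (Set.Ioi 0) :=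
    hf.congr_fun (fun x hx => by rw [abs_of_pos hx]) measurableSet_Ioi
  have h2 : IntegrableOn (fun x => f |x|) (Set.Iio 0) := by
    have h := ((Measure.measurePreserving_neg (volume : Measure ℝ)).integrableOn_comp_preimage
      (Homeomorph.neg ℝ).measurableEmbedding (f := fun x => f |x|) (s := Set.Ioi 0)).2 h1
    have e : (Neg.neg ⁻¹' Set.Ioi (0:ℝ)) = Set.Iio 0 := by ext; simp
    rw [e] at h
    refine h.congr_fun (fun x _ => by simp) measurableSet_Iio
  have h3 : IntegrableOn (fun x => f |x|) (Set.Iic 0) := by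
    rw [integrableOn_Iic_iff_integrableOn_Iio]; exact h2
  rw [← integrableOn_univ, ← Set.Iic_union_Ioi (a := (0:ℝ))]
  exact h3.union h1

lemma integrable_exp_abs {c : ℝ} (hc : 0 < c) : Integrable (fun x : ℝ => exp (-c * |x|)) :=
  integrable_abs_of_Ioi (f := fun x => exp (-c * x)) (exp_neg_integrableOn_Ioi 0 hc)

lemma integral_exp_cos {c : ℝ} (hc : 0 < c) (t : ℝ) :
    ∫ x : ℝ, exp (-c * |x|) * cos (t * x) = 2 * Pk c t := by
  have h1 : ∀ x : ℝ, exp (-c * |x|) * cos (t * x) =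
      (fun y => exp (-c * y) * cos (t * y)) |x| := by
    intro x
    simp only
    congr 1
    rcases abs_cases x with ⟨h, _⟩ | ⟨h, _⟩ <;> rw [h]
    rw [mul_neg, cos_neg]
  simp_rw [h1]
  rw [integral_comp_abs (f := fun y => exp (-c * y) * cos (t * y))]
  congr 1
  have ha : (-c + t * I : ℂ).re < 0 := by simpa using hc
  have h2 := integral_exp_mul_complex_Ioi ha 0
  have h3 := congrArg re h2
  have h4 := integral_re (integrableOn_exp_mul_complex_Ioi ha 0)
  simp only [RCLike.re_to_complex] at h4
  rw [← h4] at h3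
  have h5 : ∀ x : ℝ, (Complex.exp ((-c + t * I) * x)).re = exp (-c * x) * cos (t * x) := by
    intro x
    rw [exp_re]; simp
  simp_rw [h5] at h3
  rw [h3, Pk]
  simp [div_re, normSq_apply]
  ring

lemma integrable_mul_cos {f : ℝ → ℝ} {ν : Measure ℝ} (hf : Integrable f ν) (a : ℝ) :
    Integrable (fun x => f x * cos (a * x)) ν := by
  refine hf.mul_bdd (c := 1) (Continuous.aestronglyMeasurable (by fun_prop)) ?_
  exact evA fun x => by simpa using abs_cos_le_one _

lemma integrable_mul_sin {f : ℝ → ℝ} {ν : Measure ℝ} (hf : Integrable f ν) (a : ℝ) :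
    Integrable (fun x => f x * sin (a * x)) ν := by
  refine hf.mul_bdd (c := 1) (Continuous.aestronglyMeasurable (by fun_prop)) ?_
  exact evA fun x => by simpa using abs_sin_le_one _

lemma integral_odd_zero {f : ℝ → ℝ} (h : ∀ x, f (-x) = - f x) : ∫ x, f x = 0 := by
  have h1 := integral_neg_eq_self f volume
  simp_rw [h, integral_neg] at h1
  linarith

lemma even_exp {f : ℝ → ℝ} (hf : Integrable f) (he : ∀ x, f (-x) = f x) (a : ℝ) :
    ∫ v : ℝ, Complex.exp (((a * v : ℝ) : ℂ) * I) • (f v : ℂ) =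
      ((∫ v : ℝ, f v * cos (a * v) : ℝ) : ℂ) := by
  have h1 : ∀ v : ℝ, Complex.exp (((a * v : ℝ) : ℂ) * I) • (f v : ℂ) =
      ((f v * cos (a * v) : ℝ) : ℂ) + ((f v * sin (a * v) : ℝ) : ℂ) * I := by
    intro v
    rw [Complex.exp_mul_I, smul_eq_mul]; push_cast; ring
  simp_rw [h1]
  rw [integral_add (integrable_mul_cos hf a).ofReal ((integrable_mul_sin hf a).ofReal.mul_const _),
    integral_mul_const]
  have h3 : ∫ v : ℝ, ((f v * sin (a * v) : ℝ) : ℂ) = 0 := by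
    rw [integral_complex_ofReal, integral_odd_zero, Complex.ofReal_zero]
    intro x; rw [he, mul_neg, sin_neg, mul_neg]
  rw [h3, zero_mul, add_zero, integral_complex_ofReal]

lemma cos_inversion {f : ℝ → ℝ} (hf : Integrable f) (he : ∀ x, f (-x) = f x) (hc : Continuous f)
    (hg : Integrable (fun t => ∫ x : ℝ, f x * cos (t * x))) (η : ℝ) :
    ∫ t : ℝ, (∫ x : ℝ, f x * cos (t * x)) * cos (η * t) = 2 * π * f η := by
  obtain ⟨g, hgd⟩ : ∃ g : ℝ → ℝ, g = fun t => ∫ x : ℝ, f x * cos (t * x) := ⟨_, rfl⟩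
  have hge : ∀ t, g (-t) = g t := by
    intro t; rw [hgd]; simp only [neg_mul, cos_neg]
  have hpi : (2 * π) ≠ 0 := by positivity
  have hF : FourierTransform.fourier (fun x => (f x : ℂ)) = fun w => ((g (2 * π * w) : ℝ) : ℂ) := by
    ext w
    rw [Real.fourier_real_eq_integral_exp_smul]
    have e : ∀ v : ℝ, (-2 * π * v * w) = (-(2 * π * w)) * v := fun v => by ring
    simp_rw [e]
    rw [even_exp hf he, ← hge, hgd]
  have hgi : Integrable (fun w => g (2 * π * w)) := by
    rw [integrable_comp_mul_left_iff _ hpi, hgd]; exact hg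
  have hinv := Continuous.fourierInv_fourier_eq (f := fun x => (f x : ℂ)) (by fun_prop) hf.ofReal
    (by rw [hF]; exact hgi.ofReal)
  have h2 := congrFun hinv η
  rw [hF, Real.fourierInv_eq'] at h2
  have e : ∀ v : ℝ, (2 * π * inner ℝ v η) = (2 * π * η) * v := fun v => by
    simp; ring
  simp_rw [e] at h2
  rw [even_exp hgi (fun x => by rw [mul_neg, hge])] at h2
  have h3 : ∫ v : ℝ, g (2 * π * v) * cos (2 * π * η * v) = f η := by exact_mod_cast h2
  have h4 := Measure.integral_comp_mul_left (fun v => g v * cos (η * v)) (2 * π)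
  have e2 : ∀ v : ℝ, cos (2 * π * η * v) = cos (η * (2 * π * v)) := fun v => by congr 1; ring
  simp_rw [e2] at h3
  rw [h3, abs_of_pos (by positivity), smul_eq_mul] at h4
  have : g = fun t => ∫ x : ℝ, f x * cos (t * x) := hgd
  rw [show (fun t => (∫ x : ℝ, f x * cos (t * x)) * cos (η * t)) = fun t => g t * cos (η * t) by rw [hgd]]
  rw [h4]
  field_simp

lemma Pk_cont {c : ℝ} (hc : 0 < c) : Continuous (Pk c) := by
  unfold Pk
  refine continuous_const.div (by fun_prop) fun t => by positivity

lemma Pk_integrable {c : ℝ} (hc : 0 < c) : Integrable (Pk c) := by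
  have h := (integrable_inv_one_add_sq).comp_mul_left' (inv_ne_zero hc.ne')
  refine (h.const_mul (1 / c)).congr (evA fun t => ?_)
  unfold Pk
  simp only
  field_simp

lemma Pk_cos {c : ℝ} (hc : 0 < c) (ξ : ℝ) :
    ∫ t : ℝ, Pk c t * cos (ξ * t) = π * exp (-c * |ξ|) := by
  have h := cos_inversion (f := fun x => exp (-c * |x|)) (integrable_exp_abs hc)
    (fun x => by rw [abs_neg]) (by fun_prop)
    (by simp_rw [integral_exp_cos hc]; exact (Pk_integrable hc).const_mul 2) ξ
  simp_rw [integral_exp_cos hc, mul_assoc, integral_const_mul] at h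
  linarith

lemma Pk_conv_cos {c : ℝ} (hc : 0 < c) (ξ γ : ℝ) :
    ∫ t : ℝ, Pk c (t - γ) * cos (ξ * t) = π * exp (-c * |ξ|) * cos (ξ * γ) := by
  have h := integral_sub_right_eq_self (μ := (volume : Measure ℝ)) (fun t => Pk c t * cos (ξ * (t + γ))) γ
  simp only [sub_add_cancel] at h
  rw [h, ← Pk_cos hc]
  have e : ∀ t : ℝ, Pk c t * cos (ξ * (t + γ)) = Pk c t * cos (ξ * t) * cos (ξ * γ) -
      Pk c t * sin (ξ * t) * sin (ξ * γ) := by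
    intro t; rw [mul_add, cos_add]; ring
  simp_rw [e]
  rw [integral_sub ((integrable_mul_cos (Pk_integrable hc) ξ).mul_const _)
    ((integrable_mul_sin (Pk_integrable hc) ξ).mul_const _), integral_mul_const, integral_mul_const,
    integral_odd_zero (f := fun t => Pk c t * sin (ξ * t))]
  · ring
  · intro t; rw [mul_neg, sin_neg]; unfold Pk; ring

/-- convolution of the Poisson kernel with a cosine transform -/
lemma Pk_conv {E : ℝ → ℝ} (hE : Integrable E) {c : ℝ} (hc : 0 < c) (γ : ℝ) :
    ∫ t : ℝ, (∫ x : ℝ, E x * cos (t * x)) * Pk c (t - γ) =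
      π * ∫ x : ℝ, E x * exp (-c * |x|) * cos (x * γ) := by
  have hint : Integrable (fun p : ℝ × ℝ => (Pk c (p.1 - γ) * E p.2) * cos (p.1 * p.2)) (volume.prod volume) := by
    refine Integrable.mul_bdd (c := 1) (((Pk_integrable hc).comp_sub_right γ).mul_prod hE)
      (Continuous.aestronglyMeasurable (by fun_prop)) ?_
    exact evA fun x => by simpa using abs_cos_le_one _
  have h := integral_integral_swap (f := fun t x => (Pk c (t - γ) * E x) * cos (t * x)) hint
  calc _ = ∫ t : ℝ, ∫ x : ℝ, (Pk c (t - γ) * E x) * cos (t * x) := by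
        congr 1; ext t
        rw [mul_comm, ← integral_const_mul]
        congr 1; ext x; ring
    _ = _ := by
        rw [h, ← integral_const_mul]
        congr 1; ext x
        have := Pk_conv_cos hc x γ
        rw [show ∫ t : ℝ, Pk c (t - γ) * E x * cos (t * x) = E x * ∫ t : ℝ, Pk c (t - γ) * cos (x * t) by
          rw [← integral_const_mul]; congr 1; ext t; rw [mul_comm t x]; ring]
        rw [this]; ring

/-! zeros measure -/

def zmu : Measure ℝ := Measure.sum (fun γ : ZO => (ordMult γ : ENNReal) • Measure.dirac (γ : ℝ))

instance : Countable ZO := by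
  have h : (Set.univ : Set ZO) = ⋃ n : ℕ, {γ : ZO | |(γ : ℝ)| ≤ n} := by
    ext γ
    simp only [Set.mem_univ, Set.mem_iUnion, true_iff]
    exact exists_nat_ge |(γ : ℝ)|
  rw [← Set.countable_univ_iff, h]
  exact Set.countable_iUnion fun n => (ZO_finite n).countable

instance : SFinite zmu := by unfold zmu; infer_instance

lemma zmu_integrable_iff {f : ℝ → ℝ} : Integrable f zmu ↔ Summable (fun γ : ZO => (ordMult γ : ℝ) * |f γ|) := by
  unfold zmu
  rw [integrable_sum_dirac_iff (fun i => by simp)]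
  simp

lemma zmu_hasSum {f : ℝ → ℝ} (hf : Integrable f zmu) :
    HasSum (fun γ : ZO => (ordMult γ : ℝ) * f γ) (∫ x, f x ∂zmu) := by
  have := hasSum_integral_measure (hf : Integrable f (Measure.sum _))
  unfold zmu
  simpa using this

def PrS (t : ℝ) : ℝ := ∑' n : ℕ, LamW n * cos (t * log n)

lemma PrS_cont : Continuous PrS := by
  unfold PrS
  refine continuous_tsum (fun n => by fun_prop) LamW_summable fun n t => ?_
  rw [norm_mul, norm_eq_abs, norm_eq_abs, abs_of_nonneg (LamW_nonneg n)]
  exact mul_le_of_le_one_right (LamW_nonneg n) (abs_cos_le_one _)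

lemma PrS_bdd (t : ℝ) : |PrS t| ≤ ∑' n, LamW n := by
  rw [← norm_eq_abs]
  refine tsum_of_norm_bounded LamW_summable.hasSum fun n => ?_
  rw [norm_mul, norm_eq_abs, norm_eq_abs, abs_of_nonneg (LamW_nonneg n)]
  exact mul_le_of_le_one_right (LamW_nonneg n) (abs_cos_le_one _)

lemma P_measure (hRH : RiemannHypothesis) (t : ℝ) :
    Integrable (fun γ => Pk 1 (t - γ) + Pk 1 (t + γ)) zmu ∧
    ∫ γ, (Pk 1 (t - γ) + Pk 1 (t + γ)) ∂zmu = 2 * (Aarch t - PrS t) := by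
  have h := P_formula hRH t
  have hi : Integrable (fun γ => Pk 1 (t - γ) + Pk 1 (t + γ)) zmu := by
    rw [zmu_integrable_iff]
    refine h.summable.congr fun γ => ?_
    rw [abs_of_nonneg (add_nonneg (Pk_nonneg (by norm_num) _) (Pk_nonneg (by norm_num) _))]
  exact ⟨hi, (zmu_hasSum hi).unique h⟩

def vL (m : ℕ) : ℝ := vonMangoldt m / √m

lemma vL_nonneg (m : ℕ) : 0 ≤ vL m := div_nonneg vonMangoldt_nonneg (by positivity)

lemma LamW_mul (H : ℝ → ℝ) (m : ℕ) :
    LamW m * (H (log m) * exp |log m|) = vL m * H (log m) := by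
  rcases Nat.eq_zero_or_pos m with rfl | hm
  · simp [LamW, vL]
  have hr : (0:ℝ) < m := by exact_mod_cast hm
  have h1 : (1:ℝ) ≤ m := by exact_mod_cast hm
  rw [abs_of_nonneg (log_nonneg h1), exp_log hr, LamW, vL, sqrt_eq_rpow,
    div_eq_mul_inv _ ((m:ℝ) ^ (1 / 2 : ℝ)), ← rpow_neg hr.le]
  have : (m:ℝ) ^ (-(1 / 2) : ℝ) = (m:ℝ) ^ (-(3 / 2) : ℝ) * m := by
    rw [← rpow_add_one hr.ne']; norm_num
  rw [this]; ring

lemma sqrt_kernel_integrable : Integrable (fun t : ℝ => (1 + √|t|) / (1 + t ^ 2)) := by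
  have h := integrable_rpow_neg_one_add_norm_sq (E := ℝ) (μ := volume) (r := 3 / 2) (by simp; norm_num)
  refine (h.const_mul 2).mono' (Continuous.aestronglyMeasurable ?_) (evA fun t => ?_)
  · exact Continuous.div (by fun_prop) (by fun_prop) fun t => by positivity
  · rw [norm_eq_abs, abs_of_nonneg (by positivity), norm_eq_abs, sq_abs]
    have h1 : (1 + t ^ 2) ^ (-(3 / 2) / 2 : ℝ) = (1 + t ^ 2) ^ (1 / 4 : ℝ) / (1 + t ^ 2) := by
      rw [← Real.rpow_sub_one (by positivity)]; norm_num
    rw [h1, ← mul_div_assoc]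
    gcongr
    have h2 : (1:ℝ) ≤ (1 + t ^ 2) ^ (1 / 4 : ℝ) := Real.one_le_rpow (by nlinarith) (by norm_num)
    have h3 : √|t| ≤ (1 + t ^ 2) ^ (1 / 4 : ℝ) := by
      calc √|t| = (t ^ 2) ^ (1 / 4 : ℝ) := by
            rw [← sq_abs, ← rpow_natCast, ← Real.rpow_mul (abs_nonneg t), sqrt_eq_rpow]; norm_num
        _ ≤ _ := by gcongr; linarith
    linarith

def Bn (n : ℕ) (t : ℝ) : ℝ := Pk (1 / 2) t + 1 / 2 * log n - 1 / 2 * log π -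
      ∑ j ∈ range n, Pk (3 / 2 + 2 * (j + 1)) t

lemma Bn_cont (n : ℕ) : Continuous (Bn n) := by
  unfold Bn
  refine (((Pk_cont (by norm_num)).add continuous_const).sub continuous_const).sub ?_
  refine continuous_finsetSum _ fun j _ => Pk_cont (by positivity)

lemma Aarch_meas : Measurable Aarch := by
  refine measurable_of_tendsto_metrizable (f := fun n : ℕ => Bn n) (fun n => (Bn_cont n).measurable) ?_
  rw [tendsto_pi_nhds]
  intro t
  rw [tendsto_iff_norm_sub_tendsto_zero]
  have h : Tendsto (fun n : ℕ => 6 * (1 + √|t|) / √(n:ℝ)) atTop (nhds 0) :=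
    tendsto_const_nhds.div_atTop (Real.tendsto_sqrt_atTop.comp tendsto_natCast_atTop_atTop)
  refine squeeze_zero' (evA fun _ => norm_nonneg _) ?_ h
  filter_upwards [eventually_ge_atTop 1] with n hn
  rw [norm_eq_abs, abs_sub_comm]
  exact Aarch_bound t hn

lemma Aarch_abs (t : ℝ) : |Aarch t| ≤ 14 * (1 + √|t|) := by
  have h := Aarch_bound t (n := 1) le_rfl
  simp only [Nat.cast_one, Real.log_one, mul_zero, add_zero, Finset.range_one, sum_singleton,
    Real.sqrt_one, div_one, CharP.cast_eq_zero, zero_add, mul_one] at h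
  have hs := sqrt_nonneg |t|
  have h1 : Pk (1 / 2) t ≤ 2 := by
    unfold Pk; rw [div_le_iff₀ (by positivity)]; nlinarith [sq_nonneg t]
  have h2 : Pk (3 / 2 + 2) t ≤ 1 := by
    unfold Pk; rw [div_le_iff₀ (by positivity)]; nlinarith [sq_nonneg t]
  have h3 := Pk_nonneg (c := 1 / 2) (by norm_num) t
  have h4 := Pk_nonneg (c := 3 / 2 + 2) (by norm_num) t
  have h5 : log π ≤ 4 := (log_le_sub_one_of_pos pi_pos).trans (by linarith [pi_lt_four])
  have h6 : 0 ≤ log π := log_nonneg (by linarith [pi_gt_three])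
  rw [abs_le] at h ⊢
  constructor <;> linarith [h.1, h.2]

def KW : ℝ := 6 / π * ∫ t : ℝ, (1 + √|t|) / (1 + t ^ 2)

set_option maxHeartbeats 1600000 in
theorem weil (hRH : RiemannHypothesis) {H : ℝ → ℝ} (hev : ∀ x, H (-x) = H x) (hcont : Continuous H)
    (hE : Integrable (fun x => H x * exp |x|)) {CF : ℝ}
    (hF : ∀ t, |∫ x, H x * exp |x| * cos (t * x)| ≤ CF / (1 + t ^ 2)) :
    Integrable (fun γ => ∫ x, H x * cos (x * γ)) zmu ∧
    Summable (fun m : ℕ => vL m * H (log m)) ∧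
    ∀ n : ℕ, 1 ≤ n → |∫ γ, (∫ x, H x * cos (x * γ)) ∂zmu -
      ((∫ x, H x * exp (|x| / 2)) + (log n - log π) * H 0 -
        (∑ j ∈ range n, ∫ x, H x * exp (-(1 / 2 + 2 * (j + 1)) * |x|)) -
        2 * ∑' m : ℕ, vL m * H (log m))| ≤ KW * CF / √n := by
  obtain ⟨E, hEd⟩ : ∃ E : ℝ → ℝ, E = fun x => H x * exp |x| := ⟨_, rfl⟩
  have hEi : Integrable E := by rw [hEd]; exact hE
  have hEc : Continuous E := by rw [hEd]; fun_prop
  have hEe : ∀ x, E (-x) = E x := by intro x; rw [hEd]; simp only [hev, abs_neg]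
  obtain ⟨F, hFd⟩ : ∃ F : ℝ → ℝ, F = fun t => ∫ x, E x * cos (t * x) := ⟨_, rfl⟩
  have hFb : ∀ t, |F t| ≤ CF / (1 + t ^ 2) := by rw [hFd, hEd]; exact hF
  have hCF : 0 ≤ CF := by
    have := (abs_nonneg _).trans (hFb 0); simpa using this
  have hFc : Continuous F := by
    rw [hFd]
    refine continuous_of_dominated (bound := fun x => |E x|) ?_ ?_ hEi.abs ?_
    · intro t; exact (integrable_mul_cos hEi t).aestronglyMeasurable
    · intro t; refine evA fun x => ?_
      rw [norm_mul]; exact mul_le_of_le_one_right (norm_nonneg _) (by simpa using abs_cos_le_one _)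
    · exact evA fun x => by fun_prop
  have hJ := sqrt_kernel_integrable
  -- anything O(1+√|t|) times F is integrable
  have hdom : ∀ (q : ℝ → ℝ) (c : ℝ), Measurable q → (∀ t, |q t| ≤ c * (1 + √|t|)) → Integrable (fun t => F t * q t) := by
    intro q c hq hb
    refine (hJ.const_mul (CF * c)).mono' (hFc.measurable.mul hq).aestronglyMeasurable (evA fun t => ?_)
    rw [norm_mul, norm_eq_abs, norm_eq_abs]
    calc |F t| * |q t| ≤ CF / (1 + t ^ 2) * (c * (1 + √|t|)) := by
          gcongr
          · exact hFb t
          · exact hb t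
      _ = _ := by ring
  have hFi : Integrable F := by
    have := hdom (fun _ => 1) 1 measurable_const (fun t => by simp)
    simpa using this
  obtain ⟨CL, hCL⟩ : ∃ CL, CL = ∑' n, LamW n := ⟨_, rfl⟩
  have hinv : ∀ η, ∫ t, F t * cos (η * t) = 2 * π * E η := by
    intro η; rw [hFd]; exact cos_inversion hEi hEe hEc (by rw [← hFd]; exact hFi) η
  have hconv : ∀ c, 0 < c → ∀ γ, ∫ t, F t * Pk c (t - γ) = π * ∫ x, E x * exp (-c * |x|) * cos (x * γ) := by
    intro c hc γ; rw [hFd]; exact Pk_conv hEi hc γ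
  -- Fubini
  obtain ⟨k, hk⟩ : ∃ k : ℝ → ℝ → ℝ, k = fun t γ => Pk 1 (t - γ) + Pk 1 (t + γ) := ⟨_, rfl⟩
  have hkc : Continuous (Function.uncurry k) := by
    rw [hk]
    have := Pk_cont (c := 1) one_pos
    exact (this.comp (continuous_fst.sub continuous_snd)).add (this.comp (continuous_fst.add continuous_snd))
  have hk0 : ∀ t γ, 0 ≤ k t γ := fun t γ => by
    rw [hk]; exact add_nonneg (Pk_nonneg zero_le_one _) (Pk_nonneg zero_le_one _)
  have hkP : ∀ t, Integrable (k t) zmu ∧ ∫ γ, k t γ ∂zmu = 2 * (Aarch t - PrS t) := by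
    intro t; rw [hk]; exact P_measure hRH t
  have hqm : Measurable (fun t => Aarch t - PrS t) := Aarch_meas.sub PrS_cont.measurable
  have hqb : ∀ t, |Aarch t - PrS t| ≤ (14 + CL) * (1 + √|t|) := by
    intro t
    have h1 := Aarch_abs t
    have h2 := PrS_bdd t
    have h3 := sqrt_nonneg |t|
    have h4 : 0 ≤ CL := (abs_nonneg _).trans (hCL ▸ h2)
    refine (abs_sub _ _).trans ?_
    rw [← hCL] at h2
    nlinarith
  have hint : Integrable (fun p : ℝ × ℝ => F p.1 * k p.1 p.2) (volume.prod zmu) := by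
    rw [integrable_prod_iff]
    · refine ⟨evA fun t => (hkP t).1.const_mul (F t), ?_⟩
      have h1 : ∀ t, ∫ γ, ‖F t * k t γ‖ ∂zmu = |F t| * (2 * (Aarch t - PrS t)) := by
        intro t
        simp_rw [norm_mul, norm_eq_abs, abs_of_nonneg (hk0 t _)]
        rw [integral_const_mul, (hkP t).2]
      simp_rw [h1]
      refine ((hdom _ _ hqm hqb).abs.const_mul 2).congr (evA fun t => ?_)
      have h2 : 0 ≤ 2 * (Aarch t - PrS t) := by rw [← (hkP t).2]; exact integral_nonneg fun γ => hk0 t γ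
      simp only [abs_mul]
      rw [abs_of_nonneg (show 0 ≤ Aarch t - PrS t by linarith)]; ring
    · exact Continuous.aestronglyMeasurable ((hFc.comp continuous_fst).mul hkc)
  have hHE : ∀ x, E x * exp (-1 * |x|) = H x := by
    intro x; rw [hEd]; simp only; rw [mul_assoc, ← exp_add]; simp
  have hker : ∀ γ, ∫ t, F t * k t γ = 2 * π * ∫ x, H x * cos (x * γ) := by
    intro γ
    have i1 : ∀ γ, Integrable (fun t => F t * Pk 1 (t - γ)) := fun γ => by
      refine hFi.mul_bdd (c := 1) (((Pk_cont one_pos).comp (continuous_id.sub continuous_const)).aestronglyMeasurable) ?_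
      refine evA fun t => ?_
      change ‖Pk 1 (t - γ)‖ ≤ 1
      rw [norm_eq_abs, abs_of_nonneg (Pk_nonneg zero_le_one _), Pk]
      rw [div_le_one (by positivity)]; simp only [one_pow]; linarith [sq_nonneg (t - γ)]
    have e : ∀ t, F t * k t γ = F t * Pk 1 (t - γ) + F t * Pk 1 (t - (-γ)) := by
      intro t; rw [hk]; simp only [sub_neg_eq_add]; ring
    simp_rw [e]
    rw [integral_add (i1 γ) (i1 (-γ)), hconv 1 one_pos, hconv 1 one_pos]
    simp_rw [hHE, mul_neg, cos_neg]; ring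
  have hswap := integral_integral_swap (f := fun t γ => F t * k t γ) hint
  simp_rw [hker, integral_const_mul] at hswap
  have hGi : Integrable (fun γ => ∫ x, H x * cos (x * γ)) zmu := by
    have h1 : Integrable (fun γ => ∫ t, F t * k t γ) zmu := hint.integral_prod_right
    simp_rw [hker] at h1
    refine (h1.const_mul (1 / (2 * π))).congr (evA fun γ => ?_)
    simp only
    rw [← mul_assoc, one_div_mul_cancel (by positivity), one_mul]
  -- sum over primes
  have hEb : ∀ η, |E η| ≤ (∫ t, |F t|) := by
    intro η
    have h1 := hinv η
    have h2 : |∫ t, F t * cos (η * t)| ≤ ∫ t, |F t| := by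
      rw [← norm_eq_abs]
      refine norm_integral_le_of_norm_le hFi.abs (evA fun t => ?_)
      rw [norm_mul]; exact mul_le_of_le_one_right (norm_nonneg _) (by simpa using abs_cos_le_one _)
    rw [h1, abs_mul, abs_of_pos (by positivity : (0:ℝ) < 2 * π)] at h2
    have := pi_gt_three
    have := abs_nonneg (E η)
    nlinarith
  have hterm : ∀ m : ℕ, LamW m * E (log m) = vL m * H (log m) := by
    intro m; rw [hEd]; exact LamW_mul H m
  have hsumE : Summable (fun m : ℕ => LamW m * E (log m)) := by
    refine Summable.of_norm_bounded (LamW_summable.mul_right (∫ t, |F t|)) fun m => ?_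
    rw [norm_mul, norm_eq_abs, norm_eq_abs, abs_of_nonneg (LamW_nonneg m)]
    exact mll (hEb _) (LamW_nonneg m)
  have hprime : ∫ t, F t * PrS t = 2 * π * ∑' m : ℕ, vL m * H (log m) := by
    have h1 : ∀ t, F t * PrS t = ∑' m : ℕ, F t * (LamW m * cos (t * log m)) := by
      intro t; rw [PrS, tsum_mul_left]
    simp_rw [h1]
    have i1 : ∀ m : ℕ, Integrable (fun t => F t * (LamW m * cos (t * log m))) := by
      intro m
      refine ((integrable_mul_cos hFi (log m)).const_mul (LamW m)).congr (evA fun t => ?_)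
      simp only; rw [mul_comm t]; ring
    rw [← integral_tsum_of_summable_integral_norm i1, ← tsum_mul_left]
    · congr 1; ext m
      rw [← hterm]
      have e : ∀ t, F t * (LamW m * cos (t * log m)) = LamW m * (F t * cos (log m * t)) := by
        intro t; rw [mul_comm t]; ring
      simp_rw [e]
      rw [integral_const_mul, hinv]; ring
    · refine Summable.of_nonneg_of_le (fun m => integral_nonneg fun t => norm_nonneg _) (fun m => ?_)
        (LamW_summable.mul_left (∫ t, |F t|))
      rw [← integral_mul_const]
      refine integral_mono (i1 m).norm (hFi.abs.mul_const _) fun t => ?_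
      simp only [norm_mul, norm_eq_abs, abs_of_nonneg (LamW_nonneg m)]
      gcongr
      exact mul_le_of_le_one_right (LamW_nonneg m) (abs_cos_le_one _)
  refine ⟨hGi, by simp_rw [← hterm]; exact hsumE, fun n hn => ?_⟩
  have hPi : ∀ c, 0 < c → Integrable (fun t => F t * Pk c t) := by
    intro c hc
    refine hFi.mul_bdd (c := 1 / c) (Pk_cont hc).aestronglyMeasurable (evA fun t => ?_)
    rw [norm_eq_abs, abs_of_nonneg (Pk_nonneg hc.le _), Pk, div_le_div_iff₀ (by positivity) hc]
    nlinarith [sq_nonneg t]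
  have hPv : ∀ c, 0 < c → ∫ t, F t * Pk c t = π * ∫ x, H x * exp ((1 - c) * |x|) := by
    intro c hc
    have := hconv c hc 0
    simp only [sub_zero, mul_zero, cos_zero, mul_one] at this
    rw [this]
    congr 2; ext x
    rw [hEd]; simp only; rw [mul_assoc, ← exp_add]; congr 2; ring
  have hBi : Integrable (fun t => F t * Bn n t) ∧ ∫ t, F t * Bn n t = π * ((∫ x, H x * exp (|x| / 2)) + (log n - log π) * H 0 -
        (∑ j ∈ range n, ∫ x, H x * exp (-(1 / 2 + 2 * (j + 1)) * |x|))) := by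
    have e : ∀ t, F t * Bn n t = F t * Pk (1 / 2) t + F t * (1 / 2 * log n - 1 / 2 * log π) -
        ∑ j ∈ range n, F t * Pk (3 / 2 + 2 * (j + 1)) t := by
      intro t; rw [Bn, ← mul_sum]; ring
    have hsi : ∀ j ∈ range n, Integrable (fun t => F t * Pk (3 / 2 + 2 * ((j:ℝ) + 1)) t) :=
      fun j _ => hPi _ (by positivity)
    have hi1 : Integrable (fun t => F t * Pk (1 / 2) t + F t * (1 / 2 * log n - 1 / 2 * log π)) :=
      (hPi _ (by norm_num)).add (hFi.mul_const _)
    simp_rw [e]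
    refine ⟨hi1.sub (integrable_finsetSum _ hsi), ?_⟩
    rw [integral_sub hi1 (integrable_finsetSum _ hsi), integral_add (hPi _ (by norm_num)) (hFi.mul_const _),
      integral_finsetSum _ hsi, integral_mul_const, hPv _ (by norm_num)]
    have h0 := hinv 0
    simp only [zero_mul, cos_zero, mul_one] at h0
    have hE0 : E 0 = H 0 := by rw [hEd]; simp
    rw [h0, hE0, mul_sub π, mul_add π, mul_sum]
    congr 1
    · congr 1
      · congr 2; ext x; congr 2; ring
      · ring
    · refine sum_congr rfl fun j _ => ?_
      rw [hPv _ (by positivity)]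
      congr 2; ext x; congr 2; ring
  have hAi := hdom _ _ Aarch_meas Aarch_abs
  have hPri : Integrable (fun t => F t * PrS t) := by
    refine hFi.mul_bdd (c := CL) PrS_cont.aestronglyMeasurable (evA fun t => ?_)
    rw [hCL]; exact PrS_bdd t
  have hmain : 2 * (∫ t, F t * Aarch t) - 2 * (∫ t, F t * PrS t) = 2 * π * ∫ γ, (∫ x, H x * cos (x * γ)) ∂zmu := by
    rw [← hswap, ← mul_sub, ← integral_sub hAi hPri, ← integral_const_mul]
    congr 1; ext t
    rw [(hkP t).2]; ring
  have herr : |(∫ t, F t * Aarch t) - ∫ t, F t * Bn n t| ≤ π * (KW * CF / √n) := by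
    rw [← integral_sub hAi hBi.1, ← norm_eq_abs]
    have : π * (KW * CF / √n) = ∫ t, (CF * 6 / √n) * ((1 + √|t|) / (1 + t ^ 2)) := by
      rw [integral_const_mul, KW]; field_simp
    rw [this]
    refine norm_integral_le_of_norm_le (hJ.const_mul _) (evA fun t => ?_)
    rw [← mul_sub, norm_mul, norm_eq_abs, norm_eq_abs]
    calc |F t| * |Aarch t - Bn n t| ≤ CF / (1 + t ^ 2) * (6 * (1 + √|t|) / √n) := by
          gcongr
          · exact hFb t
          · exact Aarch_bound t hn
      _ = _ := by ring
  rw [hBi.2] at herr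
  rw [hprime] at hmain
  have hpi := pi_pos
  obtain ⟨I, hI⟩ : ∃ I, I = ∫ γ, (∫ x, H x * cos (x * γ)) ∂zmu := ⟨_, rfl⟩
  obtain ⟨Q, hQ⟩ : ∃ Q, Q = (∫ x, H x * exp (|x| / 2)) + (log n - log π) * H 0 -
        (∑ j ∈ range n, ∫ x, H x * exp (-(1 / 2 + 2 * (j + 1)) * |x|)) := ⟨_, rfl⟩
  rw [← hI] at hmain ⊢
  rw [← hQ] at herr ⊢
  have : I - (Q - 2 * ∑' m : ℕ, vL m * H (log m)) = ((∫ t, F t * Aarch t) - π * Q) / π := by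
    field_simp; linarith
  rw [this, abs_div, abs_of_pos hpi, div_le_iff₀ hpi]
  linarith

lemma q_bounds {b : ℝ} (hb : 0 < b) (k : ℝ) : ∃ K : ℝ, 0 ≤ K ∧ ∀ x : ℝ, 0 ≤ x →
    exp (-b * x ^ 2 + k * x) ≤ K * exp (-x) ∧
    |k - 2 * b * x| * exp (-b * x ^ 2 + k * x) ≤ K * exp (-x) ∧
    |(k - 2 * b * x) ^ 2 - 2 * b| * exp (-b * x ^ 2 + k * x) ≤ K * exp (-x) := by
  obtain ⟨A, hA⟩ : ∃ A : ℝ, A = (2 * b + |k| + 1) ^ 2 / (4 * b) := ⟨_, rfl⟩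
  refine ⟨(2 * exp |k| + 2 * b + 1) * exp A, by positivity, fun x hx => ?_⟩
  have hk := le_abs_self k
  have hk' := neg_abs_le k
  have h1 : exp (-b * x ^ 2 + k * x) * exp (2 * b * x) ≤ exp A * exp (-x) := by
    rw [← exp_add, ← exp_add]
    apply Real.exp_le_exp.2
    have : 0 ≤ (2 * b * x - (2 * b + |k| + 1)) ^ 2 / (4 * b) := by positivity
    have e : (2 * b * x - (2 * b + |k| + 1)) ^ 2 / (4 * b) = b * x ^ 2 - (2 * b + |k| + 1) * x + A := by
      rw [hA]; field_simp; ring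
    rw [e] at this
    nlinarith
  have hq := exp_pos (-b * x ^ 2 + k * x)
  have h2 : 1 ≤ exp (2 * b * x) := one_le_exp (by positivity)
  have h3 : |k - 2 * b * x| ≤ |k| + 2 * b * x := by
    rw [abs_le]; constructor <;> nlinarith
  have h0 : 0 ≤ |k| + 2 * b * x := by positivity
  have h4 := quadratic_le_exp_of_nonneg h0
  have h6 : 1 ≤ exp |k| := one_le_exp (abs_nonneg k)
  rw [exp_add] at h4
  have hm : exp |k| * exp (2 * b * x) ≥ 0 := by positivity
  obtain ⟨e, he⟩ : ∃ e, e = exp (2 * b * x) := ⟨_, rfl⟩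
  obtain ⟨g, hg⟩ : ∃ g, g = exp |k| := ⟨_, rfl⟩
  obtain ⟨q, hqq⟩ : ∃ q, q = exp (-b * x ^ 2 + k * x) := ⟨_, rfl⟩
  rw [← he, ← hg] at h4
  rw [← hqq] at h1 hq
  rw [← he] at h1 h2
  rw [← hg] at h6
  rw [← hqq, ← hg]
  have key : ∀ m, m ≤ (2 * g + 2 * b + 1) * e → m * q ≤ (2 * g + 2 * b + 1) * exp A * exp (-x) := by
    intro m hm
    calc m * q ≤ (2 * g + 2 * b + 1) * e * q := by gcongr
      _ = (2 * g + 2 * b + 1) * (q * e) := by ring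
      _ ≤ (2 * g + 2 * b + 1) * (exp A * exp (-x)) := by gcongr
      _ = _ := by ring
  refine ⟨?_, key _ ?_, key _ ?_⟩
  · have := key 1 (by nlinarith); linarith
  · nlinarith
  · have h5 : (k - 2 * b * x) ^ 2 ≤ (|k| + 2 * b * x) ^ 2 := by
      rw [← sq_abs]; gcongr
    rw [abs_le]; constructor <;> nlinarith [sq_nonneg (k - 2 * b * x)]

lemma q_decay {b : ℝ} (hb : 0 < b) (k : ℝ) : IntegrableOn (fun x : ℝ => exp (-b * x ^ 2 + k * x)) (Set.Ioi 0) ∧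
    ∃ C : ℝ, ∀ t : ℝ,
    |∫ x in Set.Ioi (0:ℝ), exp (-b * x ^ 2 + k * x) * cos (t * x)| ≤ C / (1 + t ^ 2) := by
  obtain ⟨K, hK, hB⟩ := q_bounds hb k
  have hexp : IntegrableOn (fun x : ℝ => K * exp (-x)) (Set.Ioi 0) := by
    have := (exp_neg_integrableOn_Ioi 0 one_pos).const_mul K
    simp only [neg_mul, one_mul] at this
    exact this
  have hdom : ∀ f : ℝ → ℝ, Continuous f → (∀ x, 0 ≤ x → |f x| ≤ K * exp (-x)) → IntegrableOn f (Set.Ioi 0) := by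
    intro f hf hb
    refine Integrable.mono' hexp hf.aestronglyMeasurable ?_
    filter_upwards [ae_restrict_mem measurableSet_Ioi] with x hx
    exact hb x (le_of_lt hx)
  have hint : ∫ x in Set.Ioi (0:ℝ), K * exp (-x) = K := by
    rw [integral_const_mul, integral_exp_neg_Ioi]; simp
  have hbd : ∀ f : ℝ → ℝ, (∀ x, 0 ≤ x → |f x| ≤ K * exp (-x)) → |∫ x in Set.Ioi (0:ℝ), f x| ≤ K := by
    intro f hb
    rw [← hint, ← norm_eq_abs]
    refine norm_integral_le_of_norm_le hexp ?_
    filter_upwards [ae_restrict_mem measurableSet_Ioi] with x hx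
    exact hb x (le_of_lt hx)
  obtain ⟨q, hq⟩ : ∃ q : ℝ → ℝ, q = fun x => exp (-b * x ^ 2 + k * x) := ⟨_, rfl⟩
  have hq0 : ∀ x, 0 < q x := fun x => by rw [hq]; positivity
  have hqc : Continuous q := by rw [hq]; fun_prop
  have hqd : ∀ x, HasDerivAt q ((k - 2 * b * x) * q x) x := by
    intro x
    have h1 : HasDerivAt (fun x : ℝ => -b * x ^ 2 + k * x) (-b * (2 * x) + k) x := by
      exact (((hasDerivAt_pow 2 x).const_mul (-b)).add ((hasDerivAt_id x).const_mul k)).congr_deriv (by simp)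
    have := h1.exp
    rw [hq]; convert this using 1; ring
  have b0 : ∀ x, 0 ≤ x → |q x| ≤ K * exp (-x) := fun x hx => by
    rw [abs_of_pos (hq0 x), hq]; exact (hB x hx).1
  have b1 : ∀ x, 0 ≤ x → |(k - 2 * b * x) * q x| ≤ K * exp (-x) := fun x hx => by
    rw [abs_mul, abs_of_pos (hq0 x), hq]; exact (hB x hx).2.1
  have b2 : ∀ x, 0 ≤ x → |((k - 2 * b * x) ^ 2 - 2 * b) * q x| ≤ K * exp (-x) := fun x hx => by
    rw [abs_mul, abs_of_pos (hq0 x), hq]; exact (hB x hx).2.2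
  have hc : ∀ (a u : ℝ), |a * cos u| ≤ |a| := fun a u => by
    rw [abs_mul]; exact mul_le_of_le_one_right (abs_nonneg _) (abs_cos_le_one _)
  have hs : ∀ (a u : ℝ), |a * sin u| ≤ |a| := fun a u => by
    rw [abs_mul]; exact mul_le_of_le_one_right (abs_nonneg _) (abs_sin_le_one _)
  refine ⟨hq ▸ hdom q hqc b0, K + (|k| + K), fun t => ?_⟩
  have hW : ∀ x, HasDerivAt (fun x => t * (q x * sin (t * x)) + (k - 2 * b * x) * q x * cos (t * x))
      (t ^ 2 * (q x * cos (t * x)) + ((k - 2 * b * x) ^ 2 - 2 * b) * q x * cos (t * x)) x := by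
    intro x
    have hl : HasDerivAt (fun x : ℝ => t * x) t x := by simpa using (hasDerivAt_id x).const_mul t
    have hk : HasDerivAt (fun x : ℝ => k - 2 * b * x) (-(2 * b)) x := by
      simpa using ((hasDerivAt_id x).const_mul (2 * b)).const_sub k
    refine ((((hqd x).mul hl.sin).const_mul t).add ((hk.mul (hqd x)).mul hl.cos)).congr_deriv ?_
    simp only [Pi.mul_apply]; ring
  have i1 : IntegrableOn (fun x => q x * cos (t * x)) (Set.Ioi 0) :=
    hdom _ (by fun_prop) fun x hx => (hc _ _).trans (b0 x hx)
  have i2 : IntegrableOn (fun x => ((k - 2 * b * x) ^ 2 - 2 * b) * q x * cos (t * x)) (Set.Ioi 0) :=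
    hdom _ (by fun_prop) fun x hx => (hc _ _).trans (b2 x hx)
  have hlim : Tendsto (fun x => t * (q x * sin (t * x)) + (k - 2 * b * x) * q x * cos (t * x)) atTop (nhds 0) := by
    have : Tendsto (fun x : ℝ => (|t| + 1) * (K * exp (-x))) atTop (nhds 0) := by
      have := ((Real.tendsto_exp_neg_atTop_nhds_zero).const_mul K).const_mul (|t| + 1)
      simpa using this
    refine squeeze_zero_norm' ?_ this
    filter_upwards [eventually_ge_atTop 0] with x hx
    rw [norm_eq_abs]
    refine (abs_add_le _ _).trans ?_
    rw [abs_mul, add_mul, one_mul]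
    gcongr
    · exact (hs _ _).trans (b0 x hx)
    · exact (hc _ _).trans (b1 x hx)
  have h := integral_Ioi_of_hasDerivAt_of_tendsto' (a := 0) (fun x _ => hW x) ((i1.const_mul (t ^ 2)).add i2) hlim
  rw [integral_add (i1.const_mul (t ^ 2)) i2, integral_const_mul] at h
  simp only [mul_zero, Real.sin_zero, cos_zero, sub_zero, zero_add, mul_one] at h
  have hq00 : q 0 = 1 := by rw [hq]; simp
  rw [hq00, mul_one, zero_sub] at h
  have h2 := hbd _ fun x hx => (hc (((k - 2 * b * x) ^ 2 - 2 * b) * q x) (t * x)).trans (b2 x hx)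
  have h1 := hbd _ fun x hx => (hc (q x) (t * x)).trans (b0 x hx)
  have hpos : 0 < 1 + t ^ 2 := by positivity
  have goal : |∫ x in Set.Ioi (0:ℝ), q x * cos (t * x)| ≤ (K + (|k| + K)) / (1 + t ^ 2) := by
    rw [le_div_iff₀ hpos]
    have e : |∫ x in Set.Ioi (0:ℝ), q x * cos (t * x)| * (1 + t ^ 2) =
        |∫ x in Set.Ioi (0:ℝ), q x * cos (t * x)| + |t ^ 2 * ∫ x in Set.Ioi (0:ℝ), q x * cos (t * x)| := by
      rw [abs_mul, abs_of_nonneg (sq_nonneg t)]; ring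
    rw [e]
    refine add_le_add h1 ?_
    have := neg_abs_le k
    have := le_abs_self k
    rw [abs_le] at h2 ⊢
    constructor <;> linarith [h2.1, h2.2]
  rw [hq] at goal
  exact goal

def VX (X t : ℝ) : ℝ := exp (-(t / X) ^ 2)
def v0 (X : ℝ) : ℝ := X / (2 * √π)
def gv (X x : ℝ) : ℝ := v0 X * exp (-(X ^ 2 / 4) * x ^ 2)
def gH (X y x : ℝ) : ℝ := (gv X (x - y) + gv X (x + y)) / 2

lemma gv_cont (X : ℝ) : Continuous (gv X) := by unfold gv; fun_prop
lemma gH_cont (X y : ℝ) : Continuous (gH X y) := by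
  unfold gH; have := gv_cont X; fun_prop
lemma gv_even (X x : ℝ) : gv X (-x) = gv X x := by unfold gv; simp
lemma gH_even (X y x : ℝ) : gH X y (-x) = gH X y x := by
  unfold gH
  rw [show -x - y = -(x + y) by ring, show -x + y = -(x - y) by ring, gv_even, gv_even, add_comm]
lemma v0_pos {X : ℝ} (hX : 0 < X) : 0 < v0 X := by unfold v0; positivity
lemma gv_pos {X : ℝ} (hX : 0 < X) (x : ℝ) : 0 < gv X x := mul_pos (v0_pos hX) (exp_pos _)
lemma gv_le {X : ℝ} (hX : 0 < X) (x : ℝ) : gv X x ≤ v0 X := by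
  unfold gv
  refine mul_le_of_le_one_right (v0_pos hX).le (Real.exp_le_one_iff.2 ?_)
  nlinarith [mul_nonneg (sq_nonneg X) (sq_nonneg x)]
lemma gv_int {X : ℝ} (hX : 0 < X) : Integrable (gv X) :=
  (integrable_exp_neg_mul_sq (by positivity)).const_mul _

lemma gv_cos {X : ℝ} (hX : 0 < X) (γ : ℝ) : ∫ x, gv X x * cos (γ * x) = VX X γ := by
  have hb : (0:ℝ) < X ^ 2 / 4 := by positivity
  have h := fourierIntegral_gaussian (b := ((X ^ 2 / 4 : ℝ) : ℂ)) (by rw [ofReal_re]; exact hb) (γ : ℂ)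
  have hi : Integrable (fun x : ℝ => Complex.exp (I * γ * x) * Complex.exp (-((X ^ 2 / 4 : ℝ) : ℂ) * x ^ 2)) := by
    refine Integrable.bdd_mul (c := 1) ?_ (Continuous.aestronglyMeasurable (by fun_prop)) ?_
    · have := (integrable_exp_neg_mul_sq hb).ofReal (𝕜 := ℂ)
      refine this.congr (evA fun x => ?_)
      simp
    · refine evA fun x => ?_
      rw [show I * γ * x = ((γ * x : ℝ) : ℂ) * I by push_cast; ring, Complex.norm_exp_ofReal_mul_I]
  have h2 := congrArg re h
  have hre := integral_re hi
  simp only [RCLike.re_to_complex] at hre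
  rw [← hre] at h2
  have e1 : ∀ x : ℝ, (Complex.exp (I * γ * x) * Complex.exp (-((X ^ 2 / 4 : ℝ) : ℂ) * x ^ 2)).re =
      exp (-(X ^ 2 / 4) * x ^ 2) * cos (γ * x) := by
    intro x
    rw [show I * γ * x = ((γ * x : ℝ) : ℂ) * I by push_cast; ring,
      show -((X ^ 2 / 4 : ℝ) : ℂ) * x ^ 2 = ((-(X ^ 2 / 4) * x ^ 2 : ℝ) : ℂ) by push_cast; ring, ← ofReal_exp,
      Complex.re_mul_ofReal, exp_ofReal_mul_I_re]; ring
  simp_rw [e1] at h2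
  have e2 : ((π / ((X ^ 2 / 4 : ℝ) : ℂ)) ^ (1 / 2 : ℂ) * Complex.exp (-(γ : ℂ) ^ 2 / (4 * ((X ^ 2 / 4 : ℝ) : ℂ)))).re =
      (2 * √π / X) * VX X γ := by
    have : (π / ((X ^ 2 / 4 : ℝ) : ℂ)) ^ (1 / 2 : ℂ) = ((2 * √π / X : ℝ) : ℂ) := by
      rw [← Complex.ofReal_div, show (1 / 2 : ℂ) = ((1 / 2 : ℝ) : ℂ) by push_cast; rfl,
        ← ofReal_cpow (by positivity), ← sqrt_eq_rpow]
      congr 1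
      rw [show π / (X ^ 2 / 4) = π * (2 / X) ^ 2 by field_simp; norm_num, sqrt_mul Real.pi_pos.le,
        sqrt_sq (by positivity)]
      ring
    rw [this, show -(γ : ℂ) ^ 2 / (4 * ((X ^ 2 / 4 : ℝ) : ℂ)) = ((-(γ / X) ^ 2 : ℝ) : ℂ) by push_cast; field_simp,
      ← ofReal_exp, ← Complex.ofReal_mul, ofReal_re, VX]
  rw [e2] at h2
  simp_rw [gv, mul_assoc]
  rw [integral_const_mul, h2, v0]
  have := Real.sqrt_pos.2 pi_pos
  field_simp

lemma gv_integral {X : ℝ} (hX : 0 < X) : ∫ x, gv X x = 1 := by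
  have := gv_cos hX 0
  simpa [VX] using this

lemma gH_cos {X : ℝ} (hX : 0 < X) (y γ : ℝ) : ∫ x, gH X y x * cos (x * γ) = VX X γ * cos (y * γ) := by
  have hi := gv_int hX
  have i1 : ∀ a, Integrable (fun x => gv X (x + a) * cos (x * γ)) := fun a => by
    have := integrable_mul_cos (hi.comp_add_right a) γ
    simpa [mul_comm γ] using this
  have e : ∀ x, gH X y x * cos (x * γ) = (gv X (x + -y) * cos (x * γ) + gv X (x + y) * cos (x * γ)) / 2 := by
    intro x; unfold gH; rw [sub_eq_add_neg]; ring
  simp_rw [e]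
  rw [integral_div, integral_add (i1 _) (i1 _)]
  have s1 : ∀ a, ∫ x, gv X (x + a) * cos (x * γ) = ∫ x, gv X x * cos ((x - a) * γ) := fun a => by
    rw [← integral_add_right_eq_self (fun x => gv X x * cos ((x - a) * γ)) a]
    simp only [add_sub_cancel_right]
  have i2 : ∀ a, Integrable (fun x => gv X x * cos ((x - a) * γ)) := fun a => by
    have := (i1 a).comp_sub_right a
    simpa using this
  rw [s1, s1, ← integral_add (i2 _) (i2 _)]
  have e2 : ∀ x, gv X x * cos ((x - -y) * γ) + gv X x * cos ((x - y) * γ) =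
      gv X x * cos (γ * x) * (2 * cos (y * γ)) := by
    intro x
    rw [show (x - -y) * γ = γ * x + y * γ by ring, show (x - y) * γ = γ * x - y * γ by ring, cos_add, cos_sub]; ring
  simp_rw [e2]
  rw [integral_mul_const, gv_cos hX]; ring

lemma gH_E {X : ℝ} (hX : 0 < X) (y : ℝ) : Integrable (fun x => gH X y x * exp |x|) ∧
    ∃ CF, ∀ t, |∫ x, gH X y x * exp |x| * cos (t * x)| ≤ CF / (1 + t ^ 2) := by
  have hb : (0:ℝ) < X ^ 2 / 4 := by positivity
  obtain ⟨j1, C1, h1⟩ := q_decay hb (1 + X ^ 2 / 2 * y)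
  obtain ⟨j2, C2, h2⟩ := q_decay hb (1 - X ^ 2 / 2 * y)
  obtain ⟨c, hc⟩ : ∃ c, c = v0 X / 2 * exp (-(X ^ 2 / 4) * y ^ 2) := ⟨_, rfl⟩
  have hc0 : 0 ≤ c := by rw [hc]; have := v0_pos hX; positivity
  have e : ∀ x, gH X y x * exp x = c * (exp (-(X ^ 2 / 4) * x ^ 2 + (1 + X ^ 2 / 2 * y) * x) +
      exp (-(X ^ 2 / 4) * x ^ 2 + (1 - X ^ 2 / 2 * y) * x)) := by
    intro x
    unfold gH gv
    have a1 : exp (-(X ^ 2 / 4) * (x - y) ^ 2) * exp x = exp (-(X ^ 2 / 4) * y ^ 2) *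
        exp (-(X ^ 2 / 4) * x ^ 2 + (1 + X ^ 2 / 2 * y) * x) := by
      rw [← exp_add, ← exp_add]; congr 1; ring
    have a2 : exp (-(X ^ 2 / 4) * (x + y) ^ 2) * exp x = exp (-(X ^ 2 / 4) * y ^ 2) *
        exp (-(X ^ 2 / 4) * x ^ 2 + (1 - X ^ 2 / 2 * y) * x) := by
      rw [← exp_add, ← exp_add]; congr 1; ring
    rw [hc]
    linear_combination (v0 X / 2) * a1 + (v0 X / 2) * a2
  have hIoi : IntegrableOn (fun x => gH X y x * exp x) (Set.Ioi 0) := by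
    simp_rw [e]; exact (j1.add j2).const_mul c
  have habs : ∀ x, gH X y |x| = gH X y x := by
    intro x; rcases abs_cases x with h | h <;> rw [h.1]; rw [gH_even]
  refine ⟨?_, c * 2 * (C1 + C2), fun t => ?_⟩
  · have := integrable_abs_of_Ioi hIoi
    simpa [habs] using this
  · have e3 : ∀ x, gH X y x * exp |x| * cos (t * x) = (fun x => gH X y x * exp x * cos (t * x)) |x| := by
      intro x; simp only [habs]
      congr 1
      rw [← cos_abs (t * x), ← cos_abs (t * |x|), abs_mul, abs_mul, abs_abs]
    simp_rw [e3]
    rw [integral_comp_abs (f := fun x => gH X y x * exp x * cos (t * x))]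
    simp_rw [e]
    have k1 : ∀ {f : ℝ → ℝ}, IntegrableOn f (Set.Ioi 0) → IntegrableOn (fun x => f x * cos (t * x)) (Set.Ioi 0) := by
      intro f hf
      refine Integrable.mul_bdd (c := 1) hf (Continuous.aestronglyMeasurable (by fun_prop)) ?_
      exact evA fun x => by simpa using abs_cos_le_one _
    simp_rw [mul_assoc c, add_mul (exp _)]
    rw [integral_const_mul, integral_add (k1 j1) (k1 j2)]
    have g1 := h1 t
    have g2 := h2 t
    rw [← mul_assoc, abs_mul, abs_of_nonneg (by positivity)]
    calc 2 * c * |_| ≤ 2 * c * (C1 / (1 + t ^ 2) + C2 / (1 + t ^ 2)) := by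
          gcongr; exact (abs_add_le _ _).trans (add_le_add g1 g2)
      _ = _ := by ring

lemma exp_abs_integral {c : ℝ} (hc : 0 < c) : ∫ x : ℝ, exp (-c * |x|) = 2 / c := by
  have := integral_exp_cos hc 0
  simp only [zero_mul, cos_zero, mul_one] at this
  rw [this]; simp [Pk]; field_simp

lemma gv_exp_int {X : ℝ} (hX : 0 < X) {c : ℝ} (hc : 0 ≤ c) : Integrable (fun x => gv X x * exp (-c * |x|)) := by
  refine (gv_int hX).mul_bdd (c := 1) (Continuous.aestronglyMeasurable (by fun_prop)) (evA fun x => ?_)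
  rw [norm_eq_abs, abs_of_pos (exp_pos _), exp_le_one_iff]
  nlinarith [abs_nonneg x, mul_nonneg hc (abs_nonneg x)]

lemma gv_exp_le {X : ℝ} (hX : 0 < X) {c : ℝ} (hc : 0 < c) :
    ∫ x, gv X x * exp (-c * |x|) ≤ 1 ∧ ∫ x, gv X x * exp (-c * |x|) ≤ v0 X * (2 / c) := by
  constructor
  · rw [← gv_integral hX]
    refine integral_mono (gv_exp_int hX hc.le) (gv_int hX) fun x => ?_
    refine mul_le_of_le_one_right (gv_pos hX x).le (Real.exp_le_one_iff.2 ?_)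
    nlinarith [abs_nonneg x, mul_nonneg hc.le (abs_nonneg x)]
  · rw [← exp_abs_integral hc, ← integral_const_mul]
    refine integral_mono (gv_exp_int hX hc.le) ((integrable_exp_abs hc).const_mul _) fun x => ?_
    exact mlr (gv_le hX x) (exp_pos _).le

lemma gv_exp_ge {X : ℝ} (hX : 0 < X) {c : ℝ} (hc : 2 * X ≤ c) :
    v0 X * (2 / c - 4 * X / c ^ 2) ≤ ∫ x, gv X x * exp (-c * |x|) := by
  have hc0 : 0 < c := by linarith
  have hcX : 0 < c - X := by linarith
  have h1 : ∫ x : ℝ, v0 X * (2 * exp (-c * |x|) - exp (-(c - X) * |x|)) ≤ ∫ x, gv X x * exp (-c * |x|) := by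
    refine integral_mono ((((integrable_exp_abs hc0).const_mul 2).sub (integrable_exp_abs hcX)).const_mul _)
      (gv_exp_int hX hc0.le) fun x => ?_
    simp only [gv, mul_assoc]
    refine mll ?_ (v0_pos hX).le
    rw [show -(c - X) * |x| = X * |x| + -c * |x| by ring, exp_add, ← sub_mul]
    refine mlr ?_ (exp_pos _).le
    have s0 : 0 ≤ X * |x| := by positivity
    have e1 := add_one_le_exp (X * |x|)
    rcases le_or_gt (X * |x|) 1 with h | h
    · have e2 := add_one_le_exp (-(X ^ 2 / 4) * x ^ 2)
      have : (X * |x|) ^ 2 = X ^ 2 * x ^ 2 := by rw [mul_pow, sq_abs]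
      nlinarith
    · have e2 := exp_pos (-(X ^ 2 / 4) * x ^ 2)
      nlinarith
  refine le_trans ?_ h1
  rw [integral_const_mul, integral_sub ((integrable_exp_abs hc0).const_mul 2) (integrable_exp_abs hcX),
    integral_const_mul, exp_abs_integral hc0, exp_abs_integral hcX]
  refine mll ?_ (v0_pos hX).le
  have : 2 * (2 / c) - 2 / (c - X) - (2 / c - 4 * X / c ^ 2) = 2 * X * (c - 2 * X) / (c ^ 2 * (c - X)) := by
    field_simp; ring
  have h2 : 0 ≤ 2 * X * (c - 2 * X) / (c ^ 2 * (c - X)) := by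
    have : 0 ≤ c - 2 * X := by linarith
    positivity
  linarith

lemma log_step {a : ℝ} (ha : 0 < a) : log (a + 1) - log a ≤ 1 / a ∧ 1 / (a + 1) ≤ log (a + 1) - log a := by
  rw [← log_div (by positivity) ha.ne']
  constructor
  · have := log_le_sub_one_of_pos (show 0 < (a + 1) / a by positivity)
    calc _ ≤ _ := this
      _ = _ := by field_simp; ring
  · have := one_sub_inv_le_log_of_pos (show 0 < (a + 1) / a by positivity)
    calc 1 / (a + 1) = 1 - ((a + 1) / a)⁻¹ := by field_simp; ring
      _ ≤ _ := this

/- sum over trivial zeros: lower bound -/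
lemma gsum_ge {X : ℝ} (hX : 1 ≤ X) (n : ℕ) (hn : X + 1 ≤ n) :
    v0 X * (log n - log X - 3) ≤
      ∑ j ∈ range n, ∫ x, gv X x * exp (-(1 / 2 + 2 * ((j:ℝ) + 1)) * |x|) := by
  have hX0 : 0 < X := by linarith
  obtain ⟨J, hJ⟩ : ∃ J, J = ⌈X⌉₊ := ⟨_, rfl⟩
  have hJ1 : X ≤ J := hJ ▸ Nat.le_ceil X
  have hJ2 : (J:ℝ) ≤ X + 1 := hJ ▸ (Nat.ceil_lt_add_one hX0.le).le
  have hJn : J ≤ n := by exact_mod_cast hJ2.trans hn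
  have key : ∀ m : ℕ, J ≤ m → v0 X * ((log (m + 5 / 4) + X / (m + 1 / 4)) - (log (J + 5 / 4) + X / (J + 1 / 4))) ≤
      ∑ j ∈ range m, ∫ x, gv X x * exp (-(1 / 2 + 2 * ((j:ℝ) + 1)) * |x|) := by
    intro m hm
    induction m, hm using Nat.le_induction with
    | base =>
      rw [sub_self, mul_zero]
      exact Finset.sum_nonneg fun j _ => integral_nonneg fun x => mul_nonneg (gv_pos hX0 x).le (exp_pos _).le
    | succ m hm ih =>
      rw [sum_range_succ]
      have hmX : X ≤ m := hJ1.trans (by exact_mod_cast hm)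
      have hm0 : (0:ℝ) < m := by linarith
      have h1 := gv_exp_ge hX0 (c := 1 / 2 + 2 * ((m:ℝ) + 1)) (by linarith)
      have h2 := (log_step (a := (m:ℝ) + 5 / 4) (by positivity)).1
      have h3 : v0 X * ((log ((m:ℝ) + 5 / 4 + 1) + X / (m + 5 / 4)) - (log (m + 5 / 4) + X / (m + 1 / 4))) ≤
          v0 X * (2 / (1 / 2 + 2 * ((m:ℝ) + 1)) - 4 * X / (1 / 2 + 2 * ((m:ℝ) + 1)) ^ 2) := by
        refine mll ?_ (v0_pos hX0).le
        have e1 : 2 / (1 / 2 + 2 * ((m:ℝ) + 1)) = 1 / (m + 5 / 4) := by field_simp; ring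
        have e2 : 4 * X / (1 / 2 + 2 * ((m:ℝ) + 1)) ^ 2 = X / (m + 5 / 4) ^ 2 := by
          rw [div_eq_div_iff (by positivity) (by positivity)]; ring
        rw [e1, e2]
        have e3 : X / (m + 5 / 4) ^ 2 ≤ X / (m + 1 / 4) - X / (m + 5 / 4) := by
          rw [div_sub_div _ _ (by positivity) (by positivity), div_le_div_iff₀ (by positivity) (by positivity)]
          have : X * (m + 5 / 4) - (m + 1 / 4) * X = X := by ring
          rw [this]
          have : ((m:ℝ) + 1 / 4) * (m + 5 / 4) ≤ (m + 5 / 4) ^ 2 := by nlinarith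
          nlinarith
        linarith
      push_cast
      rw [show (m:ℝ) + 1 + 5 / 4 = m + 5 / 4 + 1 by ring, show (m:ℝ) + 1 + 1 / 4 = m + 5 / 4 by ring]
      linarith
  refine le_trans (mll ?_ (v0_pos hX0).le) (key n hJn)
  have hn0 : (0:ℝ) < n := by linarith
  have a1 : log n ≤ log (n + 5 / 4) := log_le_log hn0 (by linarith)
  have a2 : 0 ≤ X / (n + 1 / 4) := by positivity
  have a3 : X / (J + 1 / 4) ≤ 1 := by rw [div_le_one (by linarith)]; linarith
  have a4 : log (J + 5 / 4) ≤ log X + 2 := by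
    have : (J:ℝ) + 5 / 4 ≤ X * exp 2 := by
      have := add_one_le_exp (2:ℝ)
      have h5 : exp 2 = exp 1 * exp 1 := by rw [← exp_add]; norm_num
      have := exp_one_gt_d9
      have : (13/4:ℝ) ≤ exp 2 := by rw [h5]; nlinarith
      nlinarith
    calc _ ≤ log (X * exp 2) := log_le_log (by linarith) this
      _ = _ := by rw [log_mul hX0.ne' (exp_pos _).ne', log_exp]
  linarith

lemma gsum_le {X : ℝ} (hX : 1 ≤ X) (n : ℕ) (hn : X + 1 ≤ n) :
      ∑ j ∈ range n, ∫ x, gv X x * exp (-(1 / 2 + 2 * ((j:ℝ) + 1)) * |x|) ≤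
      v0 X * (log n - log X + 1) + 2 * X := by
  have hX0 : 0 < X := by linarith
  obtain ⟨J, hJ⟩ : ∃ J, J = ⌈X⌉₊ := ⟨_, rfl⟩
  have hJ1 : X ≤ J := hJ ▸ Nat.le_ceil X
  have hJ2 : (J:ℝ) ≤ X + 1 := hJ ▸ (Nat.ceil_lt_add_one hX0.le).le
  have hJn : J ≤ n := by exact_mod_cast hJ2.trans hn
  have key : ∀ m : ℕ, J ≤ m → 
      ∑ j ∈ range m, ∫ x, gv X x * exp (-(1 / 2 + 2 * ((j:ℝ) + 1)) * |x|) ≤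
       v0 X * (log (m + 1 / 4) - log (J + 1 / 4)) + J := by
    intro m hm
    induction m, hm using Nat.le_induction with
    | base =>
      rw [sub_self, mul_zero, zero_add]
      calc _ ≤ ∑ j ∈ range J, (1:ℝ) := sum_le_sum fun j _ => (gv_exp_le hX0 (by positivity)).1
        _ = J := by simp
    | succ m hm ih =>
      rw [sum_range_succ]
      have h1 := (gv_exp_le hX0 (c := 1 / 2 + 2 * ((m:ℝ) + 1)) (by positivity)).2
      have h2 := (log_step (a := (m:ℝ) + 1 / 4) (by positivity)).2
      have e1 : 2 / (1 / 2 + 2 * ((m:ℝ) + 1)) = 1 / (m + 1 / 4 + 1) := by field_simp; ring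
      rw [e1] at h1
      have h3 := mll h2 (v0_pos hX0).le
      push_cast
      rw [show (m:ℝ) + 1 + 1 / 4 = m + 1 / 4 + 1 by ring]
      linarith
  refine (key n hJn).trans (add_le_add (mll ?_ (v0_pos hX0).le) (by linarith))
  have hn0 : (1:ℝ) ≤ n := by linarith
  have h1 : log X ≤ log (J + 1 / 4) := log_le_log hX0 (by linarith)
  have h2 : log (n + 1 / 4) ≤ log n + 1 := by
    calc _ ≤ log (n * exp 1) := log_le_log (by linarith) (by
            have := add_one_le_exp (1:ℝ); nlinarith)
      _ = _ := by rw [log_mul (by linarith) (exp_pos _).ne', log_exp]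
  linarith

lemma gv_half {X : ℝ} (hX : 1 ≤ X) (y : ℝ) : Integrable (fun x => gv X (x + y) * exp (|x| / 2)) ∧
    ∫ x, gv X (x + y) * exp (|x| / 2) ≤ 3 * exp (|y| / 2) := by
  have hX0 : 0 < X := by linarith
  have hb : (0:ℝ) < X ^ 2 / 8 := by positivity
  have hi := ((integrable_exp_neg_mul_sq hb).comp_add_right y).const_mul (v0 X * exp (1 / 2) * exp (|y| / 2))
  have hle : ∀ x, gv X (x + y) * exp (|x| / 2) ≤
      v0 X * exp (1 / 2) * exp (|y| / 2) * exp (-(X ^ 2 / 8) * (x + y) ^ 2) := by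
    intro x
    unfold gv
    rw [mul_assoc, mul_assoc, mul_assoc, ← exp_add, ← exp_add, ← exp_add]
    refine mll (Real.exp_le_exp.2 ?_) (v0_pos hX0).le
    have h1 : |x| ≤ |x + y| + |y| := by
      have := abs_sub (x + y) y; simpa using this
    have h2 := sq_abs (x + y)
    rw [← h2]
    have h3 : |x + y| ^ 2 ≤ X ^ 2 * |x + y| ^ 2 := le_mul_of_one_le_left (by positivity) (by nlinarith)
    nlinarith [sq_nonneg (|x + y| - 2)]
  have hint : Integrable (fun x => gv X (x + y) * exp (|x| / 2)) := by
    refine hi.mono' (Continuous.aestronglyMeasurable ?_) (evA fun x => ?_)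
    · have := gv_cont X; fun_prop
    · rw [norm_eq_abs, abs_of_pos (mul_pos (gv_pos hX0 _) (exp_pos _))]; exact hle x
  refine ⟨hint, (integral_mono hint hi hle).trans ?_⟩
  rw [integral_const_mul, integral_add_right_eq_self (fun x => exp (-(X ^ 2 / 8) * x ^ 2)) y, integral_gaussian, v0]
  have h1 : √(π / (X ^ 2 / 8)) = √π * √8 / X := by
    rw [show π / (X ^ 2 / 8) = π * 8 / X ^ 2 by field_simp, Real.sqrt_div (by positivity), sqrt_sq hX0.le,
      sqrt_mul Real.pi_pos.le]
  rw [h1]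
  have hs := Real.sqrt_pos.2 pi_pos
  have : X / (2 * √π) * exp (1 / 2) * exp (|y| / 2) * (√π * √8 / X) = exp (1 / 2) * √8 / 2 * exp (|y| / 2) := by
    field_simp
  rw [this]
  refine mlr ?_ (exp_pos _).le
  have a1 : exp (1 / 2) ≤ 1.7 := by
    have e1 : exp (1 / 2) * exp (1 / 2) = exp 1 := by rw [← exp_add]; norm_num
    have e2 := exp_one_lt_d9
    nlinarith [exp_pos (1 / 2)]
  have a2 : √8 ≤ 3 := by rw [sqrt_le_left (by norm_num)]; norm_num
  nlinarith [sqrt_nonneg 8, exp_pos (1/2)]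

def Zf (X y : ℝ) : ℝ := ∫ γ, VX X γ * cos (y * γ) ∂zmu

lemma VX_pos (X t : ℝ) : 0 < VX X t := exp_pos _

lemma Z_weil (hRH : RiemannHypothesis) {X : ℝ} (hX : 0 < X) (y : ℝ) :
    Integrable (fun γ => VX X γ * cos (y * γ)) zmu ∧ Summable (fun m : ℕ => vL m * gH X y (log m)) ∧
    ∃ K, ∀ n : ℕ, 1 ≤ n → |Zf X y - ((∫ x, gH X y x * exp (|x| / 2)) + (log n - log π) * gH X y 0 -
        (∑ j ∈ range n, ∫ x, gH X y x * exp (-(1 / 2 + 2 * (j + 1)) * |x|)) -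
        2 * ∑' m : ℕ, vL m * gH X y (log m))| ≤ K / √n := by
  obtain ⟨h1, CF, h2⟩ := gH_E hX y
  have h := weil hRH (gH_even X y) (gH_cont X y) h1 h2
  simp_rw [gH_cos hX] at h
  exact ⟨h.1, h.2.1, _, h.2.2⟩

lemma lim_le {a b K : ℝ} {f : ℕ → ℝ} (h : ∀ n : ℕ, 1 ≤ n → |a - f n| ≤ K / √n) (hf : ∀ᶠ n in atTop, f n ≤ b) : a ≤ b := by
  have ht : Tendsto (fun n : ℕ => b + K / √(n:ℝ)) atTop (nhds (b + 0)) :=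
    tendsto_const_nhds.add (tendsto_const_nhds.div_atTop (Real.tendsto_sqrt_atTop.comp tendsto_natCast_atTop_atTop))
  rw [add_zero] at ht
  refine ge_of_tendsto ht ?_
  filter_upwards [hf, eventually_ge_atTop 1] with n h1 h2
  have := (abs_le.1 (h n h2)).2
  linarith

lemma lim_ge {a b K : ℝ} {f : ℕ → ℝ} (h : ∀ n : ℕ, 1 ≤ n → |a - f n| ≤ K / √n) (hf : ∀ᶠ n in atTop, b ≤ f n) : b ≤ a := by
  have := lim_le (a := -a) (b := -b) (K := K) (f := fun n => - f n) (fun n hn => by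
    rw [show -a - -f n = -(a - f n) by ring, abs_neg]; exact h n hn) (hf.mono fun n hn => by linarith)
  linarith

lemma VX_int (hRH : RiemannHypothesis) {X : ℝ} (hX : 0 < X) : Integrable (VX X) zmu := by
  have := (Z_weil hRH hX 0).1
  simpa using this

lemma gH_zero (X y : ℝ) : gH X y 0 = exp (-(X ^ 2 / 4) * y ^ 2) * v0 X := by
  unfold gH gv; simp; ring

lemma gH_ge {X : ℝ} (hX : 0 < X) (y x : ℝ) : exp (-(X ^ 2 / 4) * y ^ 2) * gv X x ≤ gH X y x := by
  have e : ∀ s : ℝ, gv X (x + s * y) = v0 X * (exp (-(X ^ 2 / 4) * (x ^ 2 + s ^ 2 * y ^ 2)) * exp (-(X ^ 2 / 2) * s * x * y)) := by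
    intro s; unfold gv; rw [← exp_add]; congr 2; ring
  have e1 := e 1
  have e2 := e (-1)
  rw [one_mul] at e1
  rw [neg_one_mul, ← sub_eq_add_neg] at e2
  unfold gH
  rw [e1, e2]
  have h0 : exp (-(X ^ 2 / 4) * y ^ 2) * gv X x = v0 X * exp (-(X ^ 2 / 4) * (x ^ 2 + y ^ 2)) := by
    unfold gv; rw [mul_add, exp_add]; ring
  rw [h0]
  have a1 := add_one_le_exp (-(X ^ 2 / 2) * 1 * x * y)
  have a2 := add_one_le_exp (-(X ^ 2 / 2) * (-1) * x * y)
  have : 0 < v0 X * exp (-(X ^ 2 / 4) * (x ^ 2 + y ^ 2)) := mul_pos (v0_pos hX) (exp_pos _)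
  simp only [one_pow, one_mul, neg_one_sq]
  nlinarith

lemma gH_pos {X : ℝ} (hX : 0 < X) (y x : ℝ) : 0 < gH X y x := by
  unfold gH; have := gv_pos hX (x - y); have := gv_pos hX (x + y); linarith

lemma gH_int {X : ℝ} (hX : 0 < X) (y : ℝ) : Integrable (gH X y) :=
  (((gv_int hX).comp_sub_right y).add ((gv_int hX).comp_add_right y)).div_const 2

lemma Z_le (hRH : RiemannHypothesis) {X : ℝ} (hX : 1 ≤ X) (y : ℝ) :
    Zf X y ≤ 3 * exp (|y| / 2) + exp (-(X ^ 2 / 4) * y ^ 2) * (v0 X * (log X + 3)) -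
      2 * ∑' m : ℕ, vL m * gH X y (log m) := by
  have hX0 : 0 < X := by linarith
  obtain ⟨-, -, K, hK⟩ := Z_weil hRH hX0 y
  refine lim_le hK ?_
  have hρ := exp_pos (-(X ^ 2 / 4) * y ^ 2)
  filter_upwards [eventually_ge_atTop ⌈X + 1⌉₊] with n hn
  have hn : X + 1 ≤ n := Nat.ceil_le.1 hn
  have h1 : ∫ x, gH X y x * exp (|x| / 2) ≤ 3 * exp (|y| / 2) := by
    have a := gv_half hX y
    have b := gv_half hX (-y)
    have e : ∀ x, gH X y x * exp (|x| / 2) = (gv X (x + -y) * exp (|x| / 2) + gv X (x + y) * exp (|x| / 2)) / 2 := by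
      intro x; unfold gH; rw [← sub_eq_add_neg]; ring
    simp_rw [e]
    rw [integral_div, integral_add b.1 a.1]
    have := a.2
    have b2 := b.2
    rw [abs_neg] at b2
    linarith
  have h2 : exp (-(X ^ 2 / 4) * y ^ 2) * ∑ j ∈ range n, ∫ x, gv X x * exp (-(1 / 2 + 2 * ((j:ℝ) + 1)) * |x|) ≤
      ∑ j ∈ range n, ∫ x, gH X y x * exp (-(1 / 2 + 2 * ((j:ℝ) + 1)) * |x|) := by
    rw [mul_sum]
    refine sum_le_sum fun j _ => ?_
    rw [← integral_const_mul]
    refine integral_mono ((gv_exp_int hX0 (by positivity)).const_mul _) ?_ fun x => ?_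
    · refine (gH_int hX0 y).mul_bdd (c := 1) (Continuous.aestronglyMeasurable (by fun_prop)) (evA fun x => ?_)
      rw [norm_eq_abs, abs_of_pos (exp_pos _), exp_le_one_iff, neg_mul]
      exact neg_nonpos.2 (by positivity)
    · simp only
      rw [← mul_assoc]
      exact mlr (gH_ge hX0 y x) (exp_pos _).le
  have h3 := mll (gsum_ge hX n hn) hρ.le
  have h4 : 0 ≤ log π := log_nonneg (by linarith [pi_gt_three])
  rw [gH_zero]
  have h5 : 0 ≤ log π * (exp (-(X ^ 2 / 4) * y ^ 2) * v0 X) := mul_nonneg h4 (mul_nonneg hρ.le (v0_pos hX0).le)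
  nlinarith

lemma v0_le {X : ℝ} (hX : 0 ≤ X) : v0 X ≤ X := by
  unfold v0
  have : 1 ≤ √π := Real.one_le_sqrt.2 (by linarith [pi_gt_three])
  exact div_le_self hX (by linarith)

lemma prime_nonneg {X : ℝ} (hX : 0 < X) (y : ℝ) : 0 ≤ ∑' m : ℕ, vL m * gH X y (log m) :=
  tsum_nonneg fun m => mul_nonneg (vL_nonneg m) (gH_pos hX _ _).le

lemma Z0_le (hRH : RiemannHypothesis) {X : ℝ} (hX : 1 ≤ X) : Zf X 0 ≤ v0 X * log X + 6 * X := by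
  have h := Z_le hRH hX 0
  have h2 := prime_nonneg (X := X) (by linarith) 0
  have h3 := v0_le (X := X) (by linarith)
  simp at h
  nlinarith

lemma exp_sq_le {X y : ℝ} (hy : y ≠ 0) : X ^ 2 * exp (-(X ^ 2 / 4) * y ^ 2) ≤ 4 / y ^ 2 := by
  have h := add_one_le_exp (X ^ 2 / 4 * y ^ 2)
  have hy2 : 0 < y ^ 2 := by positivity
  rw [neg_mul, exp_neg, ← div_eq_mul_inv, div_le_div_iff₀ (exp_pos _) hy2]
  nlinarith

/- off-diagonal bound -/
lemma Z_off (hRH : RiemannHypothesis) {X : ℝ} (hX : 1 ≤ X) {y : ℝ} (hy : 0 < y) :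
    Zf X y ≤ 3 * exp (y / 2) + 4 * (log X + 3) / y := by
  have hX0 : 0 < X := by linarith
  have h := Z_le hRH hX y
  have h2 := prime_nonneg hX0 y
  have h3 := v0_le hX0.le
  have hl : 0 ≤ log X := log_nonneg hX
  rw [abs_of_pos hy] at h
  have key : X * exp (-(X ^ 2 / 4) * y ^ 2) ≤ 4 / y := by
    have h4 := add_one_le_exp (X ^ 2 / 4 * y ^ 2)
    rw [neg_mul, exp_neg, ← div_eq_mul_inv, div_le_div_iff₀ (exp_pos _) hy]
    nlinarith [sq_nonneg (X * y / 2 - 1)]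
  have : exp (-(X ^ 2 / 4) * y ^ 2) * (v0 X * (log X + 3)) ≤ 4 * (log X + 3) / y := by
    calc _ ≤ exp (-(X ^ 2 / 4) * y ^ 2) * (X * (log X + 3)) := by gcongr
      _ = (X * exp (-(X ^ 2 / 4) * y ^ 2)) * (log X + 3) := by ring
      _ ≤ 4 / y * (log X + 3) := by gcongr
      _ = _ := by ring
  linarith

lemma Z_log (hRH : RiemannHypothesis) {X : ℝ} (hX : 1 ≤ X) {n : ℕ} (hn : 2 ≤ n) :
    Zf X (log n) ≤ 40 * √n - v0 X * vL n := by
  have hX0 : 0 < X := by linarith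
  have hn0 : (2:ℝ) ≤ n := by exact_mod_cast hn
  have h := Z_le hRH hX (log n)
  have hlog : 1 / 2 ≤ log n := by
    have : log 2 ≤ log n := log_le_log (by norm_num) hn0
    linarith [log_two_gt_d9]
  have h3 := v0_le hX0.le
  have hl : log X ≤ X - 1 := log_le_sub_one_of_pos hX0
  have hl0 : 0 ≤ log X := log_nonneg hX
  have e1 : exp (|log n| / 2) = √n := by
    rw [abs_of_nonneg (by linarith), sqrt_eq_rpow, rpow_def_of_pos (by linarith)]; congr 1; ring
  rw [e1] at h
  have h4 : exp (-(X ^ 2 / 4) * log n ^ 2) * (v0 X * (log X + 3)) ≤ 48 := by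
    calc _ ≤ exp (-(X ^ 2 / 4) * log n ^ 2) * (X * (3 * X)) := by
          refine mll (mul_le_mul h3 (by linarith) (by linarith) hX0.le) (exp_pos _).le
      _ = 3 * (X ^ 2 * exp (-(X ^ 2 / 4) * log n ^ 2)) := by ring
      _ ≤ 3 * (4 / log n ^ 2) := by gcongr; exact exp_sq_le (by linarith)
      _ ≤ 3 * (4 / (1 / 2) ^ 2) := by gcongr
      _ = 48 := by norm_num
  have h5 : vL n * gH X (log n) (log n) ≤ ∑' m : ℕ, vL m * gH X (log n) (log m) :=
    (Z_weil hRH hX0 (log n)).2.1.le_tsum n fun m _ => mul_nonneg (vL_nonneg m) (gH_pos hX0 _ _).le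
  have h6 : v0 X / 2 ≤ gH X (log n) (log n) := by
    unfold gH
    have a := gv_pos hX0 (log n + log n)
    have b : gv X (log n - log n) = v0 X := by unfold gv; simp
    rw [b]; linarith
  have h7 := mll h6 (vL_nonneg n)
  have h8 : 1.4 ≤ √(n:ℝ) := Real.le_sqrt_of_sq_le (by norm_num; linarith)
  linarith

lemma Z0_ge (hRH : RiemannHypothesis) : ∃ C : ℝ, ∀ X : ℝ, 8 ≤ X → v0 X * log X - C * X ≤ Zf X 0 := by
  have hs : Summable (fun m : ℕ => 1 / (m:ℝ) ^ 2) := Real.summable_one_div_nat_pow.2 (by norm_num)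
  refine ⟨log π + 1 + 2 + 2 * ∑' m : ℕ, 1 / (m:ℝ) ^ 2, fun X hX => ?_⟩
  have hX0 : 0 < X := by linarith
  obtain ⟨-, hsum, K, hK⟩ := Z_weil hRH hX0 0
  have hgH : ∀ x, gH X 0 x = gv X x := fun x => by unfold gH; simp
  have h3 := v0_le hX0.le
  have hv := v0_pos hX0
  have hp : ∑' m : ℕ, vL m * gH X 0 (log m) ≤ X * ∑' m : ℕ, 1 / (m:ℝ) ^ 2 := by
    rw [← tsum_mul_left]
    refine hsum.tsum_le_tsum (fun m => ?_) (hs.mul_left X)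
    rcases Nat.lt_or_ge m 2 with hm | hm
    · have : vL m = 0 := by interval_cases m <;> simp [vL]
      rw [this, zero_mul]; positivity
    have hm0 : (2:ℝ) ≤ m := by exact_mod_cast hm
    have hlog : 1 / 2 ≤ log m := by
      have : log 2 ≤ log m := log_le_log (by norm_num) hm0
      linarith [log_two_gt_d9]
    have a1 : vL m ≤ m := by
      unfold vL
      have : 1 ≤ √(m:ℝ) := Real.one_le_sqrt.2 (by linarith)
      calc _ ≤ vonMangoldt m := div_le_self vonMangoldt_nonneg this
        _ ≤ log m := vonMangoldt_le_log
        _ ≤ m := Real.log_le_self (by linarith)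
    have a2 : gv X (log m) ≤ X * (1 / (m:ℝ) ^ 3) := by
      unfold gv
      refine mul_le_mul h3 ?_ (exp_pos _).le hX0.le
      have : 1 / (m:ℝ) ^ 3 = exp (-(3 * log m)) := by
        rw [exp_neg, mul_comm, Real.exp_mul, exp_log (by linarith)]; norm_num
      rw [this]
      apply Real.exp_le_exp.2
      have h16 : (16:ℝ) ≤ X ^ 2 / 4 := by nlinarith
      have := mlr h16 (sq_nonneg (log m))
      nlinarith
    rw [hgH]
    calc vL m * gv X (log m) ≤ m * (X * (1 / (m:ℝ) ^ 3)) := by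
          gcongr
          exact (gv_pos hX0 _).le
      _ = X * (1 / (m:ℝ) ^ 2) := by field_simp
  refine lim_ge hK ?_
  filter_upwards [eventually_ge_atTop ⌈X + 1⌉₊] with n hn
  have hn : X + 1 ≤ n := Nat.ceil_le.1 hn
  have h1 := gsum_le (by linarith) n hn
  simp_rw [hgH] at hp ⊢
  have h0 : 0 ≤ ∫ x, gv X x * exp (|x| / 2) := integral_nonneg fun x => mul_nonneg (gv_pos hX0 x).le (exp_pos _).le
  have g0 : gv X 0 = v0 X := by unfold gv; simp
  rw [g0]
  have h4 : 0 ≤ log π := log_nonneg (by linarith [pi_gt_three])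
  nlinarith

open ArithmeticFunction in
lemma log_fact (N : ℕ) : Real.log (Nat.factorial N) = ∑ n ∈ Ioc 0 N, vonMangoldt n * ((N / n : ℕ) : ℝ) := by
  rw [← sum_Ioc_mul_zeta_eq_sum, vonMangoldt_mul_zeta]
  induction N with
  | zero => simp
  | succ k ih =>
    rw [Nat.factorial_succ, sum_Ioc_succ_top (by omega), ← ih, Nat.cast_mul,
      Real.log_mul (by positivity) (by positivity)]
    simp [add_comm]

/-- Partial sums of `Λ(n)/n`. -/
def mS (N : ℕ) : ℝ := ∑ n ∈ Ioc 0 N, vonMangoldt n / n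

lemma mS_bounds {N : ℕ} (hN : 1 ≤ N) : log N - 1 ≤ mS N ∧ mS N ≤ log N + 6 := by
  have hN0 : (0:ℝ) < N := by exact_mod_cast hN
  have hf := log_fact N
  have h0 : ∀ n, 0 ≤ vonMangoldt n := fun n => vonMangoldt_nonneg
  constructor
  · have h1 := Real.pow_div_factorial_le_exp (N:ℝ) hN0.le N
    have h2 := log_le_log (by positivity) h1
    rw [log_exp, log_div (by positivity) (by positivity), log_pow, hf] at h2
    have h3 : ∑ n ∈ Ioc 0 N, vonMangoldt n * ((N / n : ℕ) : ℝ) ≤ N * mS N := by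
      unfold mS
      rw [mul_sum]
      refine sum_le_sum fun n _ => ?_
      have := mll (Nat.cast_div_le (α := ℝ) (m := N) (n := n)) (h0 n)
      refine this.trans (le_of_eq (by ring))
    nlinarith
  · have h1 : (Nat.factorial N : ℝ) ≤ N ^ N := by exact_mod_cast Nat.factorial_le_pow N
    have h2 := log_le_log (by positivity) h1
    rw [log_pow, hf] at h2
    have h3 := Chebyshev.psi_le_const_mul_self hN0.le
    unfold Chebyshev.psi at h3
    rw [Nat.floor_natCast] at h3
    have h4 : N * mS N ≤ ∑ n ∈ Ioc 0 N, vonMangoldt n * ((N / n : ℕ) : ℝ)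
        + ∑ n ∈ Ioc 0 N, vonMangoldt n := by
      unfold mS
      rw [mul_sum, ← sum_add_distrib]
      refine sum_le_sum fun n hn => ?_
      have hn := Finset.mem_Ioc.1 hn
      have : (N:ℝ) / n ≤ ((N / n : ℕ) : ℝ) + 1 := by
        rw [← Nat.floor_div_eq_div (K := ℝ)]
        exact (Nat.lt_floor_add_one _).le
      calc (N:ℝ) * (vonMangoldt n / n) = vonMangoldt n * (N / n) := by ring
        _ ≤ vonMangoldt n * (((N / n : ℕ) : ℝ) + 1) := mll this (h0 n)
        _ = _ := by ring
    have h5 : log 4 ≤ 2 := by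
      rw [show (4:ℝ) = 2 ^ 2 by norm_num, log_pow]; push_cast; linarith [log_two_lt_d9]
    nlinarith

lemma nonprime_sum : ∃ C : ℝ, 0 ≤ C ∧ ∀ s : Finset ℕ,
    ∑ n ∈ s, (if n.Prime then 0 else vonMangoldt n / n) ≤ C := by
  have h := ArithmeticFunction.vonMangoldt.summable_residueClass_non_primes_div (q := 1) 0
  have e : (fun n : ℕ => (if n.Prime then 0 else ArithmeticFunction.vonMangoldt.residueClass (0 : ZMod 1) n) / (n:ℝ))
      = fun n : ℕ => (if n.Prime then 0 else vonMangoldt n / n) := by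
    funext n
    split_ifs
    · simp
    · simp [ArithmeticFunction.vonMangoldt.residueClass, Set.indicator_apply, Subsingleton.elim ((n : ZMod 1)) 0]
  rw [e] at h
  have h0 : ∀ n : ℕ, 0 ≤ (if n.Prime then 0 else vonMangoldt n / (n:ℝ)) := fun n => by
    split_ifs
    · rfl
    · exact div_nonneg vonMangoldt_nonneg (by positivity)
  exact ⟨_, tsum_nonneg h0, fun s => h.sum_le_tsum s fun n _ => h0 n⟩

lemma vL_sq (n : ℕ) : vL n ^ 2 = vonMangoldt n ^ 2 / n := by
  unfold vL; rw [div_pow, sq_sqrt (by positivity)]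

lemma vL_sq_le {N : ℕ} (hN : 1 ≤ N) : ∑ n ∈ Ioc 0 N, vL n ^ 2 ≤ log N * (log N + 6) := by
  have hl : 0 ≤ log N := log_nonneg (by exact_mod_cast hN)
  calc _ ≤ ∑ n ∈ Ioc 0 N, log N * (vonMangoldt n / n) := by
        refine sum_le_sum fun n hn => ?_
        have hn := Finset.mem_Ioc.1 hn
        have h1 : vonMangoldt n ≤ log N :=
          ArithmeticFunction.vonMangoldt_le_log.trans
            (log_le_log (by exact_mod_cast hn.1) (by exact_mod_cast hn.2))
        rw [vL_sq, sq, mul_div_assoc]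
        exact mlr h1 (div_nonneg vonMangoldt_nonneg (by positivity))
    _ = log N * mS N := by rw [← mul_sum]; rfl
    _ ≤ _ := mll (mS_bounds hN).2 hl

lemma vL_sq_ge : ∃ C : ℝ, 0 ≤ C ∧ ∀ M N : ℕ, 1 ≤ M → M ≤ N →
    log M * (log N - log M - C) ≤ ∑ n ∈ Ioc M N, vL n ^ 2 := by
  obtain ⟨C, hC, h⟩ := nonprime_sum
  refine ⟨C + 7, by linarith, fun M N hM hMN => ?_⟩
  have hl : 0 ≤ log M := log_nonneg (by exact_mod_cast hM)
  have h1 := (mS_bounds hM).2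
  have h2 := (mS_bounds (hM.trans hMN)).1
  have h3 : mS N = mS M + ∑ n ∈ Ioc M N, vonMangoldt n / n :=
    (sum_Ioc_consecutive _ (Nat.zero_le _) hMN).symm
  have h4 := h (Ioc M N)
  calc _ ≤ log M * (∑ n ∈ Ioc M N, vonMangoldt n / n
        - ∑ n ∈ Ioc M N, (if n.Prime then 0 else vonMangoldt n / n)) := by
        exact mll (by linarith) hl
    _ = ∑ n ∈ Ioc M N, log M * (if n.Prime then vonMangoldt n / n else 0) := by
        rw [← sum_sub_distrib, mul_sum]
        refine sum_congr rfl fun n _ => ?_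
        split_ifs <;> simp
    _ ≤ _ := by
        refine sum_le_sum fun n hn => ?_
        have hn := Finset.mem_Ioc.1 hn
        split_ifs with hp
        · rw [vL_sq, sq, mul_div_assoc]
          refine mlr ?_ (div_nonneg vonMangoldt_nonneg (by positivity))
          rw [ArithmeticFunction.vonMangoldt_apply_prime hp]
          exact log_le_log (by exact_mod_cast hM) (by exact_mod_cast hn.1.le)
        · rw [mul_zero]; positivity

/-- Triangle window. -/
def kap (W x : ℝ) : ℝ := max 0 (1 - |x| / W) / W

def Jw (W c u : ℝ) : ℝ := ∫ x, kap W x * exp (-c * |x|) * cos (u * x)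

lemma kap_cont (W : ℝ) : Continuous (kap W) := by unfold kap; fun_prop
lemma kap_even (W x : ℝ) : kap W (-x) = kap W x := by unfold kap; rw [abs_neg]
lemma kap_nonneg {W : ℝ} (hW : 0 < W) (x : ℝ) : 0 ≤ kap W x := div_nonneg (le_max_left _ _) hW.le
lemma kap_le {W : ℝ} (hW : 0 < W) (x : ℝ) : kap W x ≤ 1 / W := by
  unfold kap; gcongr; exact max_le zero_le_one (by have : 0 ≤ |x| / W := by positivity
                                                   linarith)
lemma kap_zero {W : ℝ} (hW : 0 < W) {x : ℝ} (hx : W ≤ |x|) : kap W x = 0 := by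
  unfold kap; rw [max_eq_left, zero_div]; rw [sub_nonpos, le_div_iff₀ hW]; linarith

lemma kap_int {W : ℝ} (hW : 0 < W) {g : ℝ → ℝ} (hg : Continuous g) : Integrable (fun x => kap W x * g x) := by
  refine Continuous.integrable_of_hasCompactSupport ((kap_cont W).mul hg)
    (HasCompactSupport.intro (isCompact_Icc (a := -W) (b := W)) fun x hx => ?_)
  rw [kap_zero hW, zero_mul]
  by_contra h
  exact hx (abs_le.1 (not_le.1 h).le)

lemma Jw_eq {W : ℝ} (hW : 0 < W) {c u : ℝ} (hz : (c + u * I : ℂ) ≠ 0) :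
    Jw W c u = 2 / W * (1 / (c + u * I : ℂ) -
      (1 - Complex.exp (-(c + u * I) * W)) / (W * (c + u * I) ^ 2)).re := by
  set z : ℂ := c + u * I with hzd
  unfold Jw
  have h1 : ∀ x : ℝ, kap W x * exp (-c * |x|) * cos (u * x) =
      (fun y => kap W y * exp (-c * y) * cos (u * y)) |x| := by
    intro x
    rcases abs_cases x with ⟨h, _⟩ | ⟨h, _⟩ <;> simp only [h]
    rw [mul_neg u, cos_neg, kap_even]
  simp_rw [h1]
  rw [integral_comp_abs (f := fun y => kap W y * exp (-c * y) * cos (u * y))]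
  rw [setIntegral_eq_of_subset_of_forall_sdiff_eq_zero (s := Set.Ioc 0 W) measurableSet_Ioi
    (fun x hx => hx.1) (fun x hx => by
      have : W < x := by
        by_contra h; exact hx.2 ⟨hx.1, not_lt.1 h⟩
      rw [kap_zero hW (this.le.trans (le_abs_self x))]; ring), ← integral_of_le hW.le]
  have hW' : (W:ℂ) ≠ 0 := by exact_mod_cast hW.ne'
  have hd : ∀ x ∈ Set.uIcc 0 W, HasDerivAt (fun x : ℝ => Complex.exp (-z * x) * (-(1 - x / W) / z + 1 / (W * z ^ 2)))
      ((1 - x / W) * Complex.exp (-z * x)) x := by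
    intro x _
    have e1 : HasDerivAt (fun x : ℝ => (x:ℂ)) 1 x := Complex.ofRealCLM.hasDerivAt
    have e2 := (e1.const_mul (-z)).cexp
    have e3 := ((((e1.div_const (W:ℂ)).const_sub 1).neg).div_const z).add_const (1 / (W * z ^ 2))
    refine (e2.mul e3).congr_deriv ?_
    simp only [Pi.neg_apply]
    field_simp
    ring
  have hc : Continuous (fun x : ℝ => (1 - x / W) * Complex.exp (-z * x)) := by fun_prop
  have h2 := integral_eq_sub_of_hasDerivAt hd (hc.intervalIntegrable _ _)
  have h3 := Complex.reCLM.intervalIntegral_comp_comm (hc.intervalIntegrable (μ := volume) 0 W)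
  rw [h2] at h3
  have h4 : ∀ x ∈ Set.uIcc 0 W, kap W x * exp (-c * x) * cos (u * x) =
      (1 / W) * Complex.reCLM ((1 - x / W) * Complex.exp (-z * x)) := by
    intro x hx
    rw [Set.uIcc_of_le hW.le] at hx
    have a1 : (1 - x / W : ℂ) = ((1 - x / W : ℝ) : ℂ) := by push_cast; ring
    rw [reCLM_apply, a1, re_ofReal_mul, exp_re]
    have a2 : (-z * x).re = -c * x := by simp [hzd]
    have a3 : (-z * x).im = -(u * x) := by simp [hzd]
    have a4 : kap W x = (1 - x / W) / W := by
      unfold kap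
      rw [abs_of_nonneg hx.1, max_eq_right]
      rw [sub_nonneg, div_le_one hW]; exact hx.2
    rw [a2, a3, a4, cos_neg]; ring
  rw [integral_congr h4, intervalIntegral.integral_const_mul, h3, reCLM_apply]
  rw [show ∀ a : ℝ, 2 * (1 / W * a) = 2 / W * a from fun a => by ring]
  congr 2
  have : (1 - (W:ℂ) / W) = 0 := by rw [div_self hW', sub_self]
  rw [this]
  simp
  field_simp
  ring

lemma Jw_bound {W : ℝ} (hW : 0 < W) {c u : ℝ} (hc : c ≠ 0) :
    |Jw W c u - 2 / W * Pk c u| ≤ 2 * (1 + exp (-c * W)) / (W ^ 2 * (c ^ 2 + u ^ 2)) := by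
  have hz : (c + u * I : ℂ) ≠ 0 := fun h => hc (by simpa using congrArg re h)
  rw [Jw_eq hW hz]
  have e1 : (1 / (c + u * I : ℂ)).re = Pk c u := by
    simp [normSq_apply, Pk, sq]
  have n2 : ‖(c + u * I : ℂ)‖ ^ 2 = c ^ 2 + u ^ 2 := by
    rw [← Complex.normSq_eq_norm_sq, normSq_apply]; simp; ring
  rw [sub_re, e1, show ∀ a b : ℝ, 2 / W * (a - b) - 2 / W * a = -(2 / W * b) from fun a b => by ring, abs_neg,
    abs_mul, abs_of_pos (by positivity : 0 < 2 / W)]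
  have h5 := abs_re_le_norm ((1 - Complex.exp (-(c + u * I) * W)) / (W * (c + u * I) ^ 2))
  have h6 : ‖(1 - Complex.exp (-(c + u * I) * W))‖ ≤ 1 + exp (-c * W) := by
    refine (norm_sub_le _ _).trans ?_
    rw [norm_one, norm_exp]
    simp
  rw [norm_div, norm_mul, norm_pow, n2, norm_real, norm_eq_abs, abs_of_pos hW] at h5
  have hp : 0 < c ^ 2 + u ^ 2 := by positivity
  calc _ ≤ 2 / W * ((1 + exp (-c * W)) / (W * (c ^ 2 + u ^ 2))) := by
        gcongr; exact h5.trans (by gcongr)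
    _ = _ := by field_simp

lemma Jw_zero_nonneg {W : ℝ} (hW : 0 < W) (u : ℝ) : 0 ≤ Jw W 0 u := by
  by_cases hu : u = 0
  · subst hu
    exact integral_nonneg fun x => by simp; exact kap_nonneg hW x
  rw [Jw_eq hW (by simp [hu])]
  refine mul_nonneg (by positivity) ?_
  have : (1 / ((0:ℝ) + u * I : ℂ) - (1 - Complex.exp (-((0:ℝ) + u * I) * W)) / (W * ((0:ℝ) + u * I) ^ 2)).re
      = (1 - cos (u * W)) / (W * u ^ 2) := by
    have e : (W * ((0:ℝ) + u * I) ^ 2 : ℂ) = ((-(W * u ^ 2) : ℝ) : ℂ) := by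
      push_cast; rw [zero_add, mul_pow, Complex.I_sq]; ring
    rw [e, sub_re, Complex.div_ofReal_re, sub_re, exp_re]
    simp [normSq_apply]
    rw [div_neg, neg_neg]
  rw [this]
  exact div_nonneg (by linarith [cos_le_one (u * W)]) (by positivity)

lemma kap_integral {W : ℝ} (hW : 0 < W) : Jw W 0 0 = 1 := by
  unfold Jw
  have h1 : ∀ x : ℝ, kap W x * exp (-0 * |x|) * cos (0 * x) = kap W |x| := by
    intro x; unfold kap; simp
  simp_rw [h1]
  rw [integral_comp_abs (f := fun y => kap W y)]
  rw [setIntegral_eq_of_subset_of_forall_sdiff_eq_zero (s := Set.Ioc 0 W) measurableSet_Ioi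
    (fun x hx => hx.1) (fun x hx => by
      have : W < x := by
        by_contra h; exact hx.2 ⟨hx.1, not_lt.1 h⟩
      rw [kap_zero hW (this.le.trans (le_abs_self x))]), ← integral_of_le hW.le]
  have h4 : ∀ x ∈ Set.uIcc 0 W, kap W x = (1 - x / W) / W := by
    intro x hx
    rw [Set.uIcc_of_le hW.le] at hx
    unfold kap
    rw [abs_of_nonneg hx.1, max_eq_right]
    rw [sub_nonneg, div_le_one hW]; exact hx.2
  have hd : ∀ x ∈ Set.uIcc 0 W, HasDerivAt (fun x : ℝ => (x - x ^ 2 / (2 * W)) / W) ((1 - x / W) / W) x := by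
    intro x _
    refine (((hasDerivAt_id x).sub ((hasDerivAt_pow 2 x).div_const (2 * W))).div_const W).congr_deriv ?_
    field_simp; ring
  rw [integral_congr h4, integral_eq_sub_of_hasDerivAt hd
    (Continuous.intervalIntegrable (by fun_prop) _ _)]
  field_simp; ring

lemma Jw_zero_ge {W : ℝ} (hW : 0 < W) {u : ℝ} (hu : W * |u| ≤ 1) : 1 / 2 ≤ Jw W 0 u := by
  have h := kap_integral hW
  unfold Jw at h ⊢
  have i1 : ∀ u : ℝ, Integrable (fun x => kap W x * exp (-0 * |x|) * cos (u * x)) := fun u => by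
    simp_rw [mul_assoc]; exact kap_int hW (by fun_prop)
  have h3 : (1 / 2 : ℝ) = ∫ x, (1 / 2) * (kap W x * exp (-0 * |x|) * cos (0 * x)) := by
    rw [integral_const_mul, h, mul_one]
  rw [h3]
  refine integral_mono ((i1 0).const_mul _) (i1 u) fun x => ?_
  simp only [neg_zero, zero_mul, Real.exp_zero, cos_zero, mul_one]
  rcases le_or_gt W |x| with hx | hx
  · rw [kap_zero hW hx]; simp
  have := Real.one_sub_sq_div_two_le_cos (x := u * x)
  have h2 : (u * x) ^ 2 ≤ 1 := by
    rw [sq_le_one_iff_abs_le_one, abs_mul]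
    calc |u| * |x| ≤ |u| * W := by gcongr
      _ ≤ 1 := by linarith
  nlinarith [kap_nonneg hW x]

lemma cos_prod_int {g : ℝ → ℝ} (hi : ∀ u : ℝ, Integrable (fun x => g x * cos (u * x))) (a b : ℝ) :
    ∫ x, g x * cos (a * x) * cos (b * x) =
      ((∫ x, g x * cos ((b - a) * x)) + ∫ x, g x * cos ((b + a) * x)) / 2 := by
  rw [← integral_add (hi _) (hi _), ← integral_div]
  congr 1; funext x
  rw [sub_mul, add_mul, cos_sub, cos_add]; ring

lemma csum_ge (t : ℝ) (n : ℕ) :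
    log ((1 / 2 + 2 * ((n:ℝ) + 1)) ^ 2 + t ^ 2) / 4 - log ((5 / 2) ^ 2 + t ^ 2) / 4
      - (3 / 2) * (2 / 3 - 1 / (1 / 2 + 2 * ((n:ℝ) + 1) - 1)) ≤
    ∑ j ∈ range n, (Pk (1 / 2 + 2 * ((j:ℝ) + 1)) t - 2 / (1 / 2 + 2 * ((j:ℝ) + 1)) ^ 2) := by
  induction n with
  | zero => norm_num
  | succ k ih =>
    rw [sum_range_succ]
    push_cast
    have hk : (0:ℝ) ≤ k := Nat.cast_nonneg k
    set c : ℝ := 1 / 2 + 2 * ((k:ℝ) + 1) with hc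
    have hc0 : 5 / 2 ≤ c := by linarith
    have e : (1 / 2 + 2 * ((k:ℝ) + 1 + 1)) = c + 2 := by rw [hc]; ring
    rw [e]
    have hp : 0 < c ^ 2 + t ^ 2 := by positivity
    have h1 : log ((c + 2) ^ 2 + t ^ 2) - log (c ^ 2 + t ^ 2) ≤ 4 * (c + 1) / (c ^ 2 + t ^ 2) := by
      rw [← log_div (by positivity) hp.ne']
      refine (log_le_sub_one_of_pos (by positivity)).trans (le_of_eq ?_)
      field_simp; ring
    have h2 : 4 * (c + 1) / (c ^ 2 + t ^ 2) = 4 * Pk c t + 4 * (1 / (c ^ 2 + t ^ 2)) := by unfold Pk; field_simp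
    have h3 : 1 / (c ^ 2 + t ^ 2) ≤ 1 / c ^ 2 := by gcongr; nlinarith
    have h4 : 1 / c ^ 2 ≤ (1 / (c - 1) - 1 / (c + 2 - 1)) / 2 := by
      have a1 : 0 < c - 1 := by linarith
      have a2 : 0 < c + 2 - 1 := by linarith
      rw [div_sub_div _ _ a1.ne' a2.ne', div_div, div_le_div_iff₀ (by positivity) (by positivity)]
      nlinarith
    have h5 : 2 / c ^ 2 = 2 * (1 / c ^ 2) := by ring
    rw [h5]
    linarith

lemma csum_ge' (t : ℝ) {n : ℕ} (hn : 1 ≤ n) :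
    log n / 2 - log (3 + |t|) / 2 - 1 ≤
    ∑ j ∈ range n, (Pk (1 / 2 + 2 * ((j:ℝ) + 1)) t - 2 / (1 / 2 + 2 * ((j:ℝ) + 1)) ^ 2) := by
  refine le_trans ?_ (csum_ge t n)
  have hn0 : (1:ℝ) ≤ n := by exact_mod_cast hn
  have h1 : 2 * log n ≤ log ((1 / 2 + 2 * ((n:ℝ) + 1)) ^ 2 + t ^ 2) := by
    rw [show (2:ℝ) * log n = log ((n:ℝ) ^ 2) by rw [log_pow]; norm_num]
    exact log_le_log (by positivity) (by nlinarith [sq_nonneg t])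
  have h2 : log ((5 / 2) ^ 2 + t ^ 2) ≤ 2 * log (3 + |t|) := by
    rw [show (2:ℝ) * log (3 + |t|) = log ((3 + |t|) ^ 2) by rw [log_pow]; norm_num]
    exact log_le_log (by positivity) (by nlinarith [sq_abs t, abs_nonneg t])
  have h3 : 0 < 1 / (1 / 2 + 2 * ((n:ℝ) + 1) - 1) := one_div_pos.2 (by linarith)
  linarith

lemma Jw_neg_one {W : ℝ} (hW : 0 < W) (u : ℝ) :
    |Jw W (-1) u| ≤ (2 / W + 2 * (1 + exp W) / W ^ 2) / (1 + u ^ 2) := by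
  have h := Jw_bound hW (c := -1) (u := u) (by norm_num)
  have h1 : Pk (-1) u = -(1 / (1 + u ^ 2)) := by unfold Pk; norm_num; ring
  rw [h1] at h
  have h2 := abs_le.1 h
  have h3 : 2 * (1 + exp (- -1 * W)) / (W ^ 2 * ((-1) ^ 2 + u ^ 2)) = 2 * (1 + exp W) / W ^ 2 / (1 + u ^ 2) := by
    norm_num; rw [div_div]
  have h5 : 0 ≤ 2 / W * (1 / (1 + u ^ 2)) := by positivity
  rw [h3] at h2
  rw [add_div, show 2 / W / (1 + u ^ 2) = 2 / W * (1 / (1 + u ^ 2)) by ring]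
  rw [abs_le]; constructor <;> linarith [h2.1, h2.2]

lemma sq_shift (s t : ℝ) : 1 / (1 + (s - t) ^ 2) ≤ 2 * (1 + t ^ 2) / (1 + s ^ 2) := by
  rw [div_le_div_iff₀ (by positivity) (by positivity)]
  nlinarith [sq_nonneg (s - 2 * t), sq_nonneg (t * (s - t))]

lemma window (hRH : RiemannHypothesis) {W : ℝ} (hW : 1 ≤ W) (t : ℝ) :
    Integrable (fun γ => (Jw W 0 (γ - t) + Jw W 0 (γ + t)) / 2) zmu ∧
    ∫ γ, (Jw W 0 (γ - t) + Jw W 0 (γ + t)) / 2 ∂zmu ≤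
      2 + log (3 + |t|) / W + 16 * exp (W / 2) / (1 + t ^ 2)
        - 2 * ∑' m : ℕ, vL m * (kap W (log m) * cos (t * log m)) := by
  have hW0 : 0 < W := by linarith
  have hint : ∀ c u : ℝ, Integrable (fun x => kap W x * exp (-c * |x|) * cos (u * x)) := fun c u => by
    simp_rw [mul_assoc]; exact kap_int hW0 (by fun_prop)
  set A := (2 / W + 2 * (1 + exp W) / W ^ 2) with hA
  have hA0 : 0 < A := by positivity
  obtain ⟨w1, w2, w3⟩ := weil hRH (H := fun x => kap W x * cos (t * x)) (CF := A * (2 * (1 + t ^ 2)))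
    (fun x => by rw [kap_even, mul_neg, cos_neg]) ((kap_cont W).mul (by fun_prop))
    (by simp_rw [mul_assoc]; exact kap_int hW0 (by fun_prop))
    (fun s => by
      have e : ∫ x, kap W x * cos (t * x) * exp |x| * cos (s * x) = (Jw W (-1) (s - t) + Jw W (-1) (s + t)) / 2 := by
        unfold Jw
        rw [← cos_prod_int (hint (-1))]
        congr 1; funext x; rw [neg_neg, one_mul]; ring
      rw [e]
      have h1 := Jw_neg_one hW0 (s - t)
      have h2 := Jw_neg_one hW0 (s + t)
      rw [← hA] at h1 h2
      have h3 := mll (sq_shift s t) hA0.le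
      have h4 := mll (sq_shift s (-t)) hA0.le
      rw [sub_neg_eq_add, neg_sq] at h4
      rw [mul_one_div] at h3 h4
      rw [abs_div, abs_two, mul_div_assoc]
      have := abs_add_le (Jw W (-1) (s - t)) (Jw W (-1) (s + t))
      linarith)
  have e0 : (fun γ => ∫ x, kap W x * cos (t * x) * cos (x * γ)) = fun γ => (Jw W 0 (γ - t) + Jw W 0 (γ + t)) / 2 := by
    funext γ
    unfold Jw
    rw [← cos_prod_int (hint 0)]
    congr 1; funext x; rw [mul_comm x γ]; norm_num
  have e1 : ∀ c, ∫ x, kap W x * cos (t * x) * exp (-c * |x|) = Jw W c t := fun c => by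
    unfold Jw; congr 1; funext x; ring
  have e2 : ∫ x, kap W x * cos (t * x) * exp (|x| / 2) = Jw W (-1/2) t := by
    rw [← e1]; congr 1; funext x; congr 2; ring
  simp only [e0, e2, e1] at w1 w3
  refine ⟨w1, lim_le w3 ?_⟩
  filter_upwards [eventually_ge_atTop 1] with n hn
  have hJ : ∀ j ∈ range n, 2 / W * (Pk (1 / 2 + 2 * ((j:ℝ) + 1)) t - 2 / (1 / 2 + 2 * ((j:ℝ) + 1)) ^ 2)
      ≤ Jw W (1 / 2 + 2 * ((j:ℝ) + 1)) t := by
    intro j _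
    have hc0 : (0:ℝ) < 1 / 2 + 2 * ((j:ℝ) + 1) := by positivity
    set c := (1 / 2 + 2 * ((j:ℝ) + 1)) with hc
    have h := (abs_le.1 (Jw_bound hW0 (c := c) (u := t) hc0.ne')).1
    have h2 : 2 * (1 + exp (-c * W)) / (W ^ 2 * (c ^ 2 + t ^ 2)) ≤ 2 / W * (2 / c ^ 2) := by
      have : exp (-c * W) ≤ 1 := Real.exp_le_one_iff.2 (by nlinarith)
      calc _ ≤ 2 * (1 + 1) / (W * (c ^ 2)) := by gcongr <;> nlinarith [sq_nonneg t]
        _ = _ := by field_simp; norm_num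
    linarith
  have hs := sum_le_sum hJ
  rw [← mul_sum] at hs
  have hs2 := mll (csum_ge' t hn) (by positivity : 0 ≤ 2 / W)
  have k0 : kap W 0 = 1 / W := by unfold kap; simp
  have hh : Jw W (-1/2) t ≤ 16 * exp (W / 2) / (1 + t ^ 2) := by
    have h := (abs_le.1 (Jw_bound hW0 (c := -1/2) (u := t) (by norm_num))).2
    have h1 : 2 / W * Pk (-1/2) t ≤ 0 := by
      refine mul_nonpos_of_nonneg_of_nonpos (by positivity) ?_
      unfold Pk; exact div_nonpos_of_nonpos_of_nonneg (by norm_num) (by positivity)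
    have h2 : 2 * (1 + exp (-(-1/2) * W)) / (W ^ 2 * ((-1/2) ^ 2 + t ^ 2)) ≤ 16 * exp (W / 2) / (1 + t ^ 2) := by
      rw [show -(-1/2) * W = W / 2 by ring]
      have : 1 ≤ exp (W / 2) := one_le_exp (by linarith)
      calc _ ≤ 2 * (exp (W / 2) + exp (W / 2)) / (1 * ((1 + t ^ 2) / 4)) := by
            gcongr <;> nlinarith [sq_nonneg t]
        _ = _ := by field_simp; ring
    linarith
  simp only [k0, mul_zero, cos_zero, mul_one]
  have hpi : 0 ≤ log π := log_nonneg (by linarith [pi_gt_three])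
  have h7 : (log n - log π) * (1 / W) - 2 / W * (log n / 2 - log (3 + |t|) / 2 - 1) ≤
      2 + log (3 + |t|) / W := by
    have : (log n - log π) * (1 / W) - 2 / W * (log n / 2 - log (3 + |t|) / 2 - 1) =
      log (3 + |t|) / W + 2 / W - log π / W := by ring
    rw [this]
    have : 2 / W ≤ 2 := div_le_self (by norm_num) hW
    have : 0 ≤ log π / W := by positivity
    linarith
  linarith

lemma zmu_int_mono {f g : ℝ → ℝ} (hg : Integrable g zmu) (h : ∀ t, |f t| ≤ g t) : Integrable f zmu := by
  rw [zmu_integrable_iff] at hg ⊢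
  refine hg.of_nonneg_of_le (fun γ => by positivity) fun γ => ?_
  exact mll ((h _).trans (le_abs_self _)) (Nat.cast_nonneg _)

/-- Number of zeros within distance `h` of `t`. -/
def Nh (h t : ℝ) : ℝ := zmu.real (Set.Icc (t - h) (t + h))

lemma Nh_nonneg (h t : ℝ) : 0 ≤ Nh h t := measureReal_nonneg

lemma zmu_Icc_int (hRH : RiemannHypothesis) (a b : ℝ) : Integrable ((Set.Icc a b).indicator (1 : ℝ → ℝ)) zmu := by
  have h := (P_measure hRH 0).1.const_mul (1 + a ^ 2 + b ^ 2)
  refine zmu_int_mono h fun t => ?_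
  have e : Pk 1 (0 - t) + Pk 1 (0 + t) = 2 * (1 / (1 + t ^ 2)) := by unfold Pk; norm_num; ring
  rw [e]
  by_cases ht : t ∈ Set.Icc a b
  · rw [Set.indicator_of_mem ht]
    have : t ^ 2 ≤ a ^ 2 + b ^ 2 := by
      rcases le_total 0 t with h | h
      · nlinarith [ht.2, sq_nonneg a]
      · nlinarith [ht.1, sq_nonneg b]
    simp only [Pi.one_apply, abs_one]
    rw [mul_one_div, mul_div_assoc', le_div_iff₀ (by positivity)]; nlinarith
  · rw [Set.indicator_of_notMem ht]; simp; positivity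

lemma Nh_eq (h t : ℝ) : Nh h t = ∫ γ, (Set.Icc (t - h) (t + h)).indicator (1 : ℝ → ℝ) γ ∂zmu :=
  (integral_indicator_one measurableSet_Icc).symm

lemma Nh_le (hRH : RiemannHypothesis) {W h : ℝ} (hW : 1 ≤ W) (hh : W * h ≤ 1) (t : ℝ) :
    Nh h t ≤ 4 * ∫ γ, (Jw W 0 (γ - t) + Jw W 0 (γ + t)) / 2 ∂zmu := by
  have hW0 : 0 < W := by linarith
  rw [Nh_eq, ← integral_const_mul]
  refine integral_mono (zmu_Icc_int hRH _ _) ((window hRH hW t).1.const_mul 4) fun γ => ?_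
  have h1 := Jw_zero_nonneg hW0 (γ - t)
  have h2 := Jw_zero_nonneg hW0 (γ + t)
  by_cases hg : γ ∈ Set.Icc (t - h) (t + h)
  · rw [Set.indicator_of_mem hg]
    have : |γ - t| ≤ h := abs_le.2 ⟨by linarith [hg.1], by linarith [hg.2]⟩
    have h3 := Jw_zero_ge hW0 (u := γ - t) (by nlinarith)
    simp only [Pi.one_apply]; linarith
  · rw [Set.indicator_of_notMem hg]; linarith

lemma Zf_even (X y : ℝ) : Zf X (-y) = Zf X y := by
  unfold Zf; congr 1; funext γ; rw [neg_mul, cos_neg]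

lemma Zf_le0 (hRH : RiemannHypothesis) {X : ℝ} (hX : 0 < X) (y : ℝ) : |Zf X y| ≤ Zf X 0 := by
  unfold Zf
  refine (abs_integral_le_integral_abs).trans (integral_mono (Z_weil hRH hX y).1.abs (Z_weil hRH hX 0).1 fun γ => ?_)
  simp only [zero_mul, cos_zero, mul_one]
  rw [abs_mul, abs_of_pos (VX_pos X γ)]
  exact mul_le_of_le_one_right (VX_pos X γ).le (abs_cos_le_one _)

lemma D_expand (hRH : RiemannHypothesis) {X : ℝ} (hX : 0 < X) (s : Finset ℕ) (a : ℕ → ℝ) :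
    Integrable (fun t => VX X t * (∑ m ∈ s, a m * cos (t * log m)) ^ 2) zmu ∧
    ∫ t, VX X t * (∑ m ∈ s, a m * cos (t * log m)) ^ 2 ∂zmu =
    ∑ m ∈ s, ∑ n ∈ s, a m * a n * ((Zf X (log m - log n) + Zf X (log m + log n)) / 2) := by
  have e : (fun t => VX X t * (∑ m ∈ s, a m * cos (t * log m)) ^ 2) = fun t =>
      ∑ m ∈ s, ∑ n ∈ s, a m * a n * ((VX X t * cos ((log m - log n) * t)
        + VX X t * cos ((log m + log n) * t)) / 2) := by
    funext t
    rw [sq, Finset.sum_mul_sum, mul_sum]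
    refine sum_congr rfl fun m _ => ?_
    rw [mul_sum]
    refine sum_congr rfl fun n _ => ?_
    rw [sub_mul, add_mul, cos_sub, cos_add, mul_comm t, mul_comm t]; ring
  have hi : ∀ m n : ℕ, Integrable (fun t => a m * a n * ((VX X t * cos ((log m - log n) * t)
        + VX X t * cos ((log m + log n) * t)) / 2)) zmu := fun m n =>
    (((Z_weil hRH hX _).1.add (Z_weil hRH hX _).1).div_const 2).const_mul _
  rw [e]
  refine ⟨integrable_finsetSum _ fun m _ => integrable_finsetSum _ fun n _ => hi m n, ?_⟩
  rw [integral_finsetSum _ fun m _ => integrable_finsetSum _ fun n _ => hi m n]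
  refine sum_congr rfl fun m _ => ?_
  rw [integral_finsetSum _ fun n _ => hi m n]
  refine sum_congr rfl fun n _ => ?_
  rw [integral_const_mul, integral_div, integral_add (Z_weil hRH hX _).1 (Z_weil hRH hX _).1]
  rfl

lemma Z_off2 (hRH : RiemannHypothesis) {X : ℝ} (hX : 1 ≤ X) {N m n : ℕ} (hm : m ∈ Ioc 0 N)
    (hn : n ∈ Ioc 0 N) (hmn : m ≠ n) :
    (Zf X (log m - log n) + Zf X (log m + log n)) / 2 ≤ N * (4 * log X + 15) := by
  wlog hlt : n < m generalizing m n
  · have := this hn hm hmn.symm (by omega)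
    rwa [← neg_sub, Zf_even, add_comm (log n)] at this
  obtain ⟨hm1, hm2⟩ := Finset.mem_Ioc.1 hm
  obtain ⟨hn1, hn2⟩ := Finset.mem_Ioc.1 hn
  have hn0 : (1:ℝ) ≤ n := by exact_mod_cast hn1
  have hm0 : (n:ℝ) + 1 ≤ m := by exact_mod_cast hlt
  have hmN : (m:ℝ) ≤ N := by exact_mod_cast hm2
  have hnN : (n:ℝ) ≤ N := by exact_mod_cast hn2
  have hN0 : (0:ℝ) < N := by linarith
  have hlX : 0 ≤ log X := log_nonneg hX
  have hln : 0 ≤ log n := log_nonneg hn0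
  have hlm : log m ≤ log N := log_le_log (by linarith) hmN
  have hlnN : log n ≤ log N := log_le_log (by linarith) hnN
  have hy : 1 / (N:ℝ) ≤ log m - log n := by
    rw [← log_div (by linarith) (by linarith)]
    refine le_trans ?_ (one_sub_inv_le_log_of_pos (div_pos (by linarith) (by linarith)))
    rw [inv_div, div_le_iff₀ hN0, sub_mul, one_mul, div_mul_eq_mul_div]
    have : (n:ℝ) * N / m ≤ N - 1 := by
      rw [div_le_iff₀ (by linarith)]; nlinarith
    linarith
  have key : ∀ y, 1 / (N:ℝ) ≤ y → y ≤ 2 * log N → Zf X y ≤ N * (4 * log X + 15) := by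
    intro y h1 h2
    have hN1 : 0 < 1 / (N:ℝ) := by positivity
    refine (Z_off hRH hX (by linarith)).trans ?_
    have a1 : exp (y / 2) ≤ N := by
      calc _ ≤ exp (log N) := Real.exp_le_exp.2 (by linarith)
        _ = N := exp_log hN0
    have a2 : 4 * (log X + 3) / y ≤ 4 * (log X + 3) / (1 / N) := by gcongr
    rw [div_div_eq_mul_div, div_one] at a2
    nlinarith
  have k1 := key _ hy (by linarith)
  have k2 := key (log m + log n) (by linarith) (by linarith)
  linarith

lemma D_moment (hRH : RiemannHypothesis) {X W : ℝ} (hX : 8 ≤ X) (hW : 1 ≤ W) (hWX : exp (3 * W) ≤ X) :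
    Integrable (fun t => VX X t * (2 * ∑' m : ℕ, vL m * (kap W (log m) * cos (t * log m))) ^ 2) zmu ∧
    ∫ t, VX X t * (2 * ∑' m : ℕ, vL m * (kap W (log m) * cos (t * log m))) ^ 2 ∂zmu
      ≤ 28 * Zf X 0 + 4 * X * (4 * log X + 15) := by
  have hW0 : 0 < W := by linarith
  have hX0 : 0 < X := by linarith
  have hlX : 0 ≤ log X := log_nonneg (by linarith)
  set N := ⌊exp W⌋₊ with hN
  have hNe : (N:ℝ) ≤ exp W := Nat.floor_le (exp_pos _).le
  have hN1 : 1 ≤ N := Nat.le_floor (by simpa using one_le_exp hW0.le)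
  have hN0 : (1:ℝ) ≤ N := by exact_mod_cast hN1
  have hlN : log N ≤ W := by rw [log_le_iff_le_exp (by linarith)]; exact hNe
  set a : ℕ → ℝ := fun m => 2 * (vL m * kap W (log m)) with ha
  have e : ∀ t : ℝ, 2 * ∑' m : ℕ, vL m * (kap W (log m) * cos (t * log m)) =
      ∑ m ∈ Ioc 0 N, a m * cos (t * log m) := by
    intro t
    rw [tsum_eq_sum (s := Ioc 0 N), mul_sum]
    · refine sum_congr rfl fun m _ => ?_
      rw [ha]; ring
    · intro m hm
      rcases Nat.eq_zero_or_pos m with h | h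
      · subst h; simp [vL]
      have h2 : N < m := by
        by_contra h3; exact hm (Finset.mem_Ioc.2 ⟨h, not_lt.1 h3⟩)
      have h3 : exp W < m := (Nat.floor_lt (exp_pos _).le).1 h2
      have h4 : W ≤ log m := by
        rw [le_log_iff_exp_le (by exact_mod_cast h)]; exact h3.le
      rw [kap_zero hW0 (h4.trans (le_abs_self _))]; ring
  simp_rw [e]
  obtain ⟨d1, d2⟩ := D_expand hRH hX0 (Ioc 0 N) a
  refine ⟨d1, ?_⟩
  rw [d2]
  have ha0 : ∀ m, 0 ≤ a m := fun m => mul_nonneg (by norm_num) (mul_nonneg (vL_nonneg m) (kap_nonneg hW0 _))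
  have ha1 : ∀ m, a m ≤ 2 / W * vL m := fun m => by
    have := mll (kap_le hW0 (log m)) (vL_nonneg m)
    calc a m ≤ 2 * (vL m * (1 / W)) := mll this (by norm_num)
      _ = _ := by ring
  have ha2 : ∀ m ∈ Ioc 0 N, a m ≤ 2 := fun m hm => by
    obtain ⟨hm1, hm2⟩ := Finset.mem_Ioc.1 hm
    have hm1' : (1:ℝ) ≤ m := by exact_mod_cast hm1
    have : vL m ≤ W := by
      unfold vL
      calc _ ≤ vonMangoldt m := div_le_self vonMangoldt_nonneg (Real.one_le_sqrt.2 hm1')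
        _ ≤ log m := vonMangoldt_le_log
        _ ≤ log N := log_le_log (by linarith) (by exact_mod_cast hm2)
        _ ≤ W := hlN
    calc a m ≤ 2 / W * vL m := ha1 m
      _ ≤ 2 / W * W := by gcongr
      _ = 2 := by field_simp
  set E := (N:ℝ) * (4 * log X + 15) with hE
  have hE0 : 0 ≤ E := by positivity
  have hterm : ∀ m ∈ Ioc 0 N, ∀ n ∈ Ioc 0 N,
      a m * a n * ((Zf X (log m - log n) + Zf X (log m + log n)) / 2) ≤
      (if m = n then a m ^ 2 * Zf X 0 else 0) + 4 * E := by
    intro m hm n hn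
    split_ifs with h
    · subst h
      have h1 := (abs_le.1 (Zf_le0 hRH hX0 (log m + log m))).2
      rw [sub_self]
      nlinarith [mul_nonneg (ha0 m) (ha0 m)]
    · have h1 := Z_off2 hRH (by linarith : 1 ≤ X) hm hn h
      have h2 : a m * a n ≤ 4 := by
        nlinarith [ha2 m hm, ha2 n hn, ha0 m, ha0 n]
      rw [zero_add]
      calc _ ≤ a m * a n * E := mll h1 (mul_nonneg (ha0 m) (ha0 n))
        _ ≤ 4 * E := by gcongr
  refine (sum_le_sum fun m hm => sum_le_sum fun n hn => hterm m hm n hn).trans ?_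
  have e3 : ∑ m ∈ Ioc 0 N, ∑ n ∈ Ioc 0 N, ((if m = n then a m ^ 2 * Zf X 0 else 0) + 4 * E) =
      (∑ m ∈ Ioc 0 N, a m ^ 2) * Zf X 0 + N * (N * (4 * E)) := by
    simp only [sum_add_distrib, sum_const, Nat.card_Ioc, tsub_zero, nsmul_eq_mul]
    congr 1
    rw [sum_mul]
    refine sum_congr rfl fun m hm => ?_
    rw [Finset.sum_ite_eq, if_pos hm]
  rw [e3]
  have hZ : 0 ≤ Zf X 0 := (abs_nonneg _).trans (Zf_le0 hRH hX0 0)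
  have h28 : ∑ m ∈ Ioc 0 N, a m ^ 2 ≤ 28 := by
    calc _ ≤ ∑ m ∈ Ioc 0 N, 4 / W ^ 2 * vL m ^ 2 := by
          refine sum_le_sum fun m _ => ?_
          calc a m ^ 2 ≤ (2 / W * vL m) ^ 2 := pow_le_pow_left₀ (ha0 m) (ha1 m) 2
            _ = _ := by ring
      _ = 4 / W ^ 2 * ∑ m ∈ Ioc 0 N, vL m ^ 2 := by rw [mul_sum]
      _ ≤ 4 / W ^ 2 * (W * (7 * W)) := by
          gcongr
          refine (vL_sq_le hN1).trans ?_
          have : 0 ≤ log N := log_nonneg hN0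
          exact mul_le_mul hlN (by linarith) (by linarith) hW0.le
      _ = 28 := by field_simp; norm_num
  have hN3 : (N:ℝ) * (N * N) ≤ X := by
    calc _ ≤ exp W * (exp W * exp W) := by gcongr
      _ = exp (3 * W) := by rw [← exp_add, ← exp_add]; congr 1; ring
      _ ≤ X := hWX
  have h1 := mlr h28 hZ
  have h2 : (N:ℝ) * (N * (4 * E)) = 4 * (N * (N * N)) * (4 * log X + 15) := by rw [hE]; ring
  rw [h2]
  have h3 : 4 * ((N:ℝ) * (N * N)) * (4 * log X + 15) ≤ 4 * X * (4 * log X + 15) := by gcongr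
  linarith

lemma VX_sq_le {X : ℝ} (hX : 0 < X) (t : ℝ) : VX X t * (t / X) ^ 2 ≤ VX (2 * X) t := by
  unfold VX
  set s := (t / X) ^ 2 with hs
  have hs0 : 0 ≤ s := sq_nonneg _
  have e : (t / (2 * X)) ^ 2 = s / 4 := by rw [hs]; field_simp; norm_num
  rw [e]
  have h := quadratic_le_exp_of_nonneg (x := 3 * s / 4) (by positivity)
  have h1 : s ≤ exp (3 * s / 4) := by nlinarith [sq_nonneg (s - 1)]
  calc exp (-s) * s ≤ exp (-s) * exp (3 * s / 4) := by gcongr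
    _ = exp (-(s / 4)) := by rw [← exp_add]; congr 1; ring

lemma VX_le_one (X t : ℝ) : VX X t ≤ 1 := Real.exp_le_one_iff.2 (by nlinarith [sq_nonneg (t / X)])

lemma Zf_zero (X : ℝ) : Zf X 0 = ∫ γ, VX X γ ∂zmu := by unfold Zf; simp

lemma log_ge_one {X : ℝ} (hX : 8 ≤ X) : 1 ≤ log X := by
  rw [le_log_iff_exp_le (by linarith)]; linarith [exp_one_lt_d9]

lemma Z0_le7 (hRH : RiemannHypothesis) {X : ℝ} (hX : 8 ≤ X) : Zf X 0 ≤ 7 * (X * log X) := by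
  have h := Z0_le hRH (by linarith : 1 ≤ X)
  have h1 := v0_le (by linarith : 0 ≤ X)
  have h2 := log_ge_one hX
  nlinarith

lemma B_pt {X W : ℝ} (hX : 8 ≤ X) (hW : 1 ≤ W) (hWX : exp (3 * W) ≤ X) (t : ℝ) :
    |VX X t * (2 + log (3 + |t|) / W + 16 * exp (W / 2) / (1 + t ^ 2)) ^ 2| ≤
      (12 + 54 * (log X / W) ^ 2) * VX X t + 6 * VX (2 * X) t + 768 * X * (1 / (1 + t ^ 2)) := by
  have hX0 : 0 < X := by linarith
  have hW0 : 0 < W := by linarith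
  have hlX := log_ge_one hX
  set q := log X / W with hq
  have hq0 : 0 ≤ q := by positivity
  rw [abs_of_nonneg (mul_nonneg (VX_pos X t).le (sq_nonneg _))]
  have hV := VX_pos X t
  have h1 : 0 ≤ log (3 + |t|) := log_nonneg (by linarith [abs_nonneg t])
  have h2 : log (3 + |t|) ≤ 3 * log X + |t| / X := by
    have a1 : 3 + |t| ≤ 3 * X * (1 + |t| / X) := by
      have : 3 * X * (1 + |t| / X) = 3 * X + 3 * |t| := by field_simp
      rw [this]; linarith [abs_nonneg t]
    have a2 : 0 < 1 + |t| / X := by positivity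
    calc _ ≤ log (3 * X * (1 + |t| / X)) := log_le_log (by positivity) a1
      _ = log 3 + log X + log (1 + |t| / X) := by
          rw [log_mul (by positivity) a2.ne', log_mul (by norm_num) hX0.ne']
      _ ≤ _ := by
          have b1 := log_le_sub_one_of_pos a2
          have b2 := log_le_sub_one_of_pos (by norm_num : (0:ℝ) < 3)
          linarith
  have h3 : log (3 + |t|) / W ≤ 3 * q + |t| / X := by
    rw [div_le_iff₀ hW0]
    have : (3 * q + |t| / X) * W = 3 * log X + |t| / X * W := by rw [hq]; field_simp
    rw [this]
    have : |t| / X * 1 ≤ |t| / X * W := by gcongr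
    linarith
  have h30 : 0 ≤ log (3 + |t|) / W := by positivity
  have h4 : (log (3 + |t|) / W) ^ 2 ≤ 18 * q ^ 2 + 2 * (t / X) ^ 2 := by
    have : (t / X) ^ 2 = (|t| / X) ^ 2 := by rw [div_pow, div_pow, sq_abs]
    rw [this]
    have := pow_le_pow_left₀ h30 h3 2
    nlinarith [sq_nonneg (3 * q - |t| / X)]
  have h5 : (16 * exp (W / 2) / (1 + t ^ 2)) ^ 2 ≤ 256 * X * (1 / (1 + t ^ 2)) := by
    have a : exp (W / 2) ^ 2 ≤ X := by
      rw [← exp_nat_mul]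
      refine le_trans (Real.exp_le_exp.2 ?_) hWX
      push_cast; linarith
    have b : 1 / (1 + t ^ 2) ≤ 1 := by rw [div_le_one (by positivity)]; nlinarith [sq_nonneg t]
    have b0 : 0 < 1 / (1 + t ^ 2) := by positivity
    calc _ = 256 * exp (W / 2) ^ 2 * ((1 / (1 + t ^ 2)) * (1 / (1 + t ^ 2))) := by ring
      _ ≤ 256 * X * ((1 / (1 + t ^ 2)) * 1) := by gcongr
      _ = _ := by ring
  set b := log (3 + |t|) / W
  set c := 16 * exp (W / 2) / (1 + t ^ 2)
  have h6 : (2 + b + c) ^ 2 ≤ 3 * (4 + b ^ 2 + c ^ 2) := by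
    nlinarith [sq_nonneg (2 - b), sq_nonneg (2 - c), sq_nonneg (b - c)]
  have h7 := VX_sq_le hX0 t
  have h8 := VX_le_one X t
  have h9 : VX X t * c ^ 2 ≤ 256 * X * (1 / (1 + t ^ 2)) :=
    (mul_le_of_le_one_left (sq_nonneg c) h8).trans h5
  have h10 := mll h4 hV.le
  have h11 := mll h6 hV.le
  linarith

lemma B_arith {Q q C0 z z' X : ℝ} (z1 : z ≤ 7 * Q) (z2 : z' ≤ 28 * Q) (hXl : X ≤ Q) (hX : 0 ≤ X) (hC : 0 ≤ C0) :
    (12 + 54 * q ^ 2) * z + 6 * z' + 768 * X * C0 ≤ (1000 + 768 * C0) * Q * (1 + q ^ 2) := by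
  have hQ : 0 ≤ Q := hX.trans hXl
  have w1 := mll z1 (by positivity : 0 ≤ 12 + 54 * q ^ 2)
  have w2 := mlr hXl hC
  have w3 : 0 ≤ C0 * Q * q ^ 2 := by positivity
  have w4 : 0 ≤ Q * q ^ 2 := by positivity
  nlinarith only [w1, w2, w3, w4, z2, hQ]

lemma int_lin {f g h : ℝ → ℝ} {μ : Measure ℝ} (hf : Integrable f μ) (hg : Integrable g μ) (hh : Integrable h μ) (a b c : ℝ) :
    Integrable (fun x => a * f x + b * g x + c * h x) μ ∧
    ∫ x, (a * f x + b * g x + c * h x) ∂μ = a * ∫ x, f x ∂μ + b * ∫ x, g x ∂μ + c * ∫ x, h x ∂μ := by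
  have i : Integrable (fun x => a * f x + b * g x) μ := (hf.const_mul a).add (hg.const_mul b)
  refine ⟨i.add (hh.const_mul c), ?_⟩
  rw [integral_add i (hh.const_mul c), integral_add (hf.const_mul a) (hg.const_mul b)]
  simp only [integral_const_mul]

lemma B_moment (hRH : RiemannHypothesis) : ∃ C : ℝ, 0 < C ∧ ∀ X W : ℝ, 8 ≤ X → 1 ≤ W → exp (3 * W) ≤ X →
    Integrable (fun t => VX X t * (2 + log (3 + |t|) / W + 16 * exp (W / 2) / (1 + t ^ 2)) ^ 2) zmu ∧
    ∫ t, VX X t * (2 + log (3 + |t|) / W + 16 * exp (W / 2) / (1 + t ^ 2)) ^ 2 ∂zmu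
      ≤ C * (X * log X) * (1 + (log X / W) ^ 2) := by
  have hP : Integrable (fun t : ℝ => 1 / (1 + t ^ 2)) zmu := by
    refine ((P_measure hRH 0).1.div_const 2).congr (evA fun t => ?_)
    simp only [Pk]; norm_num
  obtain ⟨C0, hC0⟩ : ∃ C0, C0 = ∫ t : ℝ, 1 / (1 + t ^ 2) ∂zmu := ⟨_, rfl⟩
  have hC00 : 0 ≤ C0 := hC0 ▸ integral_nonneg fun t => by positivity
  refine ⟨1000 + 768 * C0, by positivity, fun X W hX hW hWX => ?_⟩
  have hX0 : 0 < X := by linarith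
  have hlX := log_ge_one hX
  have hpt := B_pt hX hW hWX
  obtain ⟨i3, e3⟩ := int_lin (VX_int hRH hX0) (VX_int hRH (by linarith : 0 < 2 * X)) hP
    (12 + 54 * (log X / W) ^ 2) 6 (768 * X)
  have hi := zmu_int_mono i3 hpt
  refine ⟨hi, (integral_mono hi i3 fun t => (le_abs_self _).trans (hpt t)).trans ?_⟩
  rw [e3, ← Zf_zero, ← Zf_zero, ← hC0]
  refine B_arith (Z0_le7 hRH hX) ?_ (by nlinarith) hX0.le hC00
  refine (Z0_le7 hRH (by linarith)).trans ?_
  rw [log_mul (by norm_num) hX0.ne']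
  nlinarith [log_two_lt_d9]

theorem second_moment (hRH : RiemannHypothesis) : ∃ C : ℝ, 0 < C ∧ ∀ X W h : ℝ, 8 ≤ X → 1 ≤ W →
    exp (3 * W) ≤ X → W * h ≤ 1 →
    Integrable (fun t => VX X t * Nh h t ^ 2) zmu ∧
    ∫ t, VX X t * Nh h t ^ 2 ∂zmu ≤ C * (X * log X) * (1 + (log X / W) ^ 2) := by
  obtain ⟨C, hC, hB⟩ := B_moment hRH
  refine ⟨32 * C + 32 * 272, by positivity, fun X W h hX hW hWX hh => ?_⟩
  obtain ⟨b1, b2⟩ := hB X W hX hW hWX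
  obtain ⟨d1, d2⟩ := D_moment hRH hX hW hWX
  have i3 := (b1.const_mul 32).add (d1.const_mul 32)
  have hpt : ∀ t, |VX X t * Nh h t ^ 2| ≤ 32 * (VX X t * (2 + log (3 + |t|) / W + 16 * exp (W / 2) / (1 + t ^ 2)) ^ 2)
      + 32 * (VX X t * (2 * ∑' m : ℕ, vL m * (kap W (log m) * cos (t * log m))) ^ 2) := by
    intro t
    have hV := VX_pos X t
    rw [abs_of_nonneg (mul_nonneg hV.le (sq_nonneg _))]
    have h1 := Nh_le hRH hW hh t
    have h2 := (window hRH hW t).2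
    have h3 := Nh_nonneg h t
    set b := 2 + log (3 + |t|) / W + 16 * exp (W / 2) / (1 + t ^ 2)
    set d := 2 * ∑' m : ℕ, vL m * (kap W (log m) * cos (t * log m))
    have h4 : Nh h t ≤ 4 * (b - d) := by linarith
    have h5 : Nh h t ^ 2 ≤ 32 * (b ^ 2 + d ^ 2) := by
      have := pow_le_pow_left₀ h3 h4 2
      nlinarith [sq_nonneg (b + d)]
    have := mll h5 hV.le
    linarith
  have hi := zmu_int_mono i3 hpt
  refine ⟨hi, (integral_mono hi i3 fun t => (le_abs_self _).trans (hpt t)).trans ?_⟩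
  simp only [Pi.add_apply]
  rw [integral_add (b1.const_mul 32) (d1.const_mul 32), integral_const_mul, integral_const_mul]
  have hlX := log_ge_one hX
  have z1 := Z0_le7 hRH hX
  have hXl : X ≤ X * log X := by nlinarith
  set Q := X * log X with hQ
  have w4 : 0 ≤ Q * (log X / W) ^ 2 := by
    have : 0 ≤ Q := by linarith
    positivity
  have w5 : 4 * X * (4 * log X + 15) = 16 * Q + 60 * X := by rw [hQ]; ring
  rw [w5] at d2
  linarith

lemma VX_vint {X : ℝ} (hX : 0 < X) : Integrable (VX X) := by
  refine (integrable_exp_neg_mul_sq (b := 1 / X ^ 2) (by positivity)).congr (evA fun t => ?_)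
  unfold VX; ring_nf

lemma VX_cos {X : ℝ} (hX : 0 < X) (x : ℝ) : ∫ t, VX X t * cos (x * t) = 2 * π * gv X x := by
  have := cos_inversion (gv_int hX) (gv_even X) (gv_cont X) (by simp_rw [gv_cos hX]; exact VX_vint hX) x
  simpa only [gv_cos hX] using this

lemma cosT_cont {r : ℝ → ℝ} (hi : Integrable r) : Continuous (fun t => ∫ x, r x * cos (t * x)) := by
  refine continuous_of_dominated (bound := fun x => |r x|) (fun t => (integrable_mul_cos hi t).1) (fun t => evA fun x => ?_)
    hi.abs (evA fun x => by fun_prop)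
  rw [norm_eq_abs, abs_mul]
  exact mul_le_of_le_one_right (abs_nonneg _) (abs_cos_le_one _)

lemma cosT_gauss {r : ℝ → ℝ} (hi : Integrable r) {X : ℝ} (hX : 0 < X) :
    Integrable (fun t => (∫ x, r x * cos (t * x)) * VX X t) ∧
    ∫ t, (∫ x, r x * cos (t * x)) * VX X t = 2 * π * ∫ x, r x * gv X x := by
  have hint : Integrable (fun p : ℝ × ℝ => (VX X p.1 * r p.2) * cos (p.1 * p.2)) (volume.prod volume) := by
    refine Integrable.mul_bdd (c := 1) ((VX_vint hX).mul_prod hi) (Continuous.aestronglyMeasurable (by fun_prop))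
      (evA fun x => by simpa using abs_cos_le_one _)
  have e : ∀ t, (∫ x, r x * cos (t * x)) * VX X t = ∫ x, (VX X t * r x) * cos (t * x) := fun t => by
    rw [mul_comm, ← integral_const_mul]; simp only [mul_assoc]
  simp_rw [e]
  refine ⟨hint.integral_prod_left, ?_⟩
  rw [integral_integral_swap hint, ← integral_const_mul]
  refine integral_congr_ae (evA fun x => ?_)
  simp only
  rw [show 2 * π * (r x * gv X x) = r x * (2 * π * gv X x) by ring, ← VX_cos hX, ← integral_const_mul]
  congr 1; ext t; rw [mul_comm t x]; ring

lemma gv_far {X : ℝ} (hX : 4 ≤ X) {x : ℝ} (hx : 1 ≤ |x|) : gv X x ≤ 1 := by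
  have hX0 : 0 < X := by linarith
  unfold gv
  have h := exp_sq_le (X := X) (y := x) (by rintro rfl; simp at hx; linarith)
  have h2 : 1 ≤ x ^ 2 := by rw [← sq_abs]; nlinarith
  have h3 : 4 / x ^ 2 ≤ 4 := div_le_self (by norm_num) h2
  have h4 := v0_le hX0.le
  have h5 := exp_pos (-(X ^ 2 / 4) * x ^ 2)
  nlinarith [mlr h4 h5.le]

lemma cosT_int {r : ℝ → ℝ} (hc : Continuous r) (hi : Integrable r) (hp : ∀ t, 0 ≤ ∫ x, r x * cos (t * x)) :
    Integrable (fun t => ∫ x, r x * cos (t * x)) := by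
  obtain ⟨M, hM⟩ := (isCompact_Icc (a := (-1:ℝ)) (b := 1)).exists_bound_of_continuousOn hc.continuousOn
  have hM0 : 0 ≤ M := (norm_nonneg _).trans (hM 0 (by simp))
  have hg := cosT_cont hi
  refine integrable_of_intervalIntegral_norm_bounded (l := atTop) (a := fun n : ℕ => -(n:ℝ)) (b := fun n : ℕ => (n:ℝ))
    (exp 1 * (2 * π * (M + ∫ x, |r x|)))
    (fun n => (hg.integrableOn_Icc).mono_set Set.Ioc_subset_Icc_self)
    (tendsto_neg_atTop_atBot.comp tendsto_natCast_atTop_atTop) tendsto_natCast_atTop_atTop ?_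
  filter_upwards [eventually_ge_atTop 4] with n hn
  have hX : (4:ℝ) ≤ n := by exact_mod_cast hn
  have hX0 : (0:ℝ) < n := by linarith
  obtain ⟨i1, e1⟩ := cosT_gauss hi hX0
  have b1 : ∫ x, r x * gv n x ≤ M + ∫ x, |r x| := by
    have : Integrable (fun x => M * gv n x + |r x|) := ((gv_int hX0).const_mul M).add hi.abs
    calc _ ≤ ∫ x, (M * gv n x + |r x|) := by
          refine integral_mono (hi.mul_bdd (c := v0 n) (gv_cont _).aestronglyMeasurable (evA fun x => ?_)) this fun x => ?_
          · rw [norm_eq_abs, abs_of_pos (gv_pos hX0 x)]; exact gv_le hX0 x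
          · have hg0 := gv_pos hX0 x
            have ha := le_abs_self (r x)
            rcases le_total |x| 1 with hx | hx
            · have := hM x (abs_le.1 hx)
              rw [norm_eq_abs] at this
              nlinarith [abs_nonneg (r x)]
            · have := gv_far hX hx
              nlinarith [abs_nonneg (r x), mul_nonneg hM0 hg0.le]
      _ = _ := by rw [integral_add ((gv_int hX0).const_mul M) hi.abs, integral_const_mul, gv_integral hX0, mul_one]
  calc _ = ∫ t in Set.Ioc (-(n:ℝ)) n, (∫ x, r x * cos (t * x)) := by
        rw [integral_of_le (by linarith)]
        simp only [norm_eq_abs, abs_of_nonneg (hp _)]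
    _ ≤ ∫ t in Set.Ioc (-(n:ℝ)) n, exp 1 * ((∫ x, r x * cos (t * x)) * VX n t) := by
        refine setIntegral_mono_on ((hg.integrableOn_Icc).mono_set Set.Ioc_subset_Icc_self) (i1.const_mul _).integrableOn measurableSet_Ioc fun t ht => ?_
        have : 1 ≤ exp 1 * VX n t := by
          unfold VX
          rw [← exp_add, Real.one_le_exp_iff, div_pow]
          have : t ^ 2 / (n:ℝ) ^ 2 ≤ 1 := (div_le_one (by positivity)).2 (sq_le_sq' ht.1.le ht.2)
          linarith
        nlinarith [hp t]
    _ ≤ ∫ t, exp 1 * ((∫ x, r x * cos (t * x)) * VX n t) :=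
        setIntegral_le_integral (i1.const_mul _) (evA fun t =>
          mul_nonneg (exp_pos _).le (mul_nonneg (hp t) (VX_pos _ _).le))
    _ ≤ _ := by
        rw [integral_const_mul, e1]
        gcongr

lemma fourierCos_facts {lam : ℝ} {r : ℝ → ℝ} (hr : memA lam r) :
    Continuous (fourierCos r) ∧ (∀ a, fourierCos r (-a) = fourierCos r a) ∧ Integrable (fourierCos r) ∧
    (∀ {L : ℝ}, 0 < L → ∀ d, ∫ y, fourierCos r (y / L) * cos (y * d) = L * r (d * L / (2 * π))) ∧ ∀ u, r u ≤ 1 := by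
  obtain ⟨hc, he, hi, h0, hneg, hp⟩ := hr
  obtain ⟨g, hg⟩ : ∃ g : ℝ → ℝ, g = fun t => ∫ x, r x * cos (t * x) := ⟨_, rfl⟩
  have hf : fourierCos r = fun a => g (2 * π * a) := by rw [hg]; rfl
  have hgc : Continuous g := hg ▸ cosT_cont hi
  have hgp : ∀ t, 0 ≤ g t := fun t => by
    have := hp (t / (2 * π)); rw [hf] at this
    simpa [mul_div_cancel₀ _ Real.two_pi_pos.ne'] using this
  have hgi : Integrable g := by
    rw [hg] at hgp ⊢; exact cosT_int hc hi hgp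
  have hinv : ∀ u, ∫ t, g t * cos (u * t) = 2 * π * r u := fun u => by
    rw [hg] at hgi ⊢; exact cos_inversion hi he hc hgi u
  refine ⟨by rw [hf]; fun_prop, fun a => by unfold fourierCos; simp, by rw [hf]; exact hgi.comp_mul_left' Real.two_pi_pos.ne', fun {L} hL d => ?_, fun u => ?_⟩
  · have h2 : 0 < 2 * π / L := by positivity
    have := Measure.integral_comp_mul_left (fun t => g t * cos (d * L / (2 * π) * t)) (2 * π / L)
    rw [hinv, abs_of_pos (by positivity), smul_eq_mul] at this
    rw [show L * r (d * L / (2 * π)) = (2 * π / L)⁻¹ * (2 * π * r (d * L / (2 * π))) by field_simp, ← this, hf]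
    congr 1; ext y
    congr 2
    · ring
    · field_simp
  · have h1 := hinv u
    have h2 := hinv 0
    rw [h0] at h2
    have h3 : ∫ t, g t * cos (u * t) ≤ ∫ t, g t * cos (0 * t) := by
      refine integral_mono (integrable_mul_cos hgi u) (integrable_mul_cos hgi 0) fun t => ?_
      simp only [zero_mul, cos_zero]
      exact mll (cos_le_one _) (hgp t)
    have := two_pi_pos
    nlinarith

lemma VX_sqrt2 {X : ℝ} (t : ℝ) : VX (√2 * X) t ^ 2 = VX X t := by
  unfold VX
  rw [← exp_nat_mul]
  congr 1
  rw [div_pow, div_pow, mul_pow, sq_sqrt (by norm_num)]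
  push_cast; ring

lemma Zf_cont (hRH : RiemannHypothesis) {X : ℝ} (hX : 0 < X) : Continuous (Zf X) := by
  refine continuous_of_dominated (bound := VX X) (fun y => (Z_weil hRH hX y).1.1) (fun y => evA fun x => ?_)
    (VX_int hRH hX) (evA fun x => by fun_prop)
  rw [norm_eq_abs, abs_mul, abs_of_pos (VX_pos _ _)]
  exact mul_le_of_le_one_right (VX_pos _ _).le (abs_cos_le_one _)

lemma Zf_sq_le (hRH : RiemannHypothesis) {X : ℝ} (hX : 0 < X) (y : ℝ) :
    Zf X y ^ 2 ≤ ∫ p : ℝ × ℝ, VX X p.1 * VX X p.2 * cos (y * (p.1 - p.2)) ∂(zmu.prod zmu) := by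
  have i := VX_int hRH hX
  have ic := integrable_mul_cos i y
  have is := integrable_mul_sin i y
  have e : ∀ p : ℝ × ℝ, VX X p.1 * VX X p.2 * cos (y * (p.1 - p.2)) =
    (VX X p.1 * cos (y * p.1)) * (VX X p.2 * cos (y * p.2)) + (VX X p.1 * sin (y * p.1)) * (VX X p.2 * sin (y * p.2)) := by
    intro p; rw [mul_sub, cos_sub]; ring
  simp_rw [e]
  rw [integral_add (ic.mul_prod ic) (is.mul_prod is),
    integral_prod_mul (fun x => VX X x * cos (y * x)) (fun x => VX X x * cos (y * x)),
    integral_prod_mul (fun x => VX X x * sin (y * x)) (fun x => VX X x * sin (y * x))]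
  unfold Zf
  nlinarith [sq_nonneg (∫ x, VX X x * sin (y * x) ∂zmu)]

lemma near_int {X h : ℝ} (hN : Integrable (fun t => VX X t * Nh h t) zmu) (hRH : RiemannHypothesis) :
    Integrable (fun p : ℝ × ℝ => {p : ℝ × ℝ | |p.1 - p.2| ≤ h}.indicator (fun p => VX X p.1) p) (zmu.prod zmu) ∧
    ∫ p : ℝ × ℝ, {p : ℝ × ℝ | |p.1 - p.2| ≤ h}.indicator (fun p => VX X p.1) p ∂(zmu.prod zmu) = ∫ t, VX X t * Nh h t ∂zmu := by
  have hs : MeasurableSet {p : ℝ × ℝ | |p.1 - p.2| ≤ h} := measurableSet_le (by fun_prop) (by fun_prop)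
  have e : ∀ x y : ℝ, {p : ℝ × ℝ | |p.1 - p.2| ≤ h}.indicator (fun p => VX X p.1) (x, y) =
      VX X x * (Set.Icc (x - h) (x + h)).indicator 1 y := by
    intro x y
    by_cases hxy : |x - y| ≤ h
    · rw [Set.indicator_of_mem (by exact hxy), Set.indicator_of_mem (by rw [abs_le] at hxy; constructor <;> linarith)]; simp
    · rw [Set.indicator_of_notMem (by exact hxy), Set.indicator_of_notMem, mul_zero]
      rintro ⟨h1, h2⟩; exact hxy (abs_le.2 ⟨by linarith, by linarith⟩)
  have hI : Integrable (fun p : ℝ × ℝ => {p : ℝ × ℝ | |p.1 - p.2| ≤ h}.indicator (fun p => VX X p.1) p) (zmu.prod zmu) := by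
    rw [integrable_prod_iff]
    · simp only [e, norm_mul, norm_eq_abs, abs_of_pos (VX_pos _ _), integral_const_mul]
      refine ⟨evA fun x => (zmu_Icc_int hRH _ _).const_mul _, hN.congr (evA fun x => ?_)⟩
      simp only [Nh_eq]
      congr 2; ext y
      exact (abs_of_nonneg (Set.indicator_nonneg (fun _ _ => by simp) _)).symm
    · exact (Measurable.indicator (by unfold VX; fun_prop) hs).aestronglyMeasurable
  refine ⟨hI, ?_⟩
  rw [integral_prod _ hI]
  simp only [e, integral_const_mul, Nh_eq]

theorem S_bound (hRH : RiemannHypothesis) {lam : ℝ} {r : ℝ → ℝ} (hr : memA lam r) {X L : ℝ} (hX : 0 < X) (hL : 0 < L)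
    (hN : Integrable (fun t => VX X t * Nh (2 * π * lam / L) t) zmu) :
    Integrable (fun y => fourierCos r (y / L) * Zf (√2 * X) y ^ 2) ∧
    ∫ y, fourierCos r (y / L) * Zf (√2 * X) y ^ 2 ≤ L * ∫ t, VX X t * Nh (2 * π * lam / L) t ∂zmu := by
  obtain ⟨fc, fe, fi, finv, fone⟩ := fourierCos_facts hr
  have hY : 0 < √2 * X := by positivity
  have i := VX_int hRH hY
  have fiL : Integrable (fun y => fourierCos r (y / L)) := fi.comp_div hL.ne'
  have hI : Integrable (fun y => fourierCos r (y / L) * Zf (√2 * X) y ^ 2) := by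
    refine fiL.mul_bdd (c := Zf (√2 * X) 0 ^ 2) ((Zf_cont hRH hY).pow 2).aestronglyMeasurable (evA fun y => ?_)
    rw [norm_pow, norm_eq_abs]
    exact pow_le_pow_left₀ (abs_nonneg _) (Zf_le0 hRH hY y) 2
  refine ⟨hI, ?_⟩
  have ip : Integrable (fun p : ℝ × ℝ => VX (√2 * X) p.1 * VX (√2 * X) p.2) (zmu.prod zmu) := i.mul_prod i
  have i3 : Integrable (fun q : ℝ × (ℝ × ℝ) => (fourierCos r (q.1 / L) * (VX (√2 * X) q.2.1 * VX (√2 * X) q.2.2)) * cos (q.1 * (q.2.1 - q.2.2)))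
      (volume.prod (zmu.prod zmu)) := by
    refine Integrable.mul_bdd (c := 1) (fiL.mul_prod ip) (Continuous.aestronglyMeasurable (by fun_prop))
      (evA fun x => by simpa using abs_cos_le_one _)
  have hfp : ∀ a, 0 ≤ fourierCos r a := hr.2.2.2.2.2
  obtain ⟨n1, n2⟩ := near_int hN hRH
  have n1s := n1.swap
  have n2s := integral_prod_swap (μ := zmu) (ν := zmu) (fun p : ℝ × ℝ => {p : ℝ × ℝ | |p.1 - p.2| ≤ 2 * π * lam / L}.indicator (fun p => VX X p.1) p)
  have i4 := (n1.add n1s).const_mul (L / 2)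
  calc _ ≤ ∫ y, ∫ p : ℝ × ℝ, (fourierCos r (y / L) * (VX (√2 * X) p.1 * VX (√2 * X) p.2)) * cos (y * (p.1 - p.2)) ∂(zmu.prod zmu) := by
        refine integral_mono hI i3.integral_prod_left fun y => ?_
        simp only [mul_assoc (fourierCos r (y / L)), integral_const_mul]
        exact mll (Zf_sq_le hRH hY y) (hfp _)
    _ = ∫ p : ℝ × ℝ, (∫ y : ℝ, (fourierCos r (y / L) * (VX (√2 * X) p.1 * VX (√2 * X) p.2)) * cos (y * (p.1 - p.2))) ∂(zmu.prod zmu) :=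
        integral_integral_swap i3
    _ ≤ ∫ p : ℝ × ℝ, L / 2 * ({p : ℝ × ℝ | |p.1 - p.2| ≤ 2 * π * lam / L}.indicator (fun p => VX X p.1) p +
          {p : ℝ × ℝ | |p.1 - p.2| ≤ 2 * π * lam / L}.indicator (fun p => VX X p.1) p.swap) ∂(zmu.prod zmu) := by
        refine integral_mono i3.integral_prod_right i4 fun p => ?_
        simp only
        have e : ∀ y, (fourierCos r (y / L) * (VX (√2 * X) p.1 * VX (√2 * X) p.2)) * cos (y * (p.1 - p.2)) =
          (VX (√2 * X) p.1 * VX (√2 * X) p.2) * (fourierCos r (y / L) * cos (y * (p.1 - p.2))) := fun y => by ring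
        simp only [e, integral_const_mul]
        rw [finv hL]
        have w0 := VX_pos (√2 * X) p.1
        have w1 := VX_pos (√2 * X) p.2
        have w2 := mul_pos w0 w1
        by_cases hp : |p.1 - p.2| ≤ 2 * π * lam / L
        · rw [Set.indicator_of_mem (by exact hp), Set.indicator_of_mem (by simpa [abs_sub_comm] using hp)]
          have := fone ((p.1 - p.2) * L / (2 * π))
          simp only [Prod.fst_swap]
          rw [← VX_sqrt2 (X := X) p.1, ← VX_sqrt2 (X := X) p.2]
          have a1 : L * r ((p.1 - p.2) * L / (2 * π)) ≤ L := by nlinarith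
          have a2 := mll a1 w2.le
          nlinarith [mul_nonneg hL.le (sq_nonneg (VX (√2 * X) p.1 - VX (√2 * X) p.2))]
        · rw [Set.indicator_of_notMem (by exact hp), Set.indicator_of_notMem (by simpa [abs_sub_comm] using hp)]
          have hneg := hr.2.2.2.2.1 ((p.1 - p.2) * L / (2 * π)) (by
            rw [abs_div, abs_mul, abs_of_pos hL, abs_of_pos two_pi_pos, lt_div_iff₀ two_pi_pos]
            rw [not_le, div_lt_iff₀ hL] at hp
            linarith)
          have : L * r ((p.1 - p.2) * L / (2 * π)) ≤ 0 := mul_nonpos_of_nonneg_of_nonpos hL.le hneg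
          have := mul_nonpos_of_nonneg_of_nonpos w2.le this
          linarith
    _ = _ := by
        rw [integral_const_mul, integral_add n1 (by exact n1s), n2s, n2]; ring

lemma v0_sqrt2 (X : ℝ) : v0 (√2 * X) = √2 * v0 X := by unfold v0; ring
lemma sqrt2_sq (X : ℝ) : (√2 * X) ^ 2 = 2 * X ^ 2 := by rw [mul_pow, sq_sqrt (by norm_num)]

lemma gv_Zf_int (hRH : RiemannHypothesis) {X : ℝ} (hX : 0 < X) (y0 : ℝ) :
    Integrable (fun x => gv X (x - y0) * Zf X x) := by
  refine ((gv_int hX).comp_sub_right y0).mul_bdd (c := Zf X 0) (Zf_cont hRH hX).aestronglyMeasurable (evA fun y => ?_)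
  exact Zf_le0 hRH hX y

lemma gv_Zf (hRH : RiemannHypothesis) {X : ℝ} (hX : 0 < X) (y0 : ℝ) :
    ∫ x, gv (√2 * X) (x - y0) * Zf (√2 * X) x = Zf X y0 := by
  have hY : 0 < √2 * X := by positivity
  have hint : Integrable (fun p : ℝ × ℝ => (gH (√2 * X) y0 p.1 * VX (√2 * X) p.2) * cos (p.1 * p.2)) (volume.prod zmu) := by
    refine Integrable.mul_bdd (c := 1) ((gH_int hY y0).mul_prod (VX_int hRH hY)) (Continuous.aestronglyMeasurable (by fun_prop))
      (evA fun x => by simpa using abs_cos_le_one _)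
  have h1 : ∫ x, gH (√2 * X) y0 x * Zf (√2 * X) x = Zf X y0 := by
    have e : ∀ x, gH (√2 * X) y0 x * Zf (√2 * X) x = ∫ γ, (gH (√2 * X) y0 x * VX (√2 * X) γ) * cos (x * γ) ∂zmu := fun x => by
      unfold Zf; rw [← integral_const_mul]; simp only [mul_assoc]
    simp_rw [e]
    rw [integral_integral_swap hint]
    unfold Zf
    congr 1; ext γ
    rw [← VX_sqrt2 (X := X) γ, sq, mul_assoc, ← gH_cos hY, ← integral_const_mul]
    congr 1; ext x; ring
  have i1 := gv_Zf_int hRH hY y0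
  have i2 := gv_Zf_int hRH hY (-y0)
  simp only [sub_neg_eq_add] at i2
  have h2 : ∫ x, gv (√2 * X) (x + y0) * Zf (√2 * X) x = ∫ x, gv (√2 * X) (x - y0) * Zf (√2 * X) x := by
    rw [← integral_neg_eq_self (fun x => gv (√2 * X) (x + y0) * Zf (√2 * X) x)]
    congr 1; ext x
    rw [show -x + y0 = -(x - y0) by ring, gv_even, Zf_even]
  have h3 : ∫ x, gH (√2 * X) y0 x * Zf (√2 * X) x =
      ((∫ x, gv (√2 * X) (x - y0) * Zf (√2 * X) x) + ∫ x, gv (√2 * X) (x + y0) * Zf (√2 * X) x) / 2 := by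
    rw [← integral_add i1 i2, ← integral_div]
    congr 1; ext x; unfold gH; ring
  rw [← h1, h3, h2]; ring

lemma gv_sq {X : ℝ} (hX : 0 < X) (y0 : ℝ) : Integrable (fun x => gv (√2 * X) (x - y0) ^ 2) ∧
    ∫ x, gv (√2 * X) (x - y0) ^ 2 = v0 X := by
  have e : ∀ x, gv (√2 * X) x ^ 2 = (√2 * v0 X) ^ 2 * exp (-(X ^ 2) * x ^ 2) := fun x => by
    unfold gv
    rw [sqrt2_sq, mul_pow, v0_sqrt2, ← exp_nat_mul]; congr 2; push_cast; ring
  have hi : Integrable (fun x => gv (√2 * X) x ^ 2) := by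
    simp_rw [e]; exact (integrable_exp_neg_mul_sq (by positivity)).const_mul _
  refine ⟨hi.comp_sub_right y0, ?_⟩
  rw [integral_sub_right_eq_self (fun x => gv (√2 * X) x ^ 2)]
  simp_rw [e]
  rw [integral_const_mul, integral_gaussian, Real.sqrt_div' _ (by positivity), sqrt_sq hX.le, sqrt2_sq (v0 X)]
  unfold v0
  have := Real.sqrt_pos.2 pi_pos
  field_simp

lemma gv_tail {X : ℝ} (hX : 0 < X) {w x : ℝ} (hx : w ^ 2 ≤ x ^ 2) :
    gv (√2 * X) x ≤ √2 * exp (-(X * w) ^ 2 / 4) * gv X x := by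
  unfold gv
  rw [v0_sqrt2, sqrt2_sq]
  have : exp (-(2 * X ^ 2 / 4) * x ^ 2) ≤ exp (-(X * w) ^ 2 / 4) * exp (-(X ^ 2 / 4) * x ^ 2) := by
    rw [← exp_add, Real.exp_le_exp]
    nlinarith [mll hx (sq_nonneg X)]
  calc _ ≤ √2 * v0 X * (exp (-(X * w) ^ 2 / 4) * exp (-(X ^ 2 / 4) * x ^ 2)) :=
        mll this (mul_nonneg (sqrt_nonneg _) (v0_pos hX).le)
    _ = _ := by ring

theorem loc_ge (hRH : RiemannHypothesis) {X : ℝ} (hX : 0 < X) (y0 : ℝ) {w : ℝ} (hw : 0 ≤ w) {A : ℝ} (hA0 : 0 ≤ A)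
    (hA : A ≤ |Zf X y0| - √2 * Zf (√2 * X) 0 * exp (-(X * w) ^ 2 / 4)) :
    A ^ 2 ≤ v0 X * ∫ y in (y0 - w)..(y0 + w), Zf (√2 * X) y ^ 2 := by
  have hY : 0 < √2 * X := by positivity
  have hv := v0_pos hX
  rw [integral_of_le (by linarith)]
  obtain ⟨I, hI⟩ : ∃ I, I = Set.Ioc (y0 - w) (y0 + w) := ⟨_, rfl⟩
  rw [← hI]
  have hIm : MeasurableSet I := hI ▸ measurableSet_Ioc
  have i1 := gv_Zf_int hRH hY y0
  have hsp := integral_add_compl hIm i1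
  rw [gv_Zf hRH hX] at hsp
  have hgx : ∀ x, 0 < gv X (x - y0) := fun x => gv_pos hX _
  have it : Integrable (fun x => √2 * Zf (√2 * X) 0 * exp (-(X * w) ^ 2 / 4) * gv X (x - y0)) :=
    ((gv_int hX).comp_sub_right y0).const_mul _
  have hZ0 : 0 ≤ Zf (√2 * X) 0 := (abs_nonneg _).trans (Zf_le0 hRH hY 0)
  have ht : |∫ x in Iᶜ, gv (√2 * X) (x - y0) * Zf (√2 * X) x| ≤ √2 * Zf (√2 * X) 0 * exp (-(X * w) ^ 2 / 4) := by
    calc _ ≤ ∫ x : ℝ in Iᶜ, √2 * Zf (√2 * X) 0 * exp (-(X * w) ^ 2 / 4) * gv X (x - y0) := by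
          rw [← norm_eq_abs]
          refine norm_integral_le_of_norm_le (μ := volume.restrict Iᶜ) it.integrableOn ((ae_restrict_iff' hIm.compl).2 (evA fun x hx => ?_))
          have hxw : w ^ 2 ≤ (x - y0) ^ 2 := by
            rw [hI, Set.mem_compl_iff, Set.mem_Ioc, not_and_or, not_lt, not_le] at hx
            rcases hx with h | h <;> nlinarith
          rw [norm_mul, norm_eq_abs, abs_of_pos (gv_pos hY _), norm_eq_abs]
          calc _ ≤ (√2 * exp (-(X * w) ^ 2 / 4) * gv X (x - y0)) * Zf (√2 * X) 0 :=
                mul_le_mul (gv_tail hX hxw) (Zf_le0 hRH hY x) (abs_nonneg _) ((gv_pos hY _).le.trans (gv_tail hX hxw))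
            _ = _ := by ring
      _ ≤ ∫ x, √2 * Zf (√2 * X) 0 * exp (-(X * w) ^ 2 / 4) * gv X (x - y0) :=
          setIntegral_le_integral it (evA fun x => mul_nonneg (by positivity) (hgx x).le)
      _ = _ := by rw [integral_const_mul, integral_sub_right_eq_self (gv X), gv_integral hX, mul_one]
  obtain ⟨B, hB⟩ : ∃ B, B = ∫ x in I, gv (√2 * X) (x - y0) * Zf (√2 * X) x := ⟨_, rfl⟩
  rw [← hB] at hsp
  have hAB : A ≤ |B| := by
    have := abs_add_le B (∫ x in Iᶜ, gv (√2 * X) (x - y0) * Zf (√2 * X) x)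
    rw [hsp] at this
    linarith
  obtain ⟨g1, g2⟩ := gv_sq hX y0
  have g3 : ∫ x in I, gv (√2 * X) (x - y0) ^ 2 ≤ v0 X := g2 ▸ setIntegral_le_integral g1 (evA fun x => sq_nonneg _)
  have iZ : IntegrableOn (fun x => Zf (√2 * X) x ^ 2) I := by
    rw [hI]; exact (((Zf_cont hRH hY).pow 2).integrableOn_Icc).mono_set Set.Ioc_subset_Icc_self
  obtain ⟨Q, hQ⟩ : ∃ Q, Q = ∫ x in I, Zf (√2 * X) x ^ 2 := ⟨_, rfl⟩
  rw [← hQ]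
  have hcs : 0 ≤ Q - 2 * (B / v0 X) * B + (B / v0 X) ^ 2 * ∫ x in I, gv (√2 * X) (x - y0) ^ 2 := by
    have e := (int_lin (μ := volume.restrict I) iZ i1.integrableOn g1.integrableOn 1 (-(2 * (B / v0 X))) ((B / v0 X) ^ 2)).2
    rw [← hQ, ← hB] at e
    have : 0 ≤ ∫ x in I, (1 * Zf (√2 * X) x ^ 2 + -(2 * (B / v0 X)) * (gv (√2 * X) (x - y0) * Zf (√2 * X) x) + (B / v0 X) ^ 2 * gv (√2 * X) (x - y0) ^ 2) :=
      integral_nonneg fun x => by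
        have := sq_nonneg (Zf (√2 * X) x - B / v0 X * gv (√2 * X) (x - y0))
        simp only [Pi.zero_apply]; linarith
    linarith
  have h4 := mll g3 (sq_nonneg (B / v0 X))
  have h5 : (B / v0 X) ^ 2 * v0 X = B ^ 2 / v0 X := by field_simp
  have h6 : 2 * (B / v0 X) * B = 2 * (B ^ 2 / v0 X) := by ring
  have h7 : B ^ 2 / v0 X ≤ Q := by linarith
  rw [div_le_iff₀ hv] at h7
  have h8 := pow_le_pow_left₀ hA0 hAB 2
  rw [sq_abs] at h8
  linarith

lemma sum_loc {F : ℝ → ℝ} (hF : Integrable F) (he : ∀ x, F (-x) = F x) (h0 : ∀ x, 0 ≤ F x) {w : ℝ} (hw : 0 ≤ w) (N : ℕ) (hN : 1 ≤ N)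
    (hwN : 2 * w * (N + 1) ≤ 1) :
    (∫ y in (-w)..w, F y) + 2 * ∑ n ∈ Ioc 1 N, ∫ y in (log n - w)..(log n + w), F y ≤ ∫ y, F y := by
  have ii : ∀ a b, IntervalIntegrable F volume a b := fun a b => hF.intervalIntegrable
  have hnn : ∀ {a b}, a ≤ b → 0 ≤ ∫ y in a..b, F y := fun h => intervalIntegral.integral_nonneg h fun x _ => h0 x
  have key : ∀ M : ℕ, 1 ≤ M → M ≤ N → (∫ y in (0:ℝ)..w, F y) + ∑ n ∈ Ioc 1 M, ∫ y in (log n - w)..(log n + w), F y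
      ≤ ∫ y in (0:ℝ)..(log M + w), F y := by
    intro M hM
    induction M, hM using Nat.le_induction with
    | base => intro _; simp
    | succ M hM ih =>
      intro hMN
      rw [sum_Ioc_succ_top hM, ← add_assoc]
      have hM0 : (0:ℝ) < M := by exact_mod_cast hM
      have hMN' : (M:ℝ) + 1 ≤ N := by exact_mod_cast hMN
      have hs := (log_step hM0).2
      have hq : 2 * w ≤ 1 / ((M:ℝ) + 1) := by
        rw [le_div_iff₀ (by linarith)]
        exact (mll (by linarith : (M:ℝ) + 1 ≤ N + 1) (by linarith)).trans hwN
      push_cast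
      have e1 := integral_add_adjacent_intervals (ii 0 (log M + w)) (ii (log M + w) (log (M + 1) - w))
      have e2 := integral_add_adjacent_intervals (ii 0 (log (M + 1) - w)) (ii (log (M + 1) - w) (log (M + 1) + w))
      have := hnn (a := log M + w) (b := log (M + 1) - w) (by linarith)
      linarith [ih (by omega)]
  have k := key N hN le_rfl
  have hlN : 0 ≤ log N := log_natCast_nonneg N
  have hsym : ∀ b, ∫ y in (-b)..0, F y = ∫ y in (0:ℝ)..b, F y := fun b => by
    have := intervalIntegral.integral_comp_neg (a := -b) (b := 0) F
    simp only [he, neg_neg, neg_zero] at this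
    exact this
  have e3 : ∀ b, ∫ y in (-b)..b, F y = 2 * ∫ y in (0:ℝ)..b, F y := fun b => by
    rw [← integral_add_adjacent_intervals (ii (-b) 0) (ii 0 b), hsym]; ring
  have h5 : ∫ y in (-(log N + w))..(log N + w), F y ≤ ∫ y, F y := by
    rw [integral_of_le (by linarith)]
    exact setIntegral_le_integral hF (evA h0)
  rw [e3] at h5 ⊢
  linarith

lemma step_fn {f : ℝ → ℝ} (hf : Continuous f) (hp : ∀ a, 0 ≤ f a) {c : ℝ} (hc : 0 < c)
    (h : f 0 - 1 + 2 * ∫ a in (0:ℝ)..1, a * f a = c) :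
    ∃ (J : ℕ) (b0 : ℝ) (b : ℕ → ℝ), 2 ≤ J ∧ 0 ≤ b0 ∧ (∀ i, 0 ≤ b i) ∧ (∀ a : ℝ, |a| ≤ 1 / (J:ℝ) → b0 ≤ f a) ∧
      (∀ i < J - 1, ∀ a : ℝ, (i:ℝ) / J - 1 / J ≤ a → a ≤ (i:ℝ) / J + 2 / J → b i ≤ f a) ∧
      1 + c / 2 ≤ b0 + 2 * ∑ i ∈ range (J - 1), b i * (i / J ^ 2) := by
  have huc := (isCompact_Icc (a := (-1:ℝ)) (b := 2)).uniformContinuousOn_of_continuous hf.continuousOn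
  obtain ⟨d, hd, hdf⟩ := Metric.uniformContinuousOn_iff.1 huc (c / 20) (by positivity)
  obtain ⟨B, hB⟩ := (isCompact_Icc (a := (-1:ℝ)) (b := 2)).exists_bound_of_continuousOn hf.continuousOn
  have hB0 : 0 ≤ B := (norm_nonneg _).trans (hB 0 (by constructor <;> norm_num))
  obtain ⟨J, hJ⟩ := exists_nat_gt (max (3 / d) (max (16 * B / c) 2))
  have hJ1 : 3 / d < J := (le_max_left _ _).trans_lt hJ
  have hJ2 : 16 * B / c < J := ((le_max_left _ _).trans (le_max_right _ _)).trans_lt hJ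
  have hJ3 : (2:ℝ) < J := ((le_max_right _ _).trans (le_max_right _ _)).trans_lt hJ
  have hJ0 : (0:ℝ) < J := by linarith
  have hJ2n : 2 < J := by exact_mod_cast hJ3
  rw [div_lt_iff₀ hd] at hJ1
  rw [div_lt_iff₀ hc] at hJ2
  have hd2 : 2 / (J:ℝ) < d := by rw [div_lt_iff₀ hJ0]; linarith
  have hJ4 : 1 / (J:ℝ) ≤ 1 / 2 := one_div_le_one_div_of_le (by norm_num) hJ3.le
  have h2J : 2 / (J:ℝ) = 2 * (1 / J) := by ring
  have hJp : 0 < 1 / (J:ℝ) := by positivity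
  have near : ∀ x ∈ Set.Icc (0:ℝ) 1, ∀ y ∈ Set.Icc (-1:ℝ) 2, |x - y| ≤ 2 / J → |f x - f y| ≤ c / 20 := fun x hx y hy hxy =>
    (hdf x ⟨by linarith [hx.1], by linarith [hx.2]⟩ y hy (lt_of_le_of_lt hxy hd2)).le
  have hiJ : ∀ i : ℕ, i < J → 0 ≤ (i:ℝ) / J ∧ (i:ℝ) / J + 1 / J ≤ 1 := fun i hi => by
    refine ⟨by positivity, ?_⟩
    rw [← add_div, div_le_one hJ0]; exact_mod_cast hi
  refine ⟨J, max (f 0 - c / 20) 0, fun i => max (f (i / J) - c / 20) 0, by exact_mod_cast hJ3.le, le_max_right _ _,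
    fun i => le_max_right _ _, fun a ha => max_le ?_ (hp a), fun i hi a ha1 ha2 => max_le ?_ (hp a), ?_⟩
  · rw [abs_le] at ha
    have := near 0 (by simp) a ⟨by linarith, by linarith⟩ (abs_le.2 ⟨by linarith, by linarith⟩)
    rw [abs_le] at this; linarith
  · obtain ⟨h1, h2⟩ := hiJ i (by omega)
    have := near (i / J) ⟨h1, by linarith⟩ a ⟨by linarith, by linarith⟩ (abs_le.2 ⟨by linarith, by linarith⟩)
    rw [abs_le] at this; linarith
  · have hb0 := le_max_left (f 0 - c / 20) 0
    obtain ⟨b, hb⟩ : ∃ b : ℕ → ℝ, b = fun i : ℕ => max (f (i / J) - c / 20) 0 := ⟨_, rfl⟩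
    have hbe : ∀ i : ℕ, max (f (i / J) - c / 20) 0 = b i := fun i => by rw [hb]
    simp only [hbe]
    have hbB : ∀ i : ℕ, i < J → b i ≤ B := fun i hi => by
      obtain ⟨h1, h2⟩ := hiJ i hi
      have := (le_abs_self _).trans (hB (i / J) ⟨by linarith, by linarith⟩)
      rw [← hbe]; exact max_le (by linarith) hB0
    have ii : ∀ x y, IntervalIntegrable (fun a => a * f a) volume x y := fun x y => (by fun_prop : Continuous fun a => a * f a).intervalIntegrable _ _
    have hs := intervalIntegral.sum_integral_adjacent_intervals (a := fun i : ℕ => (i:ℝ) / J) (n := J) (fun k _ => ii _ _)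
    simp only [Nat.cast_zero, zero_div, div_self hJ0.ne'] at hs
    have hpc : ∀ i ∈ range J, ∫ a in ((i:ℝ) / J)..(((i + 1 : ℕ) : ℝ) / J), a * f a ≤ b i * (i / J ^ 2) + B / J ^ 2 + c / 10 * (1 / J) := by
      intro i hi
      obtain ⟨h1, h2⟩ := hiJ i (Finset.mem_range.1 hi)
      have hbi := hbB i (Finset.mem_range.1 hi)
      have e : (((i + 1 : ℕ) : ℝ) / J) = i / J + 1 / J := by push_cast; ring
      rw [e]
      have hbl : f (i / J) - c / 20 ≤ b i := by rw [← hbe]; exact le_max_left _ _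
      have hb00 : 0 ≤ b i := by rw [← hbe]; exact le_max_right _ _
      have := integral_mono_on (a := (i:ℝ) / J) (b := i / J + 1 / J) (by linarith) (ii _ _) (g := fun _ => ((i:ℝ) / J + 1 / J) * b i + c / 10) (continuous_const.intervalIntegrable _ _) (by
        intro a ha
        have h3 := near (i / J) ⟨h1, by linarith⟩ a ⟨by linarith [ha.1], by linarith [ha.2]⟩ (abs_le.2 ⟨by linarith [ha.2], by linarith [ha.1]⟩)
        rw [abs_le] at h3
        have h4 : f a ≤ b i + c / 10 := by linarith
        have ha0 : 0 ≤ a := h1.trans ha.1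
        calc a * f a ≤ a * (b i + c / 10) := mll h4 ha0
          _ = a * b i + a * (c / 10) := by ring
          _ ≤ _ := add_le_add (mlr ha.2 hb00) (by nlinarith [ha.2]))
      refine this.trans ?_
      rw [intervalIntegral.integral_const, smul_eq_mul]
      have : b i * (1 / J ^ 2) ≤ B * (1 / J ^ 2) := mlr hbi (by positivity)
      calc _ = b i * (i / J ^ 2) + b i * (1 / J ^ 2) + c / 10 * (1 / J) := by ring
        _ ≤ _ := by rw [div_eq_mul_one_div B]; linarith
    have hsum := sum_le_sum hpc
    rw [hs] at hsum
    simp only [sum_add_distrib, sum_const, Finset.card_range, nsmul_eq_mul] at hsum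
    obtain ⟨K, rfl⟩ : ∃ K, J = K + 1 := ⟨J - 1, by omega⟩
    rw [sum_range_succ] at hsum
    simp only [Nat.add_sub_cancel]
    have e1 : ((K + 1 : ℕ) : ℝ) * (B / ((K + 1 : ℕ) : ℝ) ^ 2) = B * (1 / ((K + 1 : ℕ) : ℝ)) := by field_simp
    have e2 : ((K + 1 : ℕ) : ℝ) * (c / 10 * (1 / ((K + 1 : ℕ) : ℝ))) = c / 10 := by field_simp
    have e3 : b K * (K / ((K + 1 : ℕ) : ℝ) ^ 2) ≤ B * (1 / ((K + 1 : ℕ) : ℝ)) := by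
      refine mul_le_mul (hbB K (by omega)) ?_ (by positivity) hB0
      rw [div_le_div_iff₀ (by positivity) (by positivity)]
      push_cast; nlinarith [Nat.cast_nonneg (α := ℝ) K]
    have e4 : 16 * (B * (1 / ((K + 1 : ℕ) : ℝ))) ≤ c := by
      rw [mul_one_div, ← mul_div_assoc, div_le_iff₀ hJ0]; linarith
    rw [e1, e2] at hsum
    linarith

lemma loc_n (hRH : RiemannHypothesis) {X w : ℝ} (hX : 1 ≤ X) (hw : 0 ≤ w)
    (ht : √2 * Zf (√2 * X) 0 * exp (-(X * w) ^ 2 / 4) ≤ 1) {n : ℕ} (hn : 2 ≤ n) :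
    v0 X ^ 2 * vL n ^ 2 - 82 * v0 X * log n ≤ v0 X * ∫ y in (log n - w)..(log n + w), Zf (√2 * X) y ^ 2 := by
  have hX0 : 0 < X := by linarith
  have hv := v0_pos hX0
  have hn1 : (1:ℝ) ≤ √n := Real.one_le_sqrt.2 (by exact_mod_cast (by omega : 1 ≤ n))
  have hvn := vL_nonneg n
  have hL : vL n * √n ≤ log n := by
    unfold vL; rw [div_mul_cancel₀ _ (by positivity)]; exact vonMangoldt_le_log
  have hL' := mll hL hv.le
  have hz := Z_log hRH hX hn
  by_cases hA : 0 ≤ v0 X * vL n - 41 * √n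
  · refine le_trans ?_ (loc_ge hRH hX0 (log n) hw hA ?_)
    · nlinarith [sq_nonneg (√(n:ℝ))]
    · have := neg_le_abs (Zf X (log n)); linarith
  · have h1 : v0 X * vL n * (v0 X * vL n) ≤ v0 X * vL n * (41 * √n) := mll (by linarith) (by positivity)
    have h2 : 0 ≤ v0 X * ∫ y in (log n - w)..(log n + w), Zf (√2 * X) y ^ 2 :=
      mul_nonneg hv.le (intervalIntegral.integral_nonneg (by linarith) fun x _ => sq_nonneg _)
    have h3 : 0 ≤ v0 X * (vL n * √n) := by positivity
    nlinarith

lemma loc_block (hRH : RiemannHypothesis) : ∃ C, 0 ≤ C ∧ ∀ X w : ℝ, 1 ≤ X → 0 ≤ w →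
    √2 * Zf (√2 * X) 0 * exp (-(X * w) ^ 2 / 4) ≤ 1 → ∀ M N : ℕ, 1 ≤ M → M ≤ N →
    v0 X ^ 2 * (log M * (log N - log M - C)) - 82 * v0 X * (N * log N) ≤
      v0 X * ∑ n ∈ Ioc M N, ∫ y in (log n - w)..(log n + w), Zf (√2 * X) y ^ 2 := by
  obtain ⟨C, hC, h⟩ := vL_sq_ge
  refine ⟨C, hC, fun X w hX hw ht M N hM hMN => ?_⟩
  have hv := v0_pos (by linarith : 0 < X)
  have h1 := mll (h M N hM hMN) (sq_nonneg (v0 X))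
  have h2 : ∑ n ∈ Ioc M N, (v0 X ^ 2 * vL n ^ 2 - 82 * v0 X * log N) ≤
      ∑ n ∈ Ioc M N, v0 X * ∫ y in (log n - w)..(log n + w), Zf (√2 * X) y ^ 2 := by
    refine sum_le_sum fun n hn => ?_
    rw [mem_Ioc] at hn
    refine le_trans ?_ (loc_n hRH hX hw ht (by omega : 2 ≤ n))
    have : log n ≤ log N := log_le_log (by exact_mod_cast (by omega : 0 < n)) (by exact_mod_cast hn.2)
    nlinarith
  rw [sum_sub_distrib, ← mul_sum, ← mul_sum, sum_const, Nat.card_Ioc, nsmul_eq_mul] at h2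
  rw [mul_sum]
  have h3 : ((N - M : ℕ) : ℝ) ≤ N := by exact_mod_cast Nat.sub_le _ _
  have h4 : 0 ≤ 82 * v0 X * log N := by have := log_natCast_nonneg N; positivity
  nlinarith [mlr h3 h4]

lemma floor_exp {s : ℝ} (hs : 0 ≤ s) : 1 ≤ ⌊exp s⌋₊ ∧ log ⌊exp s⌋₊ ≤ s ∧ s - 1 ≤ log ⌊exp s⌋₊ ∧
    ∀ n : ℕ, ⌊exp s⌋₊ < n → s ≤ log n := by
  have h1 : 1 ≤ exp s := one_le_exp hs
  have h2 : 1 ≤ ⌊exp s⌋₊ := Nat.le_floor (by exact_mod_cast h1)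
  have h3 := Nat.floor_le (exp_pos s).le
  have h4 := Nat.lt_floor_add_one (exp s)
  have h5 : (1:ℝ) ≤ ⌊exp s⌋₊ := by exact_mod_cast h2
  refine ⟨h2, ?_, ?_, fun n hn => ?_⟩
  · rw [log_le_iff_le_exp (by linarith)]; exact h3
  · rw [le_log_iff_exp_le (by linarith), Real.exp_sub, div_le_iff₀ (exp_pos _)]
    nlinarith [exp_one_gt_d9]
  · have hn' := (Nat.floor_lt (exp_pos s).le).1 hn
    rw [le_log_iff_exp_le ((exp_pos s).trans hn')]; exact hn'.le

lemma sum_blocks (G : ℕ → ℝ) (M : ℕ → ℕ) (hM : Monotone M) (k : ℕ) :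
    ∑ n ∈ Ioc (M 0) (M k), G n = ∑ i ∈ range k, ∑ n ∈ Ioc (M i) (M (i + 1)), G n := by
  induction k with
  | zero => simp
  | succ k ih => rw [sum_range_succ, ← ih, sum_Ioc_consecutive _ (hM (Nat.zero_le _)) (hM (Nat.le_succ _))]

def Mf (L : ℝ) (J i : ℕ) : ℕ := ⌊exp (i * (L / J))⌋₊

lemma Mf_mono {L : ℝ} (hL : 0 ≤ L) (J : ℕ) : Monotone (Mf L J) := fun i j h =>
  Nat.floor_le_floor (Real.exp_le_exp.2 (mlr (by exact_mod_cast h) (by positivity)))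

lemma F_lower {f Z : ℝ → ℝ} {J : ℕ} {b0 L w : ℝ} {b : ℕ → ℝ} (hZ : Continuous Z) (hZe : ∀ y, Z (-y) = Z y) (hf : Continuous f)
    (hfe : ∀ a, f (-a) = f a) (hp : ∀ a, 0 ≤ f a) (hJ : 2 ≤ J) (hb1 : ∀ a : ℝ, |a| ≤ 1 / (J:ℝ) → b0 ≤ f a)
    (hb2 : ∀ i < J - 1, ∀ a : ℝ, (i:ℝ) / J - 1 / J ≤ a → a ≤ (i:ℝ) / J + 2 / J → b i ≤ f a)
    (hL : (J:ℝ) ≤ L) (hw : 0 ≤ w) (hwN : 2 * w * (Mf L J (J - 1) + 1) ≤ 1)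
    (hi : Integrable (fun y => f (y / L) * Z y ^ 2)) :
    b0 * (∫ y in (-w)..w, Z y ^ 2) + 2 * ∑ i ∈ range (J - 1), b i * ∑ n ∈ Ioc (Mf L J i) (Mf L J (i + 1)),
      ∫ y in (log n - w)..(log n + w), Z y ^ 2 ≤ ∫ y, f (y / L) * Z y ^ 2 := by
  have hJ0 : (0:ℝ) < J := by exact_mod_cast (by omega : 0 < J)
  have hL0 : 0 < L := by linarith
  have hM0 : Mf L J 0 = 1 := by simp [Mf]
  have hmono := Mf_mono hL0.le J
  have hN1 : 1 ≤ Mf L J (J - 1) := by rw [← hM0]; exact hmono (Nat.zero_le _)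
  have hN1' : (1:ℝ) ≤ Mf L J (J - 1) := by exact_mod_cast hN1
  have hw1 : w ≤ 1 := by nlinarith
  have hwL : w / L ≤ 1 / J := div_le_div₀ (by norm_num) hw1 hJ0 hL
  refine le_trans ?_ (sum_loc hi (fun y => by simp only [neg_div, hfe, hZe]) (fun y => mul_nonneg (hp _) (sq_nonneg _)) hw _ hN1 hwN)
  have key : ∀ x y B : ℝ, x ≤ y → (∀ t ∈ Set.Icc x y, B ≤ f (t / L)) → B * (∫ t in x..y, Z t ^ 2) ≤ ∫ t in x..y, f (t / L) * Z t ^ 2 := by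
    intro x y B hxy h
    rw [← intervalIntegral.integral_const_mul]
    exact integral_mono_on hxy ((by fun_prop : Continuous _).intervalIntegrable _ _) ((by fun_prop : Continuous _).intervalIntegrable _ _)
      fun t ht => mlr (h t ht) (sq_nonneg _)
  have h1 := key (-w) w b0 (by linarith) fun t ht => hb1 _ (by
    rw [abs_div, abs_of_pos hL0]; exact (div_le_div_of_nonneg_right (abs_le.2 ht) hL0.le).trans hwL)
  have h2 := sum_blocks (fun n => ∫ y in (log n - w)..(log n + w), f (y / L) * Z y ^ 2) _ hmono (J - 1)
  rw [hM0] at h2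
  rw [h2]
  have h3 : ∀ i ∈ range (J - 1), b i * ∑ n ∈ Ioc (Mf L J i) (Mf L J (i + 1)), ∫ y in (log n - w)..(log n + w), Z y ^ 2 ≤
      ∑ n ∈ Ioc (Mf L J i) (Mf L J (i + 1)), ∫ y in (log n - w)..(log n + w), f (y / L) * Z y ^ 2 := by
    intro i hi
    rw [mul_sum]
    refine sum_le_sum fun n hn => key _ _ _ (by linarith) fun t ht => ?_
    rw [mem_Ioc] at hn
    have g1 := (floor_exp (s := i * (L / J)) (by positivity)).2.2.2 n hn.1
    have g2 := (floor_exp (s := ((i + 1 : ℕ):ℝ) * (L / J)) (by positivity)).2.1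
    have g3 : log n ≤ log (Mf L J (i + 1)) := log_le_log (by exact_mod_cast (by omega : 0 < n)) (by exact_mod_cast hn.2)
    have g4 : log n ≤ ((i + 1 : ℕ):ℝ) * (L / J) := g3.trans g2
    push_cast at g4
    have e1 : i * (L / J) / L = (i:ℝ) / J := by field_simp
    have e2 : ((i:ℝ) + 1) * (L / J) / L = (i:ℝ) / J + 1 / J := by field_simp
    refine hb2 i (Finset.mem_range.1 hi) _ ?_ ?_
    · have := div_le_div_of_nonneg_right (by linarith [ht.1] : i * (L / J) - w ≤ t) hL0.le
      rw [sub_div, e1] at this; linarith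
    · have := div_le_div_of_nonneg_right (by linarith [ht.2] : t ≤ ((i:ℝ) + 1) * (L / J) + w) hL0.le
      rw [add_div, e2] at this
      have e3 : (2:ℝ) / J = 1 / J + 1 / J := by ring
      linarith
  linarith [sum_le_sum h3]

lemma tail_ev (hRH : RiemannHypothesis) {κ : ℝ} (hκ : 0 < κ) {J : ℕ} (hJ : 2 ≤ J) : ∀ᶠ T : ℝ in atTop,
    √2 * Zf (√2 * (κ * T)) 0 * exp (-(κ * T * (1 / (2 * (Mf (log T) J (J - 1) + 1)))) ^ 2 / 4) ≤ 1 := by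
  have hJ0 : (0:ℝ) < J := by exact_mod_cast (by omega : 0 < J)
  obtain ⟨a, ha⟩ : ∃ a, a = κ ^ 2 / (32 * J ^ 2) := ⟨_, rfl⟩
  have ha0 : 0 < a := by rw [ha]; positivity
  obtain ⟨B, hB⟩ : ∃ B, B = |log (28 * κ ^ 2)| := ⟨_, rfl⟩
  filter_upwards [Real.tendsto_log_atTop.eventually_ge_atTop (max 1 ((2 + B) / a)), eventually_ge_atTop (max 1 (8 / κ))] with T hT1 hT2
  obtain ⟨L, hL⟩ : ∃ L, L = log T := ⟨_, rfl⟩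
  rw [← hL] at hT1 ⊢
  have hT0 : 0 < T := by linarith [le_max_left 1 (8 / κ)]
  have hTe : T = exp L := by rw [hL, exp_log hT0]
  have hX : 8 ≤ κ * T := by
    have := (le_max_right _ _).trans hT2
    rw [div_le_iff₀ hκ] at this; linarith
  have hL1 : 1 ≤ L := (le_max_left _ _).trans hT1
  have hL2 : 2 + B ≤ L * a := by rw [← div_le_iff₀ ha0]; exact (le_max_right _ _).trans hT1
  have hs2 : 1 ≤ √2 := Real.one_le_sqrt.2 (by norm_num)
  have hss : √2 * √2 = 2 := Real.mul_self_sqrt (by norm_num)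
  have hX2 : 8 ≤ √2 * (κ * T) := by nlinarith
  have hZ : √2 * Zf (√2 * (κ * T)) 0 ≤ exp (2 * L + B) := by
    have h1 := Z0_le7 hRH hX2
    have h2 : log (√2 * (κ * T)) ≤ √2 * (κ * T) := (log_le_sub_one_of_pos (by linarith)).trans (by linarith)
    have h3 : Zf (√2 * (κ * T)) 0 ≤ 7 * (√2 * (κ * T) * (√2 * (κ * T))) := h1.trans (by nlinarith)
    have h4 : Zf (√2 * (κ * T)) 0 ≤ 14 * (κ * T) ^ 2 := h3.trans (by nlinarith)
    have h5 : √2 ≤ 2 := by nlinarith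
    have h6 : √2 * Zf (√2 * (κ * T)) 0 ≤ 28 * κ ^ 2 * T ^ 2 :=
      (mll h4 (by positivity)).trans (by nlinarith [sq_nonneg (κ * T)])
    refine h6.trans ?_
    rw [add_comm, exp_add, two_mul, exp_add, ← hTe, ← sq]
    refine mlr ?_ (sq_nonneg _)
    rw [← log_le_iff_le_exp (by positivity), hB]; exact le_abs_self _
  obtain ⟨N, hN⟩ : ∃ N, N = Mf L J (J - 1) := ⟨_, rfl⟩
  rw [← hN]
  have hN1 : (N:ℝ) + 1 ≤ 2 * (T * exp (-(L / J))) := by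
    have e : ((J - 1 : ℕ):ℝ) * (L / J) = L + -(L / J) := by
      rw [Nat.cast_sub (by omega)]; push_cast; field_simp; ring
    have h1 : (N:ℝ) ≤ exp (((J - 1 : ℕ):ℝ) * (L / J)) := by rw [hN]; exact Nat.floor_le (exp_pos _).le
    have h2 : 1 ≤ exp (((J - 1 : ℕ):ℝ) * (L / J)) := one_le_exp (by positivity)
    rw [e, exp_add, ← hTe] at h1 h2
    linarith
  have hw : κ * exp (L / J) / 4 ≤ κ * T * (1 / (2 * (N + 1))) := by
    rw [mul_one_div, div_le_div_iff₀ (by norm_num) (by positivity)]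
    have h1 := mll hN1 (by positivity : 0 ≤ 2 * κ * exp (L / J))
    have h2 : exp (L / J) * exp (-(L / J)) = 1 := by rw [← exp_add]; simp
    calc _ = 2 * κ * exp (L / J) * (N + 1) := by ring
      _ ≤ _ := h1
      _ = 4 * κ * T * (exp (L / J) * exp (-(L / J))) := by ring
      _ = _ := by rw [h2]; ring
  have hq : 2 * L + B ≤ (κ * T * (1 / (2 * (N + 1)))) ^ 2 / 4 := by
    have h1 := pow_le_pow_left₀ (by positivity) hw 2
    have h2 : L / J * 2 ≤ exp (L / J) * 2 := by
      have := add_one_le_exp (L / J); linarith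
    have h3 : (L / J * 2) ^ 2 / 2 ≤ exp (L / J) ^ 2 := by
      have := quadratic_le_exp_of_nonneg (by positivity : 0 ≤ L / J * 2)
      rw [← exp_nat_mul, mul_comm ((2:ℕ):ℝ)]; push_cast
      have h4 : 0 ≤ L / J := by positivity
      linarith
    have h4 := mll h3 (by positivity : 0 ≤ κ ^ 2 / 64)
    have h5 : κ ^ 2 / 64 * ((L / J * 2) ^ 2 / 2) = a * L ^ 2 := by rw [ha]; field_simp; ring
    have hB0 : 0 ≤ B := by rw [hB]; exact abs_nonneg _
    have h6 : 2 * L + B ≤ a * L ^ 2 := by nlinarith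
    calc _ ≤ _ := h6
      _ = _ := h5.symm
      _ ≤ _ := h4
      _ = (κ * exp (L / J) / 4) ^ 2 / 4 := by ring
      _ ≤ _ := by linarith
  calc _ ≤ exp (2 * L + B) * exp (-(2 * L + B)) := by
        refine mul_le_mul hZ (Real.exp_le_exp.2 (by linarith)) (exp_pos _).le (exp_pos _).le
    _ = 1 := by rw [← exp_add]; simp

lemma X_le_v0 {X : ℝ} (hX : 0 ≤ X) : X ≤ 4 * v0 X := by
  have h : √π ≤ 2 := by rw [sqrt_le_left (by norm_num)]; linarith [pi_lt_four]
  have hp : 0 < √π := Real.sqrt_pos.2 pi_pos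
  unfold v0
  rw [← mul_div_assoc, le_div_iff₀ (by positivity)]
  nlinarith

lemma block_arith {i J : ℕ} (hJ : 2 ≤ J) (hi : i < J) {L C m m' v e κ: ℝ} (hv : 0 < v) (hL : 1 ≤ L) (hC : 0 ≤ C) (hLC : 1 + C ≤ L / J)
    (h1 : i * (L / J) - 1 ≤ m) (h1' : m ≤ i * (L / J)) (h2 : ((i:ℝ) + 1) * (L / J) - 1 ≤ m') (hm : 0 ≤ m) (he : e ≤ 4 * v / κ * L) :
    v ^ 2 * (i / J ^ 2 * L ^ 2 - (2 + C + 328 / κ) * L) ≤ v ^ 2 * (m * (m' - m - C)) - 82 * v * e := by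
  have hJ0 : (0:ℝ) < J := by exact_mod_cast (by omega : 0 < J)
  have hiJ : (i:ℝ) / J ≤ 1 := by rw [div_le_one hJ0]; exact_mod_cast hi.le
  have hJ1 : 1 / (J:ℝ) ≤ 1 := by rw [div_le_one hJ0]; exact_mod_cast (by omega : 1 ≤ J)
  obtain ⟨q, hq⟩ : ∃ q, q = L / J := ⟨_, rfl⟩
  rw [← hq] at h1 h2 hLC h1'
  have hqL : q ≤ L := by rw [hq, div_eq_mul_one_div]; nlinarith
  have hiq : i * q ≤ L := by
    have : i * q = i / J * L := by rw [hq]; ring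
    rw [this]; nlinarith
  have e0 : (i:ℝ) / J ^ 2 * L ^ 2 = i * q * q := by rw [hq]; field_simp
  have a1 : (q - 1 - C) ≤ m' - m - C := by linarith
  have hiq0 : 0 ≤ i * q := by rw [hq]; positivity
  have a2 : (i * q) * (q - 1 - C) - L  ≤ m * (m' - m - C) := by
    have b1 := mll a1 hm
    have b2 := mlr h1 (by linarith : 0 ≤ q - 1 - C)
    nlinarith
  have a3 : i * q * (1 + C) ≤ L * (1 + C) := mlr hiq (by linarith)
  have a4 : i / J ^ 2 * L ^ 2 - (2 + C) * L ≤ m * (m' - m - C) := by rw [e0]; nlinarith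
  have a5 := mll a4 (sq_nonneg v)
  have a6 := mll he (by positivity : 0 ≤ 82 * v)
  have a7 : 82 * v * (4 * v / κ * L) = v ^ 2 * (328 / κ * L) := by ring
  rw [a7] at a6
  linarith

lemma final_arith {v L C b0 S1 S2 c Q I0 G R : ℝ} (hb0 : 0 ≤ b0) (hv : 0 < v) (hL : 0 < L) (hc : 0 < c)
    (h1 : b0 * (v * (L - C)) ^ 2 ≤ b0 * (v * I0)) (h2 : v ^ 2 * L ^ 2 * S1 - v ^ 2 * L * S2 ≤ v * G)
    (h3 : b0 * I0 + 2 * G ≤ L * R) (h4 : 1 + c / 2 ≤ b0 + 2 * S1) (hQ : Q = b0 * (2 * C) + 2 * S2) (hLQ : Q * 4 / c ≤ L) :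
    (1 + c / 4) * v * L ≤ R := by
  have h3' := mll h3 hv.le
  have g1 := mll h4 (by positivity : 0 ≤ v ^ 2 * L ^ 2)
  have g2 : 0 ≤ b0 * (v * C) ^ 2 := by positivity
  have g : v ^ 2 * L * Q ≤ v ^ 2 * L * (L * (c / 4)) := by
    refine mll ?_ (by positivity)
    rw [div_le_iff₀ hc] at hLQ; linarith
  rw [hQ] at g
  have hfin : v * L * ((1 + c / 4) * v * L) ≤ v * L * R := by linarith
  exact le_of_mul_le_mul_left hfin (by positivity)

lemma moments (hRH : RiemannHypothesis) {lam : ℝ} (hlam : 0 < lam) : ∃ C, 0 < C ∧ ∀ κ, 0 < κ → ∀ᶠ T : ℝ in atTop,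
    Integrable (fun t => VX (κ * T) t * Nh (2 * π * lam / log T) t ^ 2) zmu ∧
    ∫ t, VX (κ * T) t * Nh (2 * π * lam / log T) t ^ 2 ∂zmu ≤ C * (κ * T * log T) := by
  obtain ⟨C, hC, h⟩ := second_moment hRH
  have hpl : 0 < 2 * π * lam := by positivity
  obtain ⟨d, hd⟩ : ∃ d, d = min (1 / 10) (1 / (2 * π * lam)) := ⟨_, rfl⟩
  have hd0 : 0 < d := by rw [hd]; positivity
  have hd1 : d ≤ 1 / 10 := hd ▸ min_le_left _ _
  have hd2 : d * (2 * π * lam) ≤ 1 := by rw [← le_div_iff₀ hpl]; exact hd ▸ min_le_right _ _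
  refine ⟨2 * C * (1 + (2 / d) ^ 2), by positivity, fun κ hκ => ?_⟩
  filter_upwards [Real.tendsto_log_atTop.eventually_ge_atTop (1 / d + 2 * |log κ|), eventually_ge_atTop (max 1 (8 / κ))] with T hT1 hT2
  have hT0 : 0 < T := by linarith [le_max_left 1 (8 / κ)]
  obtain ⟨L, hL⟩ : ∃ L, L = log T := ⟨_, rfl⟩
  rw [← hL] at hT1 ⊢
  have hX : 8 ≤ κ * T := by
    have := (le_max_right _ _).trans hT2
    rw [div_le_iff₀ hκ] at this; linarith
  have hd3 : 0 < 1 / d := by positivity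
  have hk1 := abs_nonneg (log κ)
  have hL0 : 0 < L := by linarith
  have hdL : 1 ≤ d * L := by
    have : d * (1 / d) = 1 := by field_simp
    nlinarith
  have hlx : log (κ * T) = log κ + L := by rw [log_mul hκ.ne' hT0.ne', hL]
  obtain ⟨i, hh⟩ := h (κ * T) (d * L) (2 * π * lam / L) hX hdL (by
    rw [← le_log_iff_exp_le (by linarith), hlx]
    have := neg_abs_le (log κ); nlinarith) (by
    rw [mul_div_assoc', div_le_one hL0]; nlinarith)
  refine ⟨i, hh.trans ?_⟩
  have hl2 : log (κ * T) ≤ 2 * L := by rw [hlx]; linarith [le_abs_self (log κ)]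
  have hl0 : 0 ≤ log (κ * T) := log_nonneg (by linarith)
  have hr : log (κ * T) / (d * L) ≤ 2 / d := by
    rw [div_le_div_iff₀ (by positivity) hd0]; nlinarith
  have hr2 := pow_le_pow_left₀ (by positivity) hr 2
  calc C * (κ * T * log (κ * T)) * (1 + (log (κ * T) / (d * L)) ^ 2)
      ≤ C * (κ * T * (2 * L)) * (1 + (2 / d) ^ 2) := by
        refine mul_le_mul (mll (mll hl2 (by linarith)) hC.le) (by linarith) (by positivity) (by positivity)
    _ = _ := by ring

lemma main0 (hRH : RiemannHypothesis) {lam : ℝ} {r : ℝ → ℝ} (hr : memA lam r) (hc : 0 < cOf r) : ∃ δ, 0 < δ ∧ ∀ κ, 0 < κ →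
    ∀ᶠ T : ℝ in atTop, Integrable (fun t => VX (κ * T) t * Nh (2 * π * lam / log T) t) zmu →
      (1 + δ) * v0 (κ * T) * log T ≤ ∫ t, VX (κ * T) t * Nh (2 * π * lam / log T) t ∂zmu := by
  obtain ⟨fc, fe, -, -, -⟩ := fourierCos_facts hr
  obtain ⟨c, hcc⟩ : ∃ c, c = cOf r := ⟨_, rfl⟩
  rw [← hcc] at hc
  obtain ⟨J, b0, b, hJ, hb0, hb, hb1, hb2, hsum⟩ := step_fn fc hr.2.2.2.2.2 hc hcc.symm
  obtain ⟨C1, hC1⟩ := Z0_ge hRH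
  obtain ⟨C2, hC2, hblk⟩ := loc_block hRH
  refine ⟨c / 4, by positivity, fun κ hκ => ?_⟩
  have hJ0 : (0:ℝ) < J := by exact_mod_cast (by omega : 0 < J)
  obtain ⟨C, hC⟩ : ∃ C, C = 4 * |C1| + |log κ| + 1 := ⟨_, rfl⟩
  have hCp : 1 ≤ C := by rw [hC]; linarith [abs_nonneg C1, abs_nonneg (log κ)]
  obtain ⟨K, hK⟩ : ∃ K, K = 2 + C2 + 328 / κ := ⟨_, rfl⟩
  obtain ⟨Q, hQ⟩ : ∃ Q, Q = b0 * (2 * C) + 2 * ∑ i ∈ range (J - 1), b i * K := ⟨_, rfl⟩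
  filter_upwards [Real.tendsto_log_atTop.eventually_ge_atTop (Q * 4 / c),
    Real.tendsto_log_atTop.eventually_ge_atTop (J * (1 + C2) + C), eventually_ge_atTop (max 1 (8 / κ)), tail_ev hRH hκ hJ] with T hLQ hT1 hT2 htail hint
  have hT0 : 0 < T := by linarith [le_max_left 1 (8 / κ)]
  obtain ⟨L, hL⟩ : ∃ L, L = log T := ⟨_, rfl⟩
  rw [← hL] at hT1 hLQ hint htail ⊢
  have hTe : T = exp L := by rw [hL, exp_log hT0]
  obtain ⟨X, hXX⟩ : ∃ X, X = κ * T := ⟨_, rfl⟩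
  have hX : 8 ≤ X := by
    have := (le_max_right _ _).trans hT2
    rw [div_le_iff₀ hκ] at this; linarith
  have hlx : log X = log κ + L := by rw [hXX, log_mul hκ.ne' hT0.ne', hL]
  rw [← hXX] at hint htail ⊢
  obtain ⟨w, hw⟩ : ∃ w : ℝ, w = 1 / (2 * (Mf L J (J - 1) + 1)) := ⟨_, rfl⟩
  rw [← hw] at htail
  have hw0 : 0 ≤ w := by rw [hw]; positivity
  have hX0 : 0 < X := by linarith
  have hJC : 0 ≤ J * C2 := by positivity
  have hLJ : (J:ℝ) ≤ L := by linarith only [hJC, hT1, hCp]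
  have hL1 : C ≤ L := by linarith only [hJC, hT1, hJ0]
  have hL0 : 0 < L := by linarith
  have hv := v0_pos hX0
  have hXv := X_le_v0 hX0.le
  obtain ⟨v, hvv⟩ : ∃ v, v = v0 X := ⟨_, rfl⟩
  obtain ⟨hFi, hS⟩ := S_bound hRH hr hX0 hL0 hint
  have hF := F_lower (Zf_cont hRH (by positivity : 0 < √2 * X)) (Zf_even _) fc fe hr.2.2.2.2.2 hJ hb1 hb2 hLJ hw0 (by
    rw [hw]; field_simp; norm_num) hFi
  have hz := hC1 X hX
  have hone := loc_ge hRH hX0 0 hw0 (A := v0 X * (L - C)) (mul_nonneg hv.le (by linarith)) (by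
    have h1 := le_abs_self (Zf X 0)
    have h2 : C1 * X ≤ |C1| * (4 * v0 X) := mul_le_mul (le_abs_self _) hXv hX0.le (abs_nonneg _)
    have h3 : v0 X * (-|log κ|) ≤ v0 X * log κ := mll (neg_abs_le _) hv.le
    rw [hlx] at hz
    rw [hC]; linarith only [h1, h2, h3, hz, htail, hXv, hX])
  simp only [zero_sub, zero_add] at hone
  have hblock : ∀ i ∈ range (J - 1), b i * (v0 X ^ 2 * (i / J ^ 2 * L ^ 2 - K * L)) ≤
      v0 X * (b i * ∑ n ∈ Ioc (Mf L J i) (Mf L J (i + 1)), ∫ y in (log n - w)..(log n + w), Zf (√2 * X) y ^ 2) := by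
    intro i hi
    rw [Finset.mem_range] at hi
    have f1 := floor_exp (s := i * (L / J)) (by positivity)
    have f2 := floor_exp (s := ((i + 1 : ℕ):ℝ) * (L / J)) (by positivity)
    rw [mul_left_comm (v0 X) (b i)]
    refine mll ?_ (hb i)
    refine le_trans ?_ (hblk X w (by linarith) hw0 htail (Mf L J i) (Mf L J (i + 1)) f1.1 (Mf_mono hL0.le J (Nat.le_succ i)))
    rw [hK]
    have hs : ((i + 1 : ℕ):ℝ) * (L / J) ≤ L := by
      have : ((i + 1 : ℕ):ℝ) ≤ J := by exact_mod_cast (by omega : i + 1 ≤ J)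
      calc _ ≤ J * (L / J) := mlr this (by positivity)
        _ = L := by field_simp
    refine block_arith hJ (by omega) hv (by linarith) hC2 (by rw [le_div_iff₀ hJ0]; linarith) f1.2.2.1 f1.2.1 (by rw [← Nat.cast_succ]; exact f2.2.2.1)
      (log_natCast_nonneg _) ?_
    refine mul_le_mul ?_ (f2.2.1.trans hs) (log_natCast_nonneg _) (by positivity)
    rw [le_div_iff₀ hκ]
    refine le_trans ?_ hXv
    rw [hXX, mul_comm]
    refine mll ?_ hκ.le
    rw [hTe]
    exact (Nat.floor_le (exp_pos _).le).trans (Real.exp_le_exp.2 hs)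
  have hbs := sum_le_sum hblock
  rw [← mul_sum] at hbs
  have e1 : ∑ i ∈ range (J - 1), b i * (v0 X ^ 2 * (i / J ^ 2 * L ^ 2 - K * L)) =
      v0 X ^ 2 * L ^ 2 * (∑ i ∈ range (J - 1), b i * (i / J ^ 2)) - v0 X ^ 2 * L * ∑ i ∈ range (J - 1), b i * K := by
    rw [mul_sum, mul_sum, ← sum_sub_distrib]
    exact sum_congr rfl fun i _ => by ring
  rw [e1] at hbs
  obtain ⟨S1, hS1⟩ : ∃ S1, S1 = ∑ i ∈ range (J - 1), b i * ((i:ℝ) / J ^ 2) := ⟨_, rfl⟩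
  obtain ⟨S2, hS2⟩ : ∃ S2, S2 = ∑ i ∈ range (J - 1), b i * K := ⟨_, rfl⟩
  rw [← hS1] at hsum hbs
  rw [← hS2] at hQ hbs
  exact final_arith hb0 hv hL0 hc (mll hone hb0) hbs (hF.trans hS) hsum hQ hLQ

/-- indicator of bad set -/
def fG (lam T : ℝ) : ℝ → ℝ := {t : ℝ | |t| ≤ T ∧ 1 < Nh (2 * π * lam / log T) t}.indicator 1

lemma fG_int (hRH : RiemannHypothesis) (lam T : ℝ) : Integrable (fG lam T) zmu := by
  refine zmu_int_mono (zmu_Icc_int hRH (-T) T) fun t => ?_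
  unfold fG
  by_cases h : t ∈ {t : ℝ | |t| ≤ T ∧ 1 < Nh (2 * π * lam / log T) t}
  · rw [Set.indicator_of_mem h, Set.indicator_of_mem (show t ∈ Set.Icc (-T) T from abs_le.1 h.1)]; simp
  · rw [Set.indicator_of_notMem h]; simp only [abs_zero]; exact Set.indicator_nonneg (fun _ _ => by simp) _

lemma fG_pt {lam T X ε η : ℝ} (hX : 0 < X) (hT : 0 ≤ T) (hε : 0 < ε) (hη : exp (-(T / X) ^ 2 / 2) ≤ η) (t : ℝ) :
    VX X t * Nh (2 * π * lam / log T) t - VX X t ≤ ε * (VX X t * Nh (2 * π * lam / log T) t ^ 2) +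
      1 / (4 * ε) * fG lam T t + η * (VX (√2 * X) t * Nh (2 * π * lam / log T) t ^ 2) := by
  have hV := VX_pos X t
  have hV1 := VX_le_one X t
  have hV' := VX_pos (√2 * X) t
  have hη0 : 0 ≤ η := (exp_pos _).le.trans hη
  have hf0 : 0 ≤ fG lam T t := Set.indicator_nonneg (fun _ _ => by simp) _
  obtain ⟨N, hN⟩ : ∃ N, N = Nh (2 * π * lam / log T) t := ⟨_, rfl⟩
  rw [← hN]
  have p1 : 0 ≤ ε * (VX X t * N ^ 2) := by positivity
  have p2 : 0 ≤ 1 / (4 * ε) * fG lam T t := by positivity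
  have p3 : 0 ≤ η * (VX (√2 * X) t * N ^ 2) := by positivity
  by_cases h1 : N ≤ 1
  · nlinarith
  · push Not at h1
    by_cases h2 : |t| ≤ T
    · have e : fG lam T t = 1 := by
        have : t ∈ {t : ℝ | |t| ≤ T ∧ 1 < Nh (2 * π * lam / log T) t} := ⟨h2, by rwa [← hN]⟩
        unfold fG; rw [Set.indicator_of_mem this]; rfl
      rw [e] at p2 ⊢
      have q : N ≤ ε * N ^ 2 + 1 / (4 * ε) := by
        have : ε * N ^ 2 + 1 / (4 * ε) - N = (2 * ε * N - 1) ^ 2 / (4 * ε) := by field_simp; ring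
        have : 0 ≤ (2 * ε * N - 1) ^ 2 / (4 * ε) := by positivity
        linarith
      have q2 := mll q hV.le
      nlinarith
    · push Not at h2
      have hv : VX (√2 * X) t ≤ η := by
        refine le_trans ?_ hη
        unfold VX
        refine Real.exp_le_exp.2 ?_
        have hs : (√2 * X) ^ 2 = 2 * X ^ 2 := by rw [mul_pow, sq_sqrt (by norm_num)]
        rw [div_pow, div_pow, hs, ← sq_abs t]
        have : T ^ 2 ≤ |t| ^ 2 := pow_le_pow_left₀ hT h2.le 2
        have e : -(T ^ 2 / X ^ 2) / 2 = -(T ^ 2 / (2 * X ^ 2)) := by field_simp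
        rw [e]
        exact neg_le_neg (div_le_div_of_nonneg_right this (by positivity))
      have q : VX X t * N ≤ η * (VX (√2 * X) t * N ^ 2) := by
        rw [← VX_sqrt2 (X := X) t, sq]
        calc _ = VX (√2 * X) t * (VX (√2 * X) t * N) := by ring
          _ ≤ η * (VX (√2 * X) t * N) := mlr hv (by positivity)
          _ ≤ _ := mll (mll (by nlinarith) hV'.le) hη0
      linarith

theorem G_lower (hRH : RiemannHypothesis) {lam : ℝ} (hlam : 0 < lam) {r : ℝ → ℝ} (hr : memA lam r) (hc : 0 < cOf r) :
    ∃ c, 0 < c ∧ ∀ᶠ T : ℝ in atTop, c * (T * log T) ≤ ∫ t, fG lam T t ∂zmu := by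
  obtain ⟨δ, hδ, h0⟩ := main0 hRH hr hc
  obtain ⟨C, hC, hm⟩ := moments hRH hlam
  obtain ⟨κ, hκ, hκC⟩ : ∃ κ, 0 < κ ∧ 2 * κ ^ 2 * (2 * C) ≤ δ / 32 := by
    refine ⟨√(δ / (128 * C)), by positivity, ?_⟩
    rw [sq_sqrt (by positivity)]
    exact le_of_eq (by field_simp; norm_num)
  obtain ⟨ε, hε⟩ : ∃ ε, ε = δ / (32 * C) := ⟨_, rfl⟩
  have hε0 : 0 < ε := by rw [hε]; positivity
  refine ⟨4 * ε * (δ / 16 * κ), by positivity, ?_⟩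
  filter_upwards [h0 κ hκ, hm κ hκ, hm (√2 * κ) (by positivity), eventually_ge_atTop (max 1 (8 / κ)),
    Real.tendsto_log_atTop.eventually_ge_atTop ((|log κ| + 24) / (δ / 2))] with T g0 g1 g2 hT hL
  have hT0 : 0 < T := by linarith [le_max_left 1 (8 / κ)]
  have hX : 8 ≤ κ * T := by
    have := (le_max_right _ _).trans hT
    rw [div_le_iff₀ hκ] at this; linarith
  have hX0 : 0 < κ * T := by linarith
  have hlx : log (κ * T) = log κ + log T := log_mul hκ.ne' hT0.ne'
  have hZ := Z0_le hRH (by linarith : 1 ≤ κ * T)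
  rw [Zf_zero, hlx] at hZ
  have iV := VX_int hRH hX0
  have iN : Integrable (fun t => VX (κ * T) t * Nh (2 * π * lam / log T) t) zmu := by
    refine zmu_int_mono (iV.add g1.1) fun t => ?_
    have a1 := VX_pos (κ * T) t
    have a2 := Nh_nonneg (2 * π * lam / log T) t
    rw [abs_of_nonneg (by positivity), Pi.add_apply]
    nlinarith [sq_nonneg (Nh (2 * π * lam / log T) t - 1)]
  have hlow := g0 iN
  rw [mul_assoc √2] at g2
  obtain ⟨il, el⟩ := int_lin g1.1 (fG_int hRH lam T) g2.1 ε (1 / (4 * ε)) (2 * κ ^ 2)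
  have hη : exp (-(T / (κ * T)) ^ 2 / 2) ≤ 2 * κ ^ 2 := by
    have e : -(T / (κ * T)) ^ 2 / 2 = -(1 / (2 * κ ^ 2)) := by field_simp
    rw [e, exp_neg, inv_le_comm₀ (exp_pos _) (by positivity), ← one_div]
    linarith [add_one_le_exp (1 / (2 * κ ^ 2))]
  have hint := integral_mono (iN.sub iV) il (fun t => fG_pt hX0 hT0.le hε0 hη t)
  rw [el] at hint
  simp only [Pi.sub_apply] at hint
  rw [integral_sub iN iV] at hint
  obtain ⟨L, hLL⟩ : ∃ L, L = log T := ⟨_, rfl⟩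
  rw [← hLL] at hL hlow hZ hint g1 g2 ⊢
  rw [div_le_iff₀ (by positivity)] at hL
  have hv := v0_pos hX0
  have hXv := X_le_v0 hX0.le
  have hk := abs_nonneg (log κ)
  have hL0 : 0 < L := by nlinarith
  have a1 : δ / 8 * (κ * T * L) ≤ (1 + δ) * v0 (κ * T) * L - (v0 (κ * T) * (log κ + L) + 6 * (κ * T)) := by
    have b1 := mll hL hv.le
    have b2 := mll (le_abs_self (log κ)) hv.le
    have b3 := mlr hXv (by positivity : 0 ≤ δ / 8 * L)
    linarith
  have a2 : ε * ∫ t, VX (κ * T) t * Nh (2 * π * lam / L) t ^ 2 ∂zmu ≤ δ / 32 * (κ * T * L) := by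
    refine (mll g1.2 hε0.le).trans (le_of_eq ?_)
    rw [hε]; field_simp
  have a3 : 2 * κ ^ 2 * ∫ t, VX (√2 * (κ * T)) t * Nh (2 * π * lam / L) t ^ 2 ∂zmu ≤ δ / 32 * (κ * T * L) := by
    refine (mll g2.2 (by positivity)).trans ?_
    have hs : √2 ≤ 2 := by rw [sqrt_le_left (by norm_num)]; norm_num
    calc _ = 2 * κ ^ 2 * (√2 * C) * (κ * T * L) := by ring
      _ ≤ _ := by
        refine mlr (le_trans ?_ hκC) (by positivity)
        exact mll (mlr hs hC.le) (by positivity)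
  have a4 : δ / 16 * (κ * T * L) ≤ 1 / (4 * ε) * ∫ t, fG lam T t ∂zmu := by linarith
  have a5 := mll a4 (by positivity : 0 ≤ 4 * ε)
  have a6 : 4 * ε * (1 / (4 * ε) * ∫ t, fG lam T t ∂zmu) = ∫ t, fG lam T t ∂zmu := by field_simp
  rw [a6] at a5
  linarith

/-- zero at ordinate -/
abbrev isZ (γ : ℝ) : Prop := riemannZeta (1 / 2 + γ * I) = 0

lemma isZ_iff (γ : ℝ) : isZ γ ↔ 1 ≤ ordMult γ := by
  refine ⟨fun h => (xi_order γ).2 h, fun h => ?_⟩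
  by_contra hz
  have : ordMult γ ≤ 0 := Nat.sInf_le (by rw [Set.mem_ofPred_eq, iteratedDeriv_zero]; exact hz)
  omega

lemma ordMult_neg (γ : ℝ) : ordMult (-γ) = ordMult γ := by
  rw [← (xi_order γ).1, ← (xi_order (-γ)).1]
  have h := analyticOrderAt_comp_of_deriv_ne_zero (f := xi) (g := fun s : ℂ => 1 - s) (z₀ := 1 / 2 + γ * I)
    (by fun_prop) (by simp)
  have e1 : xi ∘ (fun s : ℂ => 1 - s) = xi := funext xi_one_sub
  have e2 : (1:ℂ) - (1 / 2 + γ * I) = 1 / 2 + ((-γ : ℝ) : ℂ) * I := by push_cast; ring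
  simp only [e1, e2] at h
  unfold analyticOrderNatAt
  rw [h]

lemma isZ_neg {γ : ℝ} (h : isZ γ) : isZ (-γ) := by
  rw [isZ_iff] at *; rwa [ordMult_neg]

lemma zeros_finite (K : ℝ) : {γ : ℝ | |γ| ≤ K ∧ isZ γ}.Finite := by
  refine ((ZO_finite K).image Subtype.val).subset fun γ hγ => ⟨⟨γ, hγ.2⟩, hγ.1, rfl⟩

open Classical in
lemma sum_le_zmu {f : ℝ → ℝ} (hf : Integrable f zmu) (h0 : ∀ t, 0 ≤ f t) (S : Finset ℝ) (hS : ∀ γ ∈ S, isZ γ) :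
    ∑ γ ∈ S, (ordMult γ : ℝ) * f γ ≤ ∫ t, f t ∂zmu := by
  rw [← sum_subtype_of_mem (p := isZ) (fun γ => (ordMult γ : ℝ) * f γ) hS]
  exact sum_le_hasSum _ (fun i _ => mul_nonneg (Nat.cast_nonneg _) (h0 _)) (zmu_hasSum hf)

open Classical in
lemma zmu_le_sum {f : ℝ → ℝ} (hf : Integrable f zmu) (S : Finset ℝ) (hS : ∀ γ ∈ S, isZ γ) (hs : ∀ γ, isZ γ → γ ∉ S → f γ = 0) :
    ∫ t, f t ∂zmu = ∑ γ ∈ S, (ordMult γ : ℝ) * f γ := by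
  rw [← sum_subtype_of_mem (p := isZ) (fun γ => (ordMult γ : ℝ) * f γ) hS]
  refine (zmu_hasSum hf).unique (hasSum_sum_of_ne_finset_zero fun z hz => ?_)
  rw [hs z z.2 (fun h => hz (Finset.mem_subtype.2 h)), mul_zero]

/-- close pair predicate -/
def Bd (h γ : ℝ) : Prop := 2 ≤ ordMult γ ∨ ∃ γ', γ' ≠ γ ∧ isZ γ' ∧ |γ' - γ| ≤ h

lemma Bd_neg {h γ : ℝ} (hb : Bd h γ) : Bd h (-γ) := by
  rcases hb with hb | ⟨g, h1, h2, h3⟩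
  · left; rwa [ordMult_neg]
  · exact Or.inr ⟨-g, fun e => h1 (neg_injective e), isZ_neg h2, by rw [← abs_neg]; convert h3 using 2; ring⟩

lemma Bd_of_Nh (hRH : RiemannHypothesis) {h γ : ℝ} (hz : isZ γ) (hN : 1 < Nh h γ) : Bd h γ := by
  by_contra hb
  unfold Bd at hb
  push Not at hb
  rw [Nh_eq, zmu_le_sum (zmu_Icc_int hRH _ _) {γ} (by simpa using hz)] at hN
  · rw [sum_singleton] at hN
    have h1 : (ordMult γ : ℝ) ≤ 1 := by exact_mod_cast (by omega : ordMult γ ≤ 1)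
    have h2 : (Set.Icc (γ - h) (γ + h)).indicator (1 : ℝ → ℝ) γ ≤ 1 := Set.indicator_le_self' (by simp) _
    have h3 : 0 ≤ (Set.Icc (γ - h) (γ + h)).indicator (1 : ℝ → ℝ) γ := Set.indicator_nonneg (fun _ _ => by simp) _
    have h4 : (0:ℝ) ≤ ordMult γ := Nat.cast_nonneg _
    nlinarith
  · intro g hg hgn
    refine Set.indicator_of_notMem (fun hm => ?_) _
    have := hb.2 g (by simpa using hgn) hg
    rw [lt_abs] at this
    rcases this with h1 | h1 <;> linarith [hm.1, hm.2]

lemma ords_finite (T : ℝ) : (zetaOrds T).Finite :=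
  (zeros_finite T).subset fun _ h => ⟨abs_le.2 ⟨by linarith [h.1, h.2.1], h.2.1⟩, h.2.2⟩

lemma Dcount_eq (lam T : ℝ) : Dcount lam T = ∑ γ ∈ (ords_finite T).toFinset,
    ((ordMult γ - 1) + if nextOrd γ - γ ≤ 2 * π * lam / log T then 1 else 0) := finsum_mem_eq_finite_toFinset_sum _ _

lemma zetaN_eq (T : ℝ) : zetaN T = ∑ γ ∈ (ords_finite T).toFinset, ordMult γ := finsum_mem_eq_finite_toFinset_sum _ _

lemma Dcount_le (lam T : ℝ) : Dcount lam T ≤ zetaN T := by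
  rw [Dcount_eq, zetaN_eq]
  refine sum_le_sum fun γ hγ => ?_
  have := (isZ_iff γ).1 ((ords_finite T).mem_toFinset.1 hγ).2.2
  split_ifs <;> omega

lemma zetaN_le (hRH : RiemannHypothesis) {T : ℝ} (hT : 8 ≤ T) : (zetaN T : ℝ) ≤ 21 * (T * log T) := by
  have h1 := sum_le_zmu (VX_int hRH (by linarith : 0 < T)) (fun t => (VX_pos T t).le) (ords_finite T).toFinset
    (fun γ hγ => ((ords_finite T).mem_toFinset.1 hγ).2.2)
  rw [← Zf_zero] at h1
  have h2 := h1.trans (Z0_le7 hRH hT)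
  have h3 : (zetaN T : ℝ) * exp (-1) ≤ ∑ γ ∈ (ords_finite T).toFinset, (ordMult γ : ℝ) * VX T γ := by
    rw [zetaN_eq]; push_cast
    rw [sum_mul]
    refine sum_le_sum fun γ hγ => mll ?_ (Nat.cast_nonneg _)
    have hg := (ords_finite T).mem_toFinset.1 hγ
    refine Real.exp_le_exp.2 (neg_le_neg ?_)
    rw [sq_le_one_iff_abs_le_one, abs_of_pos (div_pos hg.1 (by linarith)), div_le_one (by linarith)]
    exact hg.2.1
  have h4 : (1:ℝ) ≤ exp (-1) * 3 := by
    rw [exp_neg, inv_mul_eq_div, le_div_iff₀ (exp_pos _)]; linarith [exp_one_lt_d9]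
  have h5 : (0:ℝ) ≤ zetaN T := Nat.cast_nonneg _
  nlinarith

lemma nextOrd_le {γ γ' : ℝ} (h : γ < γ') (hz : isZ γ') : nextOrd γ ≤ γ' :=
  csInf_le ⟨γ, fun _ hx => hx.1.le⟩ ⟨h, hz⟩

lemma pred_ex {γ h : ℝ} (hz : isZ γ) (hp : ∃ g, isZ g ∧ γ - h ≤ g ∧ g < γ) : ∃ g, isZ g ∧ γ - h ≤ g ∧ g < γ ∧ nextOrd g = γ := by
  have hf : {g : ℝ | isZ g ∧ γ - h ≤ g ∧ g < γ}.Finite := (zeros_finite (max |γ - h| |γ|)).subset fun g hg => ⟨by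
    rw [abs_le]
    constructor
    · linarith [neg_abs_le (γ - h), le_max_left |γ - h| |γ|, hg.2.1]
    · linarith [le_abs_self γ, le_max_right |γ - h| |γ|, hg.2.2], hg.1⟩
  obtain ⟨g, hg, hmax⟩ := Set.exists_max_image _ id hf hp
  refine ⟨g, hg.1, hg.2.1, hg.2.2, le_antisymm (nextOrd_le hg.2.2 hz) (le_csInf ⟨γ, hg.2.2, hz⟩ fun x hx => ?_)⟩
  by_contra hlt
  push Not at hlt
  have := hmax x ⟨hx.2, by linarith [hx.1, hg.2.1], hlt⟩
  simp only [id] at this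
  linarith [hx.1]

open Classical in
lemma Bd_sum {lam T : ℝ} (hh : 2 * π * lam / log T ≤ 1) :
    ∑ γ ∈ (ords_finite T).toFinset.filter (fun γ => 1 < γ ∧ Bd (2 * π * lam / log T) γ), ordMult γ ≤ 3 * Dcount lam T := by
  rw [Dcount_eq]
  obtain ⟨h, hhd⟩ : ∃ h, h = 2 * π * lam / log T := ⟨_, rfl⟩
  rw [← hhd] at hh ⊢
  obtain ⟨S, hS⟩ : ∃ S, S = (ords_finite T).toFinset := ⟨_, rfl⟩
  have hSm : ∀ γ, γ ∈ S ↔ γ ∈ zetaOrds T := fun γ => by rw [hS]; exact (ords_finite T).mem_toFinset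
  rw [← hS]
  have h1 : (S.filter (fun γ => 1 < γ ∧ ∃ g, isZ g ∧ γ - h ≤ g ∧ g < γ)).card ≤ (S.filter fun γ => nextOrd γ - γ ≤ h).card := by
    refine (Finset.card_le_card fun γ hγ => ?_).trans (Finset.card_image_le (f := nextOrd))
    rw [mem_filter, hSm] at hγ
    obtain ⟨g, g1, g2, g3, g4⟩ := pred_ex hγ.1.2.2 hγ.2.2
    rw [mem_image]
    refine ⟨g, ?_, g4⟩
    rw [mem_filter, hSm]
    exact ⟨⟨by linarith [hγ.2.1], by linarith [hγ.1.2.1], g1⟩, by linarith⟩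
  have h2 : (S.filter fun γ => nextOrd γ - γ ≤ h).card ≤ ∑ γ ∈ S, ((ordMult γ - 1) + if nextOrd γ - γ ≤ h then 1 else 0) := by
    rw [card_filter]
    exact sum_le_sum fun γ _ => Nat.le_add_left _ _
  have h3 : ∑ γ ∈ S.filter (fun γ => 1 < γ ∧ Bd h γ), ordMult γ ≤
      ∑ γ ∈ S, (2 * ((ordMult γ - 1) + if nextOrd γ - γ ≤ h then 1 else 0) + if (1 < γ ∧ ∃ g, isZ g ∧ γ - h ≤ g ∧ g < γ) then 1 else 0) := by
    rw [sum_filter]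
    refine sum_le_sum fun γ hγ => ?_
    rw [hSm] at hγ
    have hm := (isZ_iff γ).1 hγ.2.2
    split_ifs with c1 c2 c3 <;> try omega
    rcases c1.2 with hb | ⟨g, h1, h2, h3⟩
    · omega
    · exfalso
      rw [abs_le] at h3
      rcases lt_or_gt_of_ne h1 with hl | hl
      · rename_i c3
        exact c3 ⟨c1.1, g, h2, by linarith, hl⟩
      · exact c2 (by linarith [nextOrd_le hl h2])
  rw [sum_add_distrib, ← mul_sum, ← card_filter] at h3
  omega

open Classical in
lemma fG_upper (hRH : RiemannHypothesis) : ∃ K : ℝ, ∀ lam T : ℝ, 2 * π * lam / log T ≤ 1 → ∫ t, fG lam T t ∂zmu ≤ K + 6 * (Dcount lam T : ℝ) := by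
  obtain ⟨B1, hB1⟩ : ∃ B1, B1 = (zeros_finite 1).toFinset := ⟨_, rfl⟩
  refine ⟨((∑ γ ∈ B1, ordMult γ : ℕ) : ℝ), fun lam T hh => ?_⟩
  obtain ⟨h, hhd⟩ : ∃ h, h = 2 * π * lam / log T := ⟨_, rfl⟩
  have hsum := Bd_sum hh
  have hm : ∀ γ, γ ∈ (zeros_finite T).toFinset ↔ |γ| ≤ T ∧ isZ γ := fun γ => (zeros_finite T).mem_toFinset
  rw [zmu_le_sum (fG_int hRH lam T) (zeros_finite T).toFinset (fun γ hγ => ((hm γ).1 hγ).2)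
    (fun γ hz hn => Set.indicator_of_notMem (fun hc => hn ((hm γ).2 ⟨hc.1, hz⟩)) _)]
  obtain ⟨S, hS⟩ : ∃ S, S = (ords_finite T).toFinset.filter (fun γ => 1 < γ ∧ Bd (2 * π * lam / log T) γ) := ⟨_, rfl⟩
  rw [← hS] at hsum
  have hSm : ∀ γ, γ ∈ S ↔ γ ∈ zetaOrds T ∧ 1 < γ ∧ Bd h γ := fun γ => by
    rw [hS, mem_filter, (ords_finite T).mem_toFinset, hhd]
  have h1 : ∑ γ ∈ (zeros_finite T).toFinset, (ordMult γ : ℝ) * fG lam T γ ≤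
      ∑ γ ∈ (zeros_finite T).toFinset.filter (Bd h), (ordMult γ : ℝ) := by
    rw [sum_filter]
    refine sum_le_sum fun γ hγ => ?_
    unfold fG
    by_cases hc : γ ∈ {t : ℝ | |t| ≤ T ∧ 1 < Nh (2 * π * lam / log T) t}
    · rw [Set.indicator_of_mem hc, if_pos (hhd ▸ Bd_of_Nh hRH ((hm γ).1 hγ).2 hc.2)]; simp
    · rw [Set.indicator_of_notMem hc, mul_zero]; split_ifs <;> positivity
  refine h1.trans ?_
  have h2 : (zeros_finite T).toFinset.filter (Bd h) ⊆ B1 ∪ (S ∪ S.image Neg.neg) := by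
    intro γ hγ
    rw [mem_filter, hm] at hγ
    obtain ⟨⟨ht, hz⟩, hb⟩ := hγ
    rw [abs_le] at ht
    rw [mem_union, mem_union]
    by_cases h1 : |γ| ≤ 1
    · left; rw [hB1]; exact (zeros_finite 1).mem_toFinset.2 ⟨h1, hz⟩
    · right
      rw [not_le, lt_abs] at h1
      rcases h1 with h1 | h1
      · left; rw [hSm]; exact ⟨⟨by linarith, ht.2, hz⟩, h1, hb⟩
      · right; rw [mem_image]
        exact ⟨-γ, by rw [hSm]; exact ⟨⟨by linarith, by linarith, isZ_neg hz⟩, h1, Bd_neg hb⟩, neg_neg γ⟩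
  have h3 : ∑ γ ∈ (zeros_finite T).toFinset.filter (Bd h), ordMult γ ≤ ∑ γ ∈ B1, ordMult γ + 6 * Dcount lam T := by
    have e1 := sum_union_inter (s₁ := B1) (s₂ := S ∪ S.image Neg.neg) (f := ordMult)
    have e2 := sum_union_inter (s₁ := S) (s₂ := S.image Neg.neg) (f := ordMult)
    rw [sum_image (g := Neg.neg) (fun a _ b _ e => neg_injective e)] at e2
    simp only [ordMult_neg] at e2
    have e3 := Finset.sum_le_sum_of_subset (f := ordMult) h2
    omega
  exact_mod_cast h3

theorem D_low (hRH : RiemannHypothesis) {lam : ℝ} (hlam : 0 < lam) {r : ℝ → ℝ} (hr : memA lam r) (hc : 0 < cOf r) :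
    ∃ c, 0 < c ∧ ∀ᶠ T : ℝ in atTop, c ≤ Dprop lam T := by
  obtain ⟨c, hc0, hG⟩ := G_lower hRH hlam hr hc
  obtain ⟨K, hK⟩ := fG_upper hRH
  refine ⟨c / 252, by positivity, ?_⟩
  filter_upwards [hG, eventually_ge_atTop (max 8 (2 * K / c)), Real.tendsto_log_atTop.eventually_ge_atTop (max 1 (2 * π * lam))] with T g hT hL
  have hT8 := (le_max_left _ _).trans hT
  have hTK := (le_max_right _ _).trans hT
  have hL1 := (le_max_left _ _).trans hL
  have hL2 := (le_max_right _ _).trans hL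
  rw [div_le_iff₀ hc0] at hTK
  have h1 := g.trans (hK lam T (by rw [div_le_one (by linarith)]; exact hL2))
  have h2 := zetaN_le hRH hT8
  have hTL : T ≤ T * log T := by nlinarith
  have h4 := mll hTL hc0.le
  have h3 : c / 12 * (T * log T) ≤ Dcount lam T := by linarith
  have hD : (0:ℝ) < Dcount lam T := lt_of_lt_of_le (by positivity) h3
  have hN : (Dcount lam T : ℝ) ≤ zetaN T := by exact_mod_cast Dcount_le lam T
  unfold Dprop
  rw [le_div_iff₀ (by linarith)]
  have := mll h2 (by positivity : 0 ≤ c / 252)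
  linarith

/-- **Theorem (pair correlation, positive proportion form).** Assume RH. If `λ₀ > 0`,
`r ∈ 𝒜(λ₀)` and `c(λ₀; r) > 0`, then `D(λ₀, T) ≫ 1` for all sufficiently large `T`
(so `liminf_{T→∞} D(λ₀, T) > 0`), and consequently `μ_D ≤ λ₀`. -/
theorem D_pos_of_c_pos (hRH : RiemannHypothesis) (lam₀ : ℝ) (hlam₀ : 0 < lam₀)
    (r : ℝ → ℝ) (hr : memA lam₀ r) (hc : 0 < cOf r) :
    (∃ c₁ : ℝ, 0 < c₁ ∧ ∀ᶠ T : ℝ in atTop, c₁ ≤ Dprop lam₀ T) ∧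
      0 < atTop.liminf (fun T : ℝ => Dprop lam₀ T) := by
  obtain ⟨c, hc0, h⟩ := D_low hRH hlam₀ hr hc
  refine ⟨⟨c, hc0, h⟩, lt_of_lt_of_le hc0 (le_liminf_of_le ?_ h)⟩
  have hb : IsBoundedUnder (· ≤ ·) atTop (fun T : ℝ => Dprop lam₀ T) :=
    isBoundedUnder_of ⟨1, fun T => div_le_one_of_le₀ (by exact_mod_cast Dcount_le lam₀ T) (Nat.cast_nonneg _)⟩
  exact hb.isCoboundedUnder_ge
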